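/- Under the setup of the previous proposition, let in addition (X^N_i(t),V^N_i(t)), i = 1,…,N, be a solution of the topological Cucker–Smale N-agent system Ẋ^N_i = V^N_i, V̇^N_i = (1/N) Σ_j K(M(X^N_i,|X^N_i − X^N_j|)) (V^N_j − V^N_i) (with M(x,r) := (1/N)#{k : |X^N_k − x| ≤ r}, the equation holding for almost every t), with the same initial data (x_i,v_i). Then the distance δ(t) := max_{i=1,…,N} (|X^f_i(t) − X^N_i(t)| + |V^f_i(t) − V^N_i(t)|) satisfies δ(t) ≤ C(T) √(W₁(f₀, μ^N₀)) for all t ∈ [0,T], where C(T) depends only on T, R_x, R_v and ‖f₀‖_∞. -/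

import Mathlib

open MeasureTheory Metric Set
open scoped ENNReal

noncomputable section

/-- `M[ρ](x,r) = ∫_{|x'−x| ≤ r} ρ(x') dx'`. -/
def Mdens {d : ℕ} (ρ : EuclideanSpace ℝ (Fin d) → ℝ)
    (x : EuclideanSpace ℝ (Fin d)) (r : ℝ) : ℝ :=
  ∫ y in closedBall x r, ρ y

/-- The spatial marginal `Sf(x) = ∫ f(x,v) dv`. -/
def Smarg {d : ℕ} (f : EuclideanSpace ℝ (Fin d) × EuclideanSpace ℝ (Fin d) → ℝ)
    (x : EuclideanSpace ℝ (Fin d)) : ℝ :=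
  ∫ w, f (x, w)

/-- The interaction field
`W[ρ,f](x,v) = ∫ K(M[ρ](x,|x−y|)) (w−v) f(y,w) dy dw`. -/
def Wfield {d : ℕ} (K : ℝ → ℝ) (ρ : EuclideanSpace ℝ (Fin d) → ℝ)
    (f : EuclideanSpace ℝ (Fin d) × EuclideanSpace ℝ (Fin d) → ℝ)
    (x v : EuclideanSpace ℝ (Fin d)) : EuclideanSpace ℝ (Fin d) :=
  ∫ p : EuclideanSpace ℝ (Fin d) × EuclideanSpace ℝ (Fin d),
    (K (Mdens ρ x (dist x p.1)) * f p) • (p.2 - v)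

/-- The interaction field against a measure `ν`:
`W[ρ,ν](x,v) = ∫ K(M[ρ](x,|x−y|)) (w−v) dν(y,w)`. -/
def WfieldMeas {d : ℕ} (K : ℝ → ℝ) (ρ : EuclideanSpace ℝ (Fin d) → ℝ)
    (ν : Measure (EuclideanSpace ℝ (Fin d) × EuclideanSpace ℝ (Fin d)))
    (x v : EuclideanSpace ℝ (Fin d)) : EuclideanSpace ℝ (Fin d) :=
  ∫ p, K (Mdens ρ x (dist x p.1)) • (p.2 - v) ∂ν

/-- The `1`-Wasserstein distance, via duality with bounded `1`-Lipschitz functions. -/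
def W1 {E : Type*} [MeasurableSpace E] [PseudoMetricSpace E] (μ ν : Measure E) : ℝ :=
  sSup {a : ℝ | ∃ φ : E → ℝ, LipschitzWith 1 φ ∧ (∃ C : ℝ, ∀ x, |φ x| ≤ C) ∧
    a = (∫ x, φ x ∂μ) - ∫ x, φ x ∂ν}

/-- The empirical measure `(1/N) Σ_i δ_{x_i} δ_{v_i}` on phase space. -/
def empPair {d N : ℕ} (x v : Fin N → EuclideanSpace ℝ (Fin d)) :
    Measure (EuclideanSpace ℝ (Fin d) × EuclideanSpace ℝ (Fin d)) :=
  ((N : ℝ≥0∞))⁻¹ • ∑ i : Fin N, Measure.dirac (x i, v i)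

/-- A family `{f_t}_{t∈[0,T]}` of bounded probability densities, weakly continuous
in `t`, which is a weak solution of the topological Cucker–Smale equation with
initial datum `f₀`. -/
def IsWeakSolCS {d : ℕ} (K : ℝ → ℝ) (T : ℝ)
    (f₀ : EuclideanSpace ℝ (Fin d) × EuclideanSpace ℝ (Fin d) → ℝ)
    (f : ℝ → EuclideanSpace ℝ (Fin d) × EuclideanSpace ℝ (Fin d) → ℝ) : Prop :=
  (∀ t ∈ Set.Icc 0 T, Measurable (f t) ∧ (∀ p, 0 ≤ f t p) ∧ (∫ p, f t p) = 1) ∧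
  (∃ C : ℝ, ∀ t ∈ Set.Icc 0 T, ∀ᵐ p ∂volume, f t p ≤ C) ∧
  (∀ α : EuclideanSpace ℝ (Fin d) × EuclideanSpace ℝ (Fin d) → ℝ,
    Continuous α → (∃ C : ℝ, ∀ p, |α p| ≤ C) →
    ContinuousOn (fun t => ∫ p, α p * f t p) (Set.Icc 0 T)) ∧
  (∃ Z : ℝ → EuclideanSpace ℝ (Fin d) × EuclideanSpace ℝ (Fin d) →
      EuclideanSpace ℝ (Fin d) × EuclideanSpace ℝ (Fin d),
    (∀ p, Z 0 p = p) ∧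
    (∀ p, ∀ t ∈ Set.Icc 0 T,
      HasDerivWithinAt (fun τ => (Z τ p).1) ((Z t p).2) (Set.Icc 0 T) t ∧
      HasDerivWithinAt (fun τ => (Z τ p).2)
        (Wfield K (Smarg (f t)) (f t) (Z t p).1 (Z t p).2) (Set.Icc 0 T) t) ∧
    (∀ t ∈ Set.Icc 0 T,
      ∀ α : EuclideanSpace ℝ (Fin d) × EuclideanSpace ℝ (Fin d) → ℝ,
        Continuous α → (∃ C : ℝ, ∀ p, |α p| ≤ C) →
        (∫ p, α p * f t p) = ∫ p, α (Z t p) * f₀ p))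

/-- For a configuration `Y` of `N` points in `ℝ^d`, `M(p,r) = (1/N) #{k : |Y_k − p| ≤ r}`. -/
def Mpart {d N : ℕ} (Y : Fin N → EuclideanSpace ℝ (Fin d))
    (p : EuclideanSpace ℝ (Fin d)) (r : ℝ) : ℝ :=
  ((Finset.univ.filter fun k => dist (Y k) p ≤ r).card : ℝ) / N

/-- The topological Cucker–Smale interaction force on agent `i`. -/
def CSforce {d N : ℕ} (K : ℝ → ℝ)
    (Y W : Fin N → EuclideanSpace ℝ (Fin d)) (i : Fin N) :
    EuclideanSpace ℝ (Fin d) :=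
  (N : ℝ)⁻¹ • ∑ j : Fin N, K (Mpart Y (Y i) (dist (Y i) (Y j))) • (W j - W i)

set_option linter.unusedSectionVars false

/-- Baire-category argument: a `[0,∞]`-valued function on `[0,T]` with closed sublevel sets, whose
values on short intervals are comparable as soon as it is bounded there, cannot blow up. -/
theorem bounded_of_short_comparison {T h : ℝ} (hT : 0 < T) (hh : 0 < h) {m : ℝ → ℝ≥0∞}
    (hlsc : ∀ c, IsClosed {t ∈ Icc 0 T | m t ≤ c})
    (hcomp : ∀ α β : ℝ, 0 ≤ α → α < β → β ≤ T → β - α ≤ h →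
      (∃ S, S < ⊤ ∧ ∀ t ∈ Icc α β, m t ≤ S) → ∀ s ∈ Icc α β, ∀ t ∈ Icc α β, m s ≤ 2 * m t)
    (htop : ∀ α β : ℝ, 0 ≤ α → α < β → β ≤ T → (∀ t ∈ Ioo α β, m t = ⊤) →
      ∀ t ∈ Icc α β, m t = ⊤)
    (hFs : ∃ G : ℕ → Set ℝ, (∀ n, IsClosed (G n)) ∧ (⋃ n, G n) = {t ∈ Icc 0 T | m t = ⊤})
    (h0 : m 0 < ⊤) : ∃ S, S < ⊤ ∧ ∀ t ∈ Icc 0 T, m t ≤ S := by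
  classical
  set U : Set ℝ := {t | ∃ ε > 0, ∃ S, S < ⊤ ∧ ∀ s ∈ Icc 0 T, |s - t| < ε → m s ≤ S} with hU
  set V : Set ℝ := {t | ∃ ε > 0, ∀ s ∈ Icc 0 T, |s - t| < ε → m s = ⊤} with hV
  have hUo : IsOpen U := by
    rw [Metric.isOpen_iff]
    rintro t ⟨ε, hε, S, hS, h1⟩
    refine ⟨ε / 2, by positivity, fun y hy => ⟨ε / 2, by positivity, S, hS, fun s hs hsy => h1 s hs ?_⟩⟩
    rw [mem_ball, Real.dist_eq] at hy
    have := abs_sub_le s y t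
    linarith
  have hVo : IsOpen V := by
    rw [Metric.isOpen_iff]
    rintro t ⟨ε, hε, h1⟩
    refine ⟨ε / 2, by positivity, fun y hy => ⟨ε / 2, by positivity, fun s hs hsy => h1 s hs ?_⟩⟩
    rw [mem_ball, Real.dist_eq] at hy
    have := abs_sub_le s y t
    linarith
  have hUV : ∀ t ∈ Icc 0 T, t ∈ U → t ∈ V → False := by
    rintro t ht ⟨ε, hε, S, hS, h1⟩ ⟨ε', hε', h2⟩
    have e1 := h1 t ht (by simpa using hε)
    rw [h2 t ht (by simpa using hε')] at e1
    exact absurd e1 (not_le.2 hS)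
  have hcpt : ∀ a b : ℝ, 0 ≤ a → b ≤ T → Icc a b ⊆ U →
      ∃ S, S < ⊤ ∧ ∀ t ∈ Icc a b, m t ≤ S := by
    intro a b ha hb hab
    refine isCompact_Icc.induction_on (p := fun u => ∃ S, S < ⊤ ∧ ∀ s ∈ u, m s ≤ S)
        ⟨0, by simp, by simp⟩ ?_ ?_ ?_
    · rintro s t hst ⟨S, hS, h2⟩; exact ⟨S, hS, fun x hx => h2 x (hst hx)⟩
    · rintro s t ⟨S, hS, h2⟩ ⟨S', hS', h2'⟩
      refine ⟨max S S', max_lt hS hS', ?_⟩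
      rintro x (hx | hx)
      · exact (h2 x hx).trans (le_max_left _ _)
      · exact (h2' x hx).trans (le_max_right _ _)
    · intro t htt
      obtain ⟨ε, hε, S, hS, h1⟩ := hab htt
      refine ⟨Icc a b ∩ ball t ε, ?_, S, hS, fun s hs => h1 s ⟨ha.trans hs.1.1, hs.1.2.trans hb⟩
        (by simpa [Real.dist_eq] using hs.2)⟩
      exact Filter.inter_mem self_mem_nhdsWithin (mem_nhdsWithin_of_mem_nhds (ball_mem_nhds t hε))
  have hshort : ∀ α β : ℝ, 0 ≤ α → α < β → β ≤ T → β - α ≤ h → Ioo α β ⊆ U ∪ V →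
      ∀ s ∈ Icc α β, ∀ t ∈ Icc α β, m s ≤ 2 * m t := by
    intro α β hα hαβ hβ hlen hsub
    have hpre : IsPreconnected (Ioo α β) := isPreconnected_Ioo
    by_cases hVne : (Ioo α β ∩ V).Nonempty
    · by_cases hUne : (Ioo α β ∩ U).Nonempty
      · obtain ⟨t, ht, ht'⟩ := hpre U V hUo hVo hsub hUne hVne
        exact (hUV t ⟨hα.trans ht.1.le, ht.2.le.trans hβ⟩ ht'.1 ht'.2).elim
      · have : ∀ t ∈ Ioo α β, m t = ⊤ := by
          intro t ht
          rcases hsub ht with h1 | ⟨ε, hε, h1⟩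
          · exact (hUne ⟨t, ht, h1⟩).elim
          · exact h1 t ⟨hα.trans ht.1.le, ht.2.le.trans hβ⟩ (by simpa using hε)
        intro s _ t ht
        rw [htop α β hα hαβ hβ this t ht]
        simp
    · have hsubU : Ioo α β ⊆ U := fun t ht => (hsub ht).resolve_right fun hv => hVne ⟨t, ht, hv⟩
      have hc : (α + β) / 2 ∈ Ioo α β := ⟨by linarith, by linarith⟩
      set c := (α + β) / 2
      have hmc : m c < ⊤ := by
        obtain ⟨S, hS, h1⟩ := hcpt c c (hα.trans hc.1.le) (hc.2.le.trans hβ) (by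
          rw [Icc_self]; simpa using hsubU hc)
        exact (h1 c (by simp)).trans_lt hS
      have hin : ∀ s ∈ Ioo α β, m s ≤ 2 * m c := by
        intro s hs
        rcases lt_trichotomy s c with hsc | hsc | hsc
        · refine hcomp s c (hα.trans hs.1.le) hsc (hc.2.le.trans hβ) (by linarith [hs.1, hc.2])
            (hcpt s c (hα.trans hs.1.le) (hc.2.le.trans hβ) fun t ht => hsubU
              ⟨hs.1.trans_le ht.1, ht.2.trans_lt hc.2⟩) s (by simp [hsc.le]) c (by simp [hsc.le])
        · rw [hsc, two_mul]; exact le_self_add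
        · refine hcomp c s (hα.trans hc.1.le) hsc (hs.2.le.trans hβ) (by linarith [hs.2, hc.1])
            (hcpt c s (hα.trans hc.1.le) (hs.2.le.trans hβ) fun t ht => hsubU
              ⟨hc.1.trans_le ht.1, ht.2.trans_lt hs.2⟩) s (by simp [hsc.le]) c (by simp [hsc.le])
      refine hcomp α β hα hαβ hβ hlen ⟨2 * m c, ENNReal.mul_lt_top (by simp) hmc, ?_⟩
      have : Icc α β ⊆ {t ∈ Icc 0 T | m t ≤ 2 * m c} := by
        rw [← closure_Ioo hαβ.ne]
        exact closure_minimal (fun s hs => ⟨⟨hα.trans hs.1.le, hs.2.le.trans hβ⟩, hin s hs⟩)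
          (hlsc _)
      exact fun t ht => (this ht).2
  have hall : Icc 0 T ⊆ U ∪ V := by
    by_contra hne
    set F : Set ℝ := Icc 0 T \ (U ∪ V) with hF
    have hFc : IsClosed F := isClosed_Icc.sdiff (hUo.union hVo)
    have hFne : F.Nonempty := by
      obtain ⟨t, ht, ht'⟩ := not_subset.1 hne
      exact ⟨t, ht, ht'⟩
    obtain ⟨G, hGc, hG⟩ := hFs
    have : Nonempty F := hFne.to_subtype
    have : CompleteSpace F := hFc.completeSpace_coe
    have hbaire := nonempty_interior_of_iUnion_of_closed (X := F)
      (f := fun i : ℕ ⊕ ℕ => Subtype.val ⁻¹' (Sum.elim G (fun n : ℕ => {t ∈ Icc 0 T | m t ≤ (n : ℝ≥0∞)}) i))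
      (by
        rintro (n | n)
        · exact (hGc n).preimage continuous_subtype_val
        · exact (hlsc n).preimage continuous_subtype_val)
      (by
        refine eq_univ_of_forall fun t => ?_
        rw [mem_iUnion]
        by_cases ht : m t = ⊤
        · have : (t : ℝ) ∈ ⋃ n, G n := by rw [hG]; exact ⟨t.2.1, ht⟩
          obtain ⟨n, hn⟩ := mem_iUnion.1 this
          exact ⟨Sum.inl n, hn⟩
        · obtain ⟨n, hn⟩ := ENNReal.exists_nat_gt ht
          exact ⟨Sum.inr n, t.2.1, hn.le⟩)
    obtain ⟨i, ⟨τ, hτF⟩, hτ⟩ := hbaire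
    obtain ⟨ε, hε, hball⟩ := Metric.isOpen_iff.1 isOpen_interior _ hτ
    have hloc : ∀ t ∈ F, |t - τ| < ε → t ∈ Sum.elim G (fun n : ℕ => {t ∈ Icc 0 T | m t ≤ (n : ℝ≥0∞)}) i := by
      intro t ht htt
      have hmem : (⟨t, ht⟩ : F) ∈ ball ⟨τ, hτF⟩ ε := by
        rw [mem_ball, Subtype.dist_eq, Real.dist_eq]; exact htt
      have := interior_subset (hball hmem)
      exact this
    set ρ := min ε h with hρ
    have hρ0 : 0 < ρ := lt_min hε hh
    -- every nearby time is comparable with a nearby bad time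
    have hnear : ∀ t ∈ Icc 0 T, |t - τ| < ρ → ∃ s ∈ F, |s - τ| < ε ∧ m t ≤ 2 * m s ∧
        m s ≤ 2 * m t := by
      intro t ht htt
      by_cases htF : t ∈ F
      · exact ⟨t, htF, htt.trans_le (min_le_left _ _), by rw [two_mul]; exact le_self_add,
          by rw [two_mul]; exact le_self_add⟩
      · have hne : t ≠ τ := fun h => htF (h ▸ hτF)
        rcases lt_or_gt_of_ne hne with hlt | hgt
        · have hcF : IsClosed (F ∩ Icc t τ) := hFc.inter isClosed_Icc
          obtain ⟨hsF, hsI⟩ := hcF.csInf_mem ⟨τ, hτF, hlt.le, le_rfl⟩ ⟨t, fun y hy => hy.2.1⟩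
          set s := sInf (F ∩ Icc t τ) with hs
          have hts : t < s := lt_of_le_of_ne hsI.1 fun h => htF (h ▸ hsF)
          rw [abs_of_neg (by linarith)] at htt
          have := min_le_left ε h
          have := min_le_right ε h
          have hc := hshort t s ht.1 hts (hsF.1.2) (by linarith [hsI.2]) (by
            intro y hy
            by_contra hyU
            have : s ≤ y := csInf_le ⟨t, fun y hy => hy.2.1⟩
              ⟨⟨⟨ht.1.trans hy.1.le, hy.2.le.trans hsF.1.2⟩, hyU⟩, hy.1.le, hy.2.le.trans hsI.2⟩
            linarith [hy.2])
          refine ⟨s, hsF, ?_, hc t (by simp [hts.le]) s (by simp [hts.le]),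
            hc s (by simp [hts.le]) t (by simp [hts.le])⟩
          rw [abs_lt]; constructor <;> linarith [hsI.2]
        · have hcF : IsClosed (F ∩ Icc τ t) := hFc.inter isClosed_Icc
          obtain ⟨hsF, hsI⟩ := hcF.csSup_mem ⟨τ, hτF, le_rfl, hgt.le⟩ ⟨t, fun y hy => hy.2.2⟩
          set s := sSup (F ∩ Icc τ t) with hs
          have hts : s < t := lt_of_le_of_ne hsI.2 fun h => htF (h ▸ hsF)
          rw [abs_of_pos (by linarith)] at htt
          have := min_le_left ε h
          have := min_le_right ε h
          have hc := hshort s t hsF.1.1 hts ht.2 (by linarith [hsI.1]) (by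
            intro y hy
            by_contra hyU
            have : y ≤ s := le_csSup ⟨t, fun y hy => hy.2.2⟩
              ⟨⟨⟨hsF.1.1.trans hy.1.le, hy.2.le.trans ht.2⟩, hyU⟩, hsI.1.trans hy.1.le, hy.2.le⟩
            linarith [hy.1])
          refine ⟨s, hsF, ?_, hc t (by simp [hts.le]) s (by simp [hts.le]),
            hc s (by simp [hts.le]) t (by simp [hts.le])⟩
          rw [abs_lt]; constructor <;> linarith [hsI.1]
    refine hτF.2 ?_
    rcases i with n | n
    · right
      refine ⟨ρ, hρ0, fun t ht htt => ?_⟩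
      obtain ⟨s, hsF, hsε, -, h2⟩ := hnear t ht htt
      have h3 : s ∈ ⋃ n, G n := mem_iUnion.2 ⟨n, hloc s hsF hsε⟩
      rw [hG] at h3
      rw [h3.2, top_le_iff] at h2
      by_contra hmt
      exact (ENNReal.mul_lt_top (by simp) (lt_top_iff_ne_top.2 hmt)).ne h2
    · left
      refine ⟨ρ, hρ0, 2 * n, ENNReal.mul_lt_top (by simp) (by simp), fun t ht htt => ?_⟩
      obtain ⟨s, hsF, hsε, h2, -⟩ := hnear t ht htt
      have h3 : m s ≤ n := (hloc s hsF hsε).2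
      exact h2.trans (by gcongr)
  refine hcpt 0 T le_rfl le_rfl ?_
  have hpre : IsPreconnected (Icc 0 T) := isPreconnected_Icc
  have h0U : (0 : ℝ) ∈ U := by
    refine (hall ⟨le_rfl, hT.le⟩).resolve_right ?_
    rintro ⟨ε, hε, h1⟩
    exact h0.ne (h1 0 ⟨le_rfl, hT.le⟩ (by simpa using hε))
  intro t ht
  refine (hall ht).resolve_right fun htV => ?_
  obtain ⟨s, hs, hs'⟩ := hpre U V hUo hVo hall ⟨0, ⟨le_rfl, hT.le⟩, h0U⟩ ⟨t, ht, htV⟩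
  exact hUV s hs hs'.1 hs'.2

/-- Iterating a comparison on short intervals. -/
theorem le_two_pow_of_short_comparison {T h : ℝ} (hh : 0 < h) {m : ℝ → ℝ≥0∞}
    (hcomp : ∀ α β : ℝ, 0 ≤ α → α < β → β ≤ T → β - α ≤ h → m β ≤ 2 * m α) :
    ∀ t ∈ Icc 0 T, m t ≤ 2 ^ (⌈T / h⌉₊) * m 0 := by
  have step : ∀ n : ℕ, ∀ t ∈ Icc 0 T, t ≤ n * h → m t ≤ 2 ^ n * m 0 := by
    intro n
    induction n with
    | zero =>
      intro t ht htn
      have : t = 0 := le_antisymm (by simpa using htn) ht.1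
      simp [this]
    | succ n ih =>
      intro t ht htn
      push_cast at htn
      rcases le_or_gt t (n * h) with hle | hgt
      · refine (ih t ht hle).trans ?_
        gcongr
        · norm_num
        · omega
      · have h1 := ih (n * h) ⟨by positivity, hgt.le.trans ht.2⟩ le_rfl
        have h2 := hcomp (n * h) t (by positivity) hgt ht.2 (by linarith)
        calc m t ≤ 2 * m (n * h) := h2
          _ ≤ 2 * (2 ^ n * m 0) := by gcongr
          _ = _ := by ring
  intro t ht
  refine step _ t ht (ht.2.trans ?_)
  have := Nat.le_ceil (T / h)
  rwa [div_le_iff₀ hh] at this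

section Field

open Filter Topology

variable {E : Type*} [NormedAddCommGroup E] [InnerProductSpace ℝ E] [MeasurableSpace E]
  [BorelSpace E] [SecondCountableTopology E] [CompleteSpace E]

/-- The `μ`-mass of the points whose position lies in the closed ball of centre `x`, radius `r`. -/
def ballMass (μ : Measure (E × E)) (x : E) (r : ℝ) : ℝ := μ.real {q | dist q.1 x ≤ r}

/-- The alignment field generated by a measure on phase space. -/
def alignField (K : ℝ → ℝ) (μ : Measure (E × E)) (x v : E) : E :=
  ∫ q, K (ballMass μ x (dist x q.1)) • (q.2 - v) ∂μ

/-- Positive, decreasing and Lipschitz communication weights on `[0,1]`. -/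
structure IsWeight (K : ℝ → ℝ) (LK : NNReal) : Prop where
  pos : ∀ z ∈ Icc (0 : ℝ) 1, 0 < K z
  anti : AntitoneOn K (Icc (0 : ℝ) 1)
  lip : LipschitzOnWith LK K (Icc (0 : ℝ) 1)

section Basic

variable {K : ℝ → ℝ} {LK : NNReal} {μ : Measure (E × E)}

theorem ballMass_mem [IsProbabilityMeasure μ] (x : E) (r : ℝ) : ballMass μ x r ∈ Icc (0 : ℝ) 1 :=
  ⟨measureReal_nonneg, measureReal_le_one⟩

theorem ballMass_mono [IsFiniteMeasure μ] (x : E) : Monotone (ballMass μ x) := fun _ _ h =>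
  measureReal_mono fun _ hq => le_trans hq h

theorem ballMass_le_add [IsFiniteMeasure μ] {x y : E} {r δ : ℝ} (h : dist x y ≤ δ) :
    ballMass μ x r ≤ ballMass μ y (r + δ) :=
  measureReal_mono fun q (hq : dist q.1 x ≤ r) =>
    (dist_triangle q.1 x y).trans (add_le_add hq h)

theorem IsWeight.zero_pos (hK : IsWeight K LK) : 0 < K 0 := hK.pos 0 (by simp)

theorem IsWeight.le_zero (hK : IsWeight K LK) {z : ℝ} (hz : z ∈ Icc (0 : ℝ) 1) : K z ≤ K 0 :=
  hK.anti (by simp) hz hz.1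

theorem IsWeight.one_le (hK : IsWeight K LK) {z : ℝ} (hz : z ∈ Icc (0 : ℝ) 1) : K 1 ≤ K z :=
  hK.anti hz (by simp) hz.2

theorem IsWeight.abs_sub_le (hK : IsWeight K LK) {z z' : ℝ} (hz : z ∈ Icc (0 : ℝ) 1)
    (hz' : z' ∈ Icc (0 : ℝ) 1) : |K z - K z'| ≤ LK * |z - z'| := by
  simpa [Real.dist_eq] using hK.lip.dist_le_mul z hz z' hz'

variable [IsProbabilityMeasure μ]

theorem measurable_weight (hK : IsWeight K LK) (x : E) :
    Measurable fun q : E × E => K (ballMass μ x (dist x q.1)) := by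
  have : Antitone fun r => K (ballMass μ x r) := fun r s h =>
    hK.anti (ballMass_mem x r) (ballMass_mem x s) (ballMass_mono x h)
  exact this.measurable.comp (by fun_prop)

theorem abs_weight_le (hK : IsWeight K LK) (x : E) (r : ℝ) : |K (ballMass μ x r)| ≤ K 0 := by
  rw [abs_of_pos (hK.pos _ (ballMass_mem x r))]
  exact hK.le_zero (ballMass_mem x r)

theorem integrable_snd (hm : ∫⁻ q, ‖q.2‖ₑ ∂μ < ⊤) : Integrable (fun q : E × E => q.2) μ :=
  ⟨measurable_snd.aestronglyMeasurable, hm⟩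

theorem integrable_weight_smul (hK : IsWeight K LK) (hm : ∫⁻ q, ‖q.2‖ₑ ∂μ < ⊤) (x v : E) :
    Integrable (fun q : E × E => K (ballMass μ x (dist x q.1)) • (q.2 - v)) μ :=
  ((integrable_snd hm).sub (integrable_const v)).bdd_smul (K 0)
    (measurable_weight hK x).aestronglyMeasurable
    (ae_of_all _ fun _ => abs_weight_le hK x _)

theorem integrable_weight (hK : IsWeight K LK) (x : E) :
    Integrable (fun q : E × E => K (ballMass μ x (dist x q.1))) μ :=
  Integrable.of_bound (C := K 0) (measurable_weight hK x).aestronglyMeasurable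
    (ae_of_all _ fun _ => abs_weight_le hK x _)

theorem norm_alignField_le (hK : IsWeight K LK) (hm : ∫⁻ q, ‖q.2‖ₑ ∂μ < ⊤) (x v : E) :
    ‖alignField K μ x v‖ ≤ K 0 * ((∫⁻ q, ‖q.2‖ₑ ∂μ).toReal + ‖v‖) := by
  have h1 : (∫⁻ q, ‖q.2‖ₑ ∂μ).toReal = ∫ q, ‖q.2‖ ∂μ := by
    rw [integral_norm_eq_lintegral_enorm measurable_snd.aestronglyMeasurable]
  have hi : Integrable (fun q : E × E => ‖q.2‖) μ := (integrable_snd hm).norm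
  calc ‖alignField K μ x v‖ ≤ ∫ q, K 0 * (‖q.2‖ + ‖v‖) ∂μ := by
        refine norm_integral_le_of_norm_le ((hi.add (integrable_const _)).const_mul _)
          (ae_of_all _ fun q => ?_)
        rw [norm_smul]
        exact mul_le_mul (abs_weight_le hK x _) (norm_sub_le _ _) (norm_nonneg _) hK.zero_pos.le
    _ = _ := by
        rw [integral_const_mul, integral_add hi (integrable_const _), h1]
        simp

theorem alignField_eq_zero (hK : IsWeight K LK) (hm : ∫⁻ q, ‖q.2‖ₑ ∂μ = ⊤) (x v : E) :
    alignField K μ x v = 0 := by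
  refine integral_undef fun hi => ?_
  have hK1 : 0 < K 1 := hK.pos 1 (by simp)
  have h1 : Integrable (fun q : E × E => q.2 - v) μ := by
    refine (hi.norm.const_mul (K 1)⁻¹).mono' (by fun_prop) (ae_of_all _ fun q => ?_)
    rw [norm_smul, Real.norm_of_nonneg (hK.pos _ (ballMass_mem x _)).le, ← mul_assoc]
    refine le_mul_of_one_le_left (norm_nonneg _) ?_
    rw [inv_mul_eq_div, one_le_div hK1]
    exact hK.one_le (ballMass_mem x _)
  have h2 : Integrable (fun q : E × E => q.2) μ := by
    exact (h1.add (integrable_const v)).congr (ae_of_all _ fun q => by simp)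
  exact h2.2.ne hm

theorem alignField_eq_sub (hK : IsWeight K LK) (hm : ∫⁻ q, ‖q.2‖ₑ ∂μ < ⊤) (x v : E) :
    alignField K μ x v =
      alignField K μ x 0 - (∫ q, K (ballMass μ x (dist x q.1)) ∂μ) • v := by
  rw [alignField, alignField, ← integral_smul_const, ← integral_sub
    (integrable_weight_smul hK hm x 0) ((integrable_weight hK x).smul_const v)]
  simp [smul_sub]

theorem integral_weight_mem (hK : IsWeight K LK) (x : E) :
    (∫ q, K (ballMass μ x (dist x q.1)) ∂μ) ∈ Icc (K 1) (K 0) := by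
  constructor
  · calc K 1 = ∫ _, K 1 ∂μ := by simp
      _ ≤ _ := integral_mono (integrable_const _) (integrable_weight hK x)
        (fun q => hK.one_le (ballMass_mem x _))
  · calc ∫ q, K (ballMass μ x (dist x q.1)) ∂μ ≤ ∫ _, K 0 ∂μ :=
          integral_mono (integrable_weight hK x) (integrable_const _)
            (fun q => hK.le_zero (ballMass_mem x _))
      _ = K 0 := by simp

end Basic

section Continuity

variable {K : ℝ → ℝ} {LK : NNReal} {μ₀ : Measure (E × E)} [IsProbabilityMeasure μ₀]

theorem ballMass_map {Z : E × E → E × E} (hZ : AEMeasurable Z μ₀) (x : E) (r : ℝ) :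
    ballMass (μ₀.map Z) x r = ∫ p, ({q | dist q.1 x ≤ r} : Set (E × E)).indicator 1 (Z p) ∂μ₀ := by
  have hs : MeasurableSet {q : E × E | dist q.1 x ≤ r} :=
    measurableSet_le (by fun_prop) measurable_const
  rw [ballMass, ← integral_indicator_one hs, integral_map hZ
    ((measurable_one.indicator hs).aestronglyMeasurable)]

theorem tendsto_ballMass {ι : Type*} {l : Filter ι} [l.IsCountablyGenerated]
    {Z : ι → E × E → E × E} {Z' : E × E → E × E} (hZ : ∀ᶠ i in l, AEMeasurable (Z i) μ₀)
    (hZ' : AEMeasurable Z' μ₀) (hlim : ∀ p, Tendsto (fun i => Z i p) l (𝓝 (Z' p)))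
    {x : ι → E} {x' : E} (hx : Tendsto x l (𝓝 x')) {r : ι → ℝ} {r' : ℝ}
    (hr : Tendsto r l (𝓝 r')) (hnull : μ₀.map Z' {q | dist q.1 x' = r'} = 0) :
    Tendsto (fun i => ballMass (μ₀.map (Z i)) (x i) (r i)) l
      (𝓝 (ballMass (μ₀.map Z') x' r')) := by
  have h1 : (fun i => ballMass (μ₀.map (Z i)) (x i) (r i)) =ᶠ[l]
      fun i => ∫ p, ({q | dist q.1 (x i) ≤ r i} : Set (E × E)).indicator (1 : E × E → ℝ)
        (Z i p) ∂μ₀ := by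
    filter_upwards [hZ] with i hi using ballMass_map hi _ _
  rw [ballMass_map hZ', tendsto_congr' h1]
  refine tendsto_integral_filter_of_dominated_convergence (fun _ => 1) ?_ ?_
    (integrable_const _) ?_
  · filter_upwards [hZ] with i hi
    exact ((measurable_one.indicator (measurableSet_le (by fun_prop)
      measurable_const)).comp_aemeasurable hi).aestronglyMeasurable
  · refine Eventually.of_forall fun i => ae_of_all _ fun p => ?_
    by_cases h : Z i p ∈ {q : E × E | dist q.1 (x i) ≤ r i} <;> simp [indicator, h]
  · rw [Measure.map_apply_of_aemeasurable hZ'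
      (measurableSet_eq_fun (by fun_prop) measurable_const)] at hnull
    have hae : ∀ᵐ p ∂μ₀, dist (Z' p).1 x' ≠ r' := by
      rw [ae_iff]; simpa using hnull
    filter_upwards [hae] with p hp
    have hd : Tendsto (fun i => dist (Z i p).1 (x i)) l (𝓝 (dist (Z' p).1 x')) :=
      ((continuous_fst.tendsto _).comp (hlim p)).dist hx
    refine tendsto_const_nhds.congr' ?_
    rcases lt_or_gt_of_ne hp with h | h
    · filter_upwards [hd.eventually_lt hr h] with i hi
      simp [indicator, h.le, hi.le]
    · filter_upwards [hr.eventually_lt hd h] with i hi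
      simp [indicator, h.not_ge, hi.not_ge]

theorem alignField_map (hK : IsWeight K LK) {Z : E × E → E × E} (hZ : AEMeasurable Z μ₀) (x v : E) :
    alignField K (μ₀.map Z) x v =
      ∫ p, K (ballMass (μ₀.map Z) x (dist x (Z p).1)) • ((Z p).2 - v) ∂μ₀ := by
  have := Measure.isProbabilityMeasure_map hZ
  rw [alignField, integral_map hZ]
  exact ((measurable_weight hK x).aestronglyMeasurable).smul (by fun_prop)

theorem tendsto_alignField (hK : IsWeight K LK) {ι : Type*} {l : Filter ι} [l.IsCountablyGenerated]
    {Z : ι → E × E → E × E} {Z' : E × E → E × E} (hZ : ∀ᶠ i in l, AEMeasurable (Z i) μ₀)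
    (hZ' : AEMeasurable Z' μ₀) (hlim : ∀ p, Tendsto (fun i => Z i p) l (𝓝 (Z' p)))
    {x v : ι → E} {x' v' : E} (hx : Tendsto x l (𝓝 x')) (hv : Tendsto v l (𝓝 v'))
    (hnull : ∀ r, μ₀.map Z' {q | dist q.1 x' = r} = 0)
    {b : E × E → ℝ} (hb : Integrable b μ₀) (hbound : ∀ᶠ i in l, ∀ᵐ p ∂μ₀, ‖(Z i p).2‖ ≤ b p) :
    Tendsto (fun i => alignField K (μ₀.map (Z i)) (x i) (v i)) l
      (𝓝 (alignField K (μ₀.map Z') x' v')) := by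
  have h1 : (fun i => alignField K (μ₀.map (Z i)) (x i) (v i)) =ᶠ[l]
      fun i => ∫ p, K (ballMass (μ₀.map (Z i)) (x i) (dist (x i) (Z i p).1)) •
        ((Z i p).2 - v i) ∂μ₀ := by
    filter_upwards [hZ] with i hi using alignField_map hK hi _ _
  rw [alignField_map hK hZ', tendsto_congr' h1]
  have := Measure.isProbabilityMeasure_map hZ'
  refine tendsto_integral_filter_of_dominated_convergence
    (fun p => K 0 * (b p + (‖v'‖ + 1))) ?_ ?_ ((hb.add (integrable_const _)).const_mul _) ?_
  · filter_upwards [hZ] with i hi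
    have := Measure.isProbabilityMeasure_map hi
    exact ((measurable_weight hK (x i)).comp_aemeasurable hi).aestronglyMeasurable.smul
      (((measurable_snd.comp_aemeasurable hi).sub_const _).aestronglyMeasurable)
  · have hv1 : ∀ᶠ i in l, ‖v i‖ < ‖v'‖ + 1 := hv.norm.eventually_lt_const (by linarith)
    filter_upwards [hZ, hbound, hv1] with i hi hbi hvi
    have := Measure.isProbabilityMeasure_map hi
    filter_upwards [hbi] with p hp
    rw [norm_smul]
    refine mul_le_mul (abs_weight_le hK _ _) ((norm_sub_le _ _).trans (add_le_add hp hvi.le))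
      (norm_nonneg _) hK.zero_pos.le
  · refine ae_of_all _ fun p => Tendsto.smul ?_ (((continuous_snd.tendsto _).comp (hlim p)).sub hv)
    have h2 := tendsto_ballMass hZ hZ' hlim hx
      (hx.dist ((continuous_fst.tendsto _).comp (hlim p))) (hnull _)
    refine ((hK.lip.continuousOn _ (ballMass_mem _ _)).tendsto).comp
      (tendsto_nhdsWithin_iff.2 ⟨h2, ?_⟩)
    filter_upwards [hZ] with i hi
    have := Measure.isProbabilityMeasure_map hi
    exact ballMass_mem _ _

end Continuity

end Field

section Flow

open Filter Topology

variable {E : Type*} [NormedAddCommGroup E] [InnerProductSpace ℝ E] [FiniteDimensional ℝ E]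
  [MeasureSpace E] [BorelSpace E] [(volume : Measure E).IsAddHaarMeasure]

/-- A self-consistent characteristic flow whose laws have uniformly bounded densities. -/
structure IsFlow (K : ℝ → ℝ) (T : ℝ) (μ₀ : Measure (E × E)) (Z : ℝ → E × E → E × E) : Prop where
  zero : ∀ p, Z 0 p = p
  aemeas : ∀ t ∈ Icc 0 T, AEMeasurable (Z t) μ₀
  fst : ∀ p, ∀ t ∈ Icc 0 T, HasDerivWithinAt (fun τ => (Z τ p).1) (Z t p).2 (Icc 0 T) t
  snd : ∀ p, ∀ t ∈ Icc 0 T, HasDerivWithinAt (fun τ => (Z τ p).2)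
    (alignField K (μ₀.map (Z t)) (Z t p).1 (Z t p).2) (Icc 0 T) t
  dens : ∃ C : ℝ≥0∞, C ≠ ⊤ ∧ ∀ t ∈ Icc 0 T, μ₀.map (Z t) ≤ C • volume

theorem measure_sphere_prod [Nontrivial E] {μ : Measure (E × E)} {C : ℝ≥0∞}
    (hμ : μ ≤ C • volume) (x : E) (r : ℝ) : μ {q | dist q.1 x = r} = 0 := by
  have h1 : {q : E × E | dist q.1 x = r} = sphere x r ×ˢ univ := by
    ext q; simp [dist_eq_norm]
  refine le_antisymm ((hμ _).trans ?_) (zero_le)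
  rw [h1, Measure.smul_apply, Measure.volume_eq_prod, Measure.prod_prod,
    Measure.addHaar_sphere, zero_mul, smul_zero]

/-- The first velocity moment at time `t`. -/
def moment (μ₀ : Measure (E × E)) (Z : ℝ → E × E → E × E) (t : ℝ) : ℝ≥0∞ :=
  ∫⁻ p, ‖(Z t p).2‖ₑ ∂μ₀

variable {K : ℝ → ℝ} {LK : NNReal} {T : ℝ} {μ₀ : Measure (E × E)} [IsProbabilityMeasure μ₀]
  {Z : ℝ → E × E → E × E}

namespace IsFlow

theorem continuousOn (hZ : IsFlow K T μ₀ Z) (p : E × E) :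
    ContinuousOn (fun t => Z t p) (Icc 0 T) := fun t ht =>
  (hZ.fst p t ht).continuousWithinAt.prodMk (hZ.snd p t ht).continuousWithinAt

theorem moment_map (hZ : IsFlow K T μ₀ Z) {t : ℝ} (ht : t ∈ Icc 0 T) :
    ∫⁻ q, ‖q.2‖ₑ ∂(μ₀.map (Z t)) = moment μ₀ Z t :=
  lintegral_map' (by fun_prop) (hZ.aemeas t ht)

theorem isProbabilityMeasure_map (hZ : IsFlow K T μ₀ Z) {t : ℝ} (ht : t ∈ Icc 0 T) :
    IsProbabilityMeasure (μ₀.map (Z t)) := Measure.isProbabilityMeasure_map (hZ.aemeas t ht)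

theorem tendsto_seq (hZ : IsFlow K T μ₀ Z) {u : ℕ → ℝ} {t : ℝ} (hu : ∀ n, u n ∈ Icc 0 T)
    (hut : Tendsto u atTop (𝓝 t)) (p : E × E) :
    Tendsto (fun n => Z (u n) p) atTop (𝓝 (Z t p)) := by
  have ht : t ∈ Icc 0 T := isClosed_Icc.mem_of_tendsto hut (Eventually.of_forall hu)
  exact (hZ.continuousOn p t ht).tendsto.comp
    (tendsto_nhdsWithin_iff.2 ⟨hut, Eventually.of_forall hu⟩)

theorem isClosed_moment_le (hZ : IsFlow K T μ₀ Z) (c : ℝ≥0∞) :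
    IsClosed {t ∈ Icc 0 T | moment μ₀ Z t ≤ c} := by
  refine IsSeqClosed.isClosed fun u t hu hut => ?_
  have ht : t ∈ Icc 0 T := isClosed_Icc.mem_of_tendsto hut (Eventually.of_forall fun n => (hu n).1)
  refine ⟨ht, ?_⟩
  have h1 : ∀ p, liminf (fun n => ‖(Z (u n) p).2‖ₑ) atTop = ‖(Z t p).2‖ₑ := fun p =>
    ((continuous_enorm.comp continuous_snd).tendsto _ |>.comp
      (hZ.tendsto_seq (fun n => (hu n).1) hut p)).liminf_eq
  calc ∫⁻ p, ‖(Z t p).2‖ₑ ∂μ₀ = ∫⁻ p, liminf (fun n => ‖(Z (u n) p).2‖ₑ) atTop ∂μ₀ := by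
        simp_rw [h1]
    _ ≤ liminf (fun n => ∫⁻ p, ‖(Z (u n) p).2‖ₑ ∂μ₀) atTop :=
        lintegral_liminf_le' fun n => (hZ.aemeas _ (hu n).1).snd.enorm
    _ ≤ c := liminf_le_of_le (by isBoundedDefault) fun b hb => by
        obtain ⟨n, hn⟩ := hb.exists
        exact hn.trans (hu n).2

theorem norm_field_le (hK : IsWeight K LK) (hZ : IsFlow K T μ₀ Z) {t : ℝ} (ht : t ∈ Icc 0 T)
    {S : ℝ≥0∞} (hS : S < ⊤) (hm : moment μ₀ Z t ≤ S) (x v : E) :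
    ‖alignField K (μ₀.map (Z t)) x v‖ ≤ K 0 * (S.toReal + ‖v‖) := by
  have := hZ.isProbabilityMeasure_map ht
  refine (norm_alignField_le hK ((hZ.moment_map ht).trans_lt (hm.trans_lt hS)) x v).trans ?_
  have := hK.zero_pos
  rw [hZ.moment_map ht]
  gcongr
  exact hS.ne

theorem norm_velocity_le_of_short (hK : IsWeight K LK) (hZ : IsFlow K T μ₀ Z) {α β : ℝ}
    (hα : 0 ≤ α) (hβ : β ≤ T) (hlen : β - α ≤ (4 * K 0)⁻¹) {S : ℝ≥0∞} (hS : S < ⊤)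
    (hm : ∀ t ∈ Icc α β, moment μ₀ Z t ≤ S) (p : E × E) {s t : ℝ} (hs : s ∈ Icc α β) (ht : t ∈ Icc α β) :
    ‖(Z s p).2‖ ≤ 4 / 3 * ‖(Z t p).2‖ + S.toReal / 3 := by
  have hsub : Icc α β ⊆ Icc 0 T := Icc_subset_Icc hα hβ
  have hK0 := hK.zero_pos
  obtain ⟨τ, hτ, hmax⟩ := isCompact_Icc.exists_isMaxOn ⟨s, hs⟩
    (((continuous_snd.comp_continuousOn (hZ.continuousOn p)).mono hsub).norm)
  have h1 : ‖(Z τ p).2 - (Z t p).2‖ ≤ K 0 * (S.toReal + ‖(Z τ p).2‖) * ‖τ - t‖ := by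
    refine Convex.norm_image_sub_le_of_norm_hasDerivWithin_le
      (fun r hr => (hZ.snd p r (hsub hr)).mono hsub) (fun r hr => ?_) (convex_Icc α β) ht hτ
    refine (hZ.norm_field_le hK (hsub hr) hS (hm r hr) _ _).trans ?_
    gcongr
    exact hmax hr
  have h2 : ‖τ - t‖ ≤ (4 * K 0)⁻¹ := by
    rw [Real.norm_eq_abs, abs_le]
    constructor <;> linarith [hτ.1, hτ.2, ht.1, ht.2]
  have h3 : K 0 * (S.toReal + ‖(Z τ p).2‖) * ‖τ - t‖ ≤ (S.toReal + ‖(Z τ p).2‖) / 4 := by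
    calc _ ≤ K 0 * (S.toReal + ‖(Z τ p).2‖) * (4 * K 0)⁻¹ := by gcongr
      _ = _ := by field_simp
  have h4 := norm_sub_norm_le (Z τ p).2 (Z t p).2
  have h5 : ‖(Z s p).2‖ ≤ ‖(Z τ p).2‖ := hmax hs
  linarith

theorem moment_le_of_short (hK : IsWeight K LK) (hZ : IsFlow K T μ₀ Z) {α β : ℝ}
    (hα : 0 ≤ α) (hβ : β ≤ T) (hlen : β - α ≤ (4 * K 0)⁻¹)
    (hS : ∃ S, S < ⊤ ∧ ∀ t ∈ Icc α β, moment μ₀ Z t ≤ S) :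
    ∀ s ∈ Icc α β, ∀ t ∈ Icc α β, moment μ₀ Z s ≤ 2 * moment μ₀ Z t := by
  obtain ⟨S₀, hS₀, hm₀⟩ := hS
  intro s hs t ht
  set S := ⨆ r ∈ Icc α β, moment μ₀ Z r with hSdef
  have hSle : S ≤ S₀ := iSup₂_le hm₀
  have hSfin : S < ⊤ := hSle.trans_lt hS₀
  have hm : ∀ r ∈ Icc α β, moment μ₀ Z r ≤ S := fun r hr => le_iSup₂ (f := fun r _ => moment μ₀ Z r) r hr
  have h1 : ∀ r ∈ Icc α β, moment μ₀ Z r ≤ ENNReal.ofReal (4 / 3) * moment μ₀ Z t + S / 3 := by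
    intro r hr
    calc moment μ₀ Z r ≤ ∫⁻ p, (ENNReal.ofReal (4 / 3) * ‖(Z t p).2‖ₑ + S / 3) ∂μ₀ := by
          refine lintegral_mono fun p => ?_
          have h2 := hZ.norm_velocity_le_of_short hK hα hβ hlen hSfin hm p hr ht
          have h3 := ENNReal.ofReal_le_ofReal h2
          rw [ofReal_norm, ENNReal.ofReal_add (by positivity) (by positivity),
            ENNReal.ofReal_mul (by norm_num), ofReal_norm,
            ENNReal.ofReal_div_of_pos (x := S.toReal) (by norm_num), ENNReal.ofReal_toReal hSfin.ne] at h3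
          simpa using h3
      _ = _ := by
          rw [lintegral_add_right _ measurable_const, lintegral_const_mul'' _
            (hZ.aemeas t ⟨hα.trans ht.1, ht.2.trans hβ⟩).snd.enorm]
          simp [moment]
  have h2 : S ≤ ENNReal.ofReal (4 / 3) * moment μ₀ Z t + S / 3 := iSup₂_le h1
  have hmt : moment μ₀ Z t ≠ ⊤ := ((hm t ht).trans_lt hSfin).ne
  refine (hm s hs).trans ?_
  rw [← ENNReal.toReal_le_toReal hSfin.ne (ENNReal.mul_ne_top (by simp) hmt)]
  have h3 := ENNReal.toReal_mono (by finiteness) h2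
  rw [ENNReal.toReal_add (by finiteness) (by finiteness), ENNReal.toReal_mul,
    ENNReal.toReal_ofReal (by norm_num), ENNReal.toReal_div] at h3
  rw [ENNReal.toReal_mul]
  norm_num at h3 ⊢
  linarith

theorem moment_eq_top_of_Ioo (hK : IsWeight K LK) (hZ : IsFlow K T μ₀ Z) {α β : ℝ}
    (hα : 0 ≤ α) (hαβ : α < β) (hβ : β ≤ T) (htop : ∀ t ∈ Ioo α β, moment μ₀ Z t = ⊤) :
    ∀ t ∈ Icc α β, moment μ₀ Z t = ⊤ := by
  have hsub : Icc α β ⊆ Icc 0 T := Icc_subset_Icc hα hβ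
  have hconst : ∀ p, ∀ t ∈ Icc α β, (Z t p).2 = (Z ((α + β) / 2) p).2 := by
    intro p
    set c := (α + β) / 2 with hc
    have hcI : c ∈ Ioo α β := ⟨by linarith, by linarith⟩
    have hIoo : ∀ t ∈ Ioo α β, (Z t p).2 = (Z c p).2 := by
      intro t ht
      have := Convex.norm_image_sub_le_of_norm_hasDerivWithin_le (C := 0)
        (fun r hr => (hZ.snd p r (hsub (Ioo_subset_Icc_self hr))).mono
          (Ioo_subset_Icc_self.trans hsub)) (fun r hr => ?_) (convex_Ioo α β) hcI ht
      · rw [zero_mul] at this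
        exact sub_eq_zero.1 (norm_le_zero_iff.1 this)
      · have hr' := hsub (Ioo_subset_Icc_self hr)
        have := hZ.isProbabilityMeasure_map hr'
        rw [alignField_eq_zero hK ((hZ.moment_map hr').trans (htop r hr)), norm_zero]
    have hcl : EqOn (fun t => (Z t p).2) (fun _ => (Z c p).2) (Icc α β) := by
      refine EqOn.of_subset_closure (s := Ioo α β) (t := Icc α β) hIoo
        ((continuous_snd.comp_continuousOn (hZ.continuousOn p)).mono hsub) continuousOn_const
        Ioo_subset_Icc_self ?_
      rw [closure_Ioo hαβ.ne]
    exact hcl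
  intro t ht
  rw [moment]
  simp only [hconst _ t ht]
  exact htop _ ⟨by linarith, by linarith⟩

end IsFlow

end Flow

section Nondegenerate

open Filter Topology

variable {E : Type*} [NormedAddCommGroup E] [InnerProductSpace ℝ E] [FiniteDimensional ℝ E]
  [MeasureSpace E] [BorelSpace E] [(volume : Measure E).IsAddHaarMeasure] [Nontrivial E]
  {K : ℝ → ℝ} {LK : NNReal}

theorem continuous_alignField (hK : IsWeight K LK) {μ : Measure (E × E)} [IsProbabilityMeasure μ]
    {C : ℝ≥0∞} (hμ : μ ≤ C • volume) (hm : ∫⁻ q, ‖q.2‖ₑ ∂μ < ⊤) :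
    Continuous fun q : E × E => alignField K μ q.1 q.2 := by
  rw [continuous_iff_continuousAt]
  intro q
  have := tendsto_alignField (l := 𝓝 q) (μ₀ := μ) (Z := fun _ => id) (Z' := id) hK
    (Eventually.of_forall fun _ => aemeasurable_id) aemeasurable_id
    (fun _ => tendsto_const_nhds) (continuous_fst.tendsto q) (continuous_snd.tendsto q)
    (fun r => by rw [Measure.map_id]; exact measure_sphere_prod hμ _ _)
    (integrable_snd hm).norm (Eventually.of_forall fun _ => ae_of_all _ fun _ => le_rfl)
  simp only [Measure.map_id] at this
  exact this

theorem volume_small_field_le (hK : IsWeight K LK) {μ : Measure (E × E)} [IsProbabilityMeasure μ]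
    {C : ℝ≥0∞} (hμ : μ ≤ C • volume) (hm : ∫⁻ q, ‖q.2‖ₑ ∂μ < ⊤) (R ε : ℝ) :
    volume {q : E × E | ‖q.1‖ ≤ R ∧ ‖alignField K μ q.1 q.2‖ < ε} ≤
      volume (closedBall (0 : E) R) * volume (ball (0 : E) (ε / K 1)) := by
  have hK1 : 0 < K 1 := hK.pos 1 (by simp)
  have hmeas : MeasurableSet {q : E × E | ‖q.1‖ ≤ R ∧ ‖alignField K μ q.1 q.2‖ < ε} :=
    (measurableSet_le (f := fun q : E × E => ‖q.1‖) (by fun_prop) measurable_const).inter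
      (measurableSet_lt (continuous_alignField hK hμ hm).norm.measurable measurable_const)
  rw [Measure.volume_eq_prod, Measure.prod_apply hmeas]
  calc _ ≤ ∫⁻ x, (closedBall (0 : E) R).indicator (fun _ => volume (ball (0 : E) (ε / K 1))) x := by
        refine lintegral_mono fun x => ?_
        by_cases hx : x ∈ closedBall (0 : E) R
        · rw [indicator_of_mem hx]
          set a := ∫ q, K (ballMass μ x (dist x q.1)) ∂μ with ha
          have haI : a ∈ Icc (K 1) (K 0) := integral_weight_mem hK x
          have ha0 : 0 < a := hK1.trans_le haI.1
          rw [← Measure.addHaar_ball_center (volume : Measure E) (a⁻¹ • alignField K μ x 0)]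
          refine measure_mono fun v hv => ?_
          have hv' : ‖alignField K μ x v‖ < ε := hv.2
          rw [alignField_eq_sub hK hm, ← ha] at hv'
          rw [mem_ball, dist_eq_norm, lt_div_iff₀ hK1, norm_sub_rev]
          calc _ ≤ ‖a⁻¹ • alignField K μ x 0 - v‖ * a := by gcongr; exact haI.1
            _ = ‖a • (a⁻¹ • alignField K μ x 0 - v)‖ := by
              rw [norm_smul, Real.norm_of_nonneg ha0.le, mul_comm]
            _ < ε := by rwa [smul_sub, smul_inv_smul₀ ha0.ne']
        · rw [indicator_of_notMem hx, nonpos_iff_eq_zero]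
          convert measure_empty (μ := (volume : Measure E))
          ext v
          simp only [mem_preimage, mem_ofPred_eq, mem_empty_iff_false, iff_false, not_and]
          intro h
          exact (hx (by simpa using h)).elim
    _ = _ := by
        rw [lintegral_indicator measurableSet_closedBall, setLIntegral_const, mul_comm]

variable {T : ℝ} {μ₀ : Measure (E × E)} [IsProbabilityMeasure μ₀] {Z : ℝ → E × E → E × E}

namespace IsFlow

theorem exists_tight (hZ : IsFlow K T μ₀ Z) :
    ∃ R : ℝ, ∀ t ∈ Icc 0 T, (μ₀.map (Z t)).real {q | ¬ ‖q.1‖ ≤ R} ≤ 1 / 4 := by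
  have hsm : ∀ t ∈ Icc 0 T, ∀ R : ℝ, AEStronglyMeasurable
      (fun p => min 1 (‖(Z t p).1‖ / R)) μ₀ := fun t ht R =>
    ((by fun_prop : Measurable fun q : E × E => min 1 (‖q.1‖ / R)).comp_aemeasurable
      (hZ.aemeas t ht)).aestronglyMeasurable
  have hb : ∀ t p, ∀ R : ℝ, 0 < R → ‖min 1 (‖(Z t p).1‖ / R)‖ ≤ 1 := fun t p R hR => by
    rw [Real.norm_of_nonneg (by positivity)]
    exact min_le_left _ _
  have key : ∃ R : ℝ, 0 < R ∧ ∀ t ∈ Icc 0 T, ∫ p, min 1 (‖(Z t p).1‖ / R) ∂μ₀ ≤ 1 / 4 := by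
    suffices h : ∃ R : ℝ, 0 < R ∧ ∀ t ∈ Icc 0 T, t ∈ Icc 0 T →
        ∫ p, min 1 (‖(Z t p).1‖ / R) ∂μ₀ ≤ 1 / 4 by
      obtain ⟨R, hR, h⟩ := h
      exact ⟨R, hR, fun t ht => h t ht ht⟩
    refine isCompact_Icc.induction_on (p := fun u => ∃ R : ℝ, 0 < R ∧ ∀ t ∈ u, t ∈ Icc 0 T →
      ∫ p, min 1 (‖(Z t p).1‖ / R) ∂μ₀ ≤ 1 / 4) ⟨1, one_pos, by simp⟩ ?_ ?_ ?_
    · rintro s t hst ⟨R, hR, h⟩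
      exact ⟨R, hR, fun x hx => h x (hst hx)⟩
    · rintro s t ⟨R, hR, h⟩ ⟨R', hR', h'⟩
      have hmono : ∀ r ∈ Icc 0 T, ∀ a b : ℝ, 0 < a → a ≤ b →
          ∫ p, min 1 (‖(Z r p).1‖ / b) ∂μ₀ ≤ ∫ p, min 1 (‖(Z r p).1‖ / a) ∂μ₀ := by
        intro r hr a b ha hab
        refine integral_mono (Integrable.of_bound (hsm r hr b) 1
          (ae_of_all _ fun p => hb r p b (ha.trans_le hab))) (Integrable.of_bound (hsm r hr a) 1
          (ae_of_all _ fun p => hb r p a ha)) fun p => ?_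
        exact min_le_min le_rfl (by gcongr)
      refine ⟨max R R', lt_max_of_lt_left hR, ?_⟩
      rintro r (hr | hr) hrI
      · exact (hmono r hrI _ _ hR (le_max_left _ _)).trans (h r hr hrI)
      · exact (hmono r hrI _ _ hR' (le_max_right _ _)).trans (h' r hr hrI)
    · intro t ht
      have hlim : Tendsto (fun n : ℕ => ∫ p, min 1 (‖(Z t p).1‖ / ((n : ℝ) + 1)) ∂μ₀) atTop
          (𝓝 (∫ _, (0 : ℝ) ∂μ₀)) := by
        refine tendsto_integral_of_dominated_convergence (fun _ => 1) (fun n => hsm t ht _)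
          (integrable_const _) (fun n => ae_of_all _ fun p => hb t p _ (by positivity))
          (ae_of_all _ fun p => ?_)
        have h1 : Tendsto (fun n : ℕ => ‖(Z t p).1‖ / ((n : ℝ) + 1)) atTop (𝓝 0) :=
          Tendsto.div_atTop tendsto_const_nhds
            (tendsto_atTop_add_const_right _ _ tendsto_natCast_atTop_atTop)
        simpa using (tendsto_const_nhds (x := (1 : ℝ))).min h1
      rw [integral_zero] at hlim
      obtain ⟨n, hn⟩ := (hlim.eventually_lt_const (by norm_num : (0 : ℝ) < 1 / 4)).exists
      have hcont : Tendsto (fun s => ∫ p, min 1 (‖(Z s p).1‖ / ((n : ℝ) + 1)) ∂μ₀)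
          (𝓝[Icc 0 T] t) (𝓝 (∫ p, min 1 (‖(Z t p).1‖ / ((n : ℝ) + 1)) ∂μ₀)) := by
        refine tendsto_integral_filter_of_dominated_convergence (fun _ => 1)
          (eventually_nhdsWithin_of_forall fun s hs => hsm s hs _)
          (Eventually.of_forall fun s => ae_of_all _ fun p => hb s p _ (by positivity))
          (integrable_const _) (ae_of_all _ fun p => ?_)
        exact ((by fun_prop : Continuous fun q : E × E => min 1 (‖q.1‖ / ((n : ℝ) + 1))).tendsto
          _).comp (hZ.continuousOn p t ht)
      exact ⟨_, hcont.eventually_lt_const hn, (n : ℝ) + 1, by positivity, fun s hs _ => hs.le⟩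
  obtain ⟨R, hR, h⟩ := key
  refine ⟨R, fun t ht => le_trans ?_ (h t ht)⟩
  have hmeas : MeasurableSet {q : E × E | ¬ ‖q.1‖ ≤ R} :=
    (measurableSet_le (f := fun q : E × E => ‖q.1‖) (by fun_prop) measurable_const).compl
  rw [measureReal_def, Measure.map_apply_of_aemeasurable (hZ.aemeas t ht) hmeas]
  have h2 := mul_meas_ge_le_integral_of_nonneg (μ := μ₀)
    (f := fun p => min 1 (‖(Z t p).1‖ / R)) (ae_of_all _ fun p => by positivity)
    (Integrable.of_bound (hsm t ht R) 1 (ae_of_all _ fun p => hb t p R hR)) 1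
  rw [one_mul] at h2
  refine le_trans (measureReal_mono fun p hp => ?_) h2
  have hp' : R < ‖(Z t p).1‖ := not_le.1 hp
  exact le_min le_rfl ((one_le_div hR).2 hp'.le)

theorem exists_field_lower_bound (hK : IsWeight K LK) (hZ : IsFlow K T μ₀ Z) :
    ∃ c : ℝ, 0 < c ∧ ∀ t ∈ Icc 0 T, moment μ₀ Z t ≠ ⊤ →
      c ≤ ∫ p, min 1 ‖alignField K (μ₀.map (Z t)) (Z t p).1 (Z t p).2‖ ∂μ₀ := by
  have hK1 : 0 < K 1 := hK.pos 1 (by simp)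
  obtain ⟨R, hR⟩ := hZ.exists_tight
  obtain ⟨C, hC, hdens⟩ := hZ.dens
  obtain ⟨ε, hε0, hε1, hε⟩ : ∃ ε : ℝ, 0 < ε ∧ ε ≤ 1 ∧
      C * (volume (closedBall (0 : E) R) * volume (ball (0 : E) (ε / K 1))) ≤
        ENNReal.ofReal (1 / 4) := by
    have hlim : Tendsto (fun ε : ℝ => C * (volume (closedBall (0 : E) R) *
        (ENNReal.ofReal ((ε / K 1) ^ Module.finrank ℝ E) * volume (ball (0 : E) 1)))) (𝓝[>] 0)
        (𝓝 (C * (volume (closedBall (0 : E) R) * (ENNReal.ofReal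
          ((0 / K 1) ^ Module.finrank ℝ E) * volume (ball (0 : E) 1))))) := by
      refine Tendsto.mono_left ?_ nhdsWithin_le_nhds
      refine ENNReal.Tendsto.const_mul (ENNReal.Tendsto.const_mul (ENNReal.Tendsto.mul_const
        (ENNReal.tendsto_ofReal ?_) (Or.inr measure_ball_lt_top.ne))
        (Or.inr measure_closedBall_lt_top.ne)) (Or.inr hC)
      exact (by fun_prop : Continuous fun ε : ℝ => (ε / K 1) ^ Module.finrank ℝ E).tendsto 0
    rw [zero_div, zero_pow Module.finrank_pos.ne'] at hlim
    simp only [ENNReal.ofReal_zero, zero_mul, mul_zero] at hlim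
    obtain ⟨ε, h1, h2, h3⟩ := ((hlim.eventually_le_const (u := ENNReal.ofReal (1 / 4))
      (by simp)).and ((eventually_mem_nhdsWithin).and (mem_nhdsWithin_of_mem_nhds
        (Iic_mem_nhds one_pos)))).exists
    refine ⟨ε, h2, h3, ?_⟩
    rwa [Measure.addHaar_ball _ _ (div_nonneg (le_of_lt h2) hK1.le)]
  refine ⟨ε * (1 / 2), by positivity, fun t ht hm => ?_⟩
  have := hZ.isProbabilityMeasure_map ht
  set μ := μ₀.map (Z t) with hμ
  have hm' : ∫⁻ q, ‖q.2‖ₑ ∂μ < ⊤ := by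
    rw [hμ, hZ.moment_map ht]; exact lt_top_iff_ne_top.2 hm
  have hcont := continuous_alignField hK (hdens t ht) hm'
  have h0 : Measurable fun q : E × E => min 1 ‖alignField K μ q.1 q.2‖ :=
    measurable_const.min hcont.norm.measurable
  have h1 : ∫ p, min 1 ‖alignField K μ (Z t p).1 (Z t p).2‖ ∂μ₀ =
      ∫ q, min 1 ‖alignField K μ q.1 q.2‖ ∂μ := by
    rw [hμ, integral_map (hZ.aemeas t ht) h0.aestronglyMeasurable]
  rw [h1]
  have hbad : μ.real {q | ‖q.1‖ ≤ R ∧ ‖alignField K μ q.1 q.2‖ < ε} ≤ 1 / 4 := by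
    refine ENNReal.toReal_le_of_le_ofReal (by norm_num) (le_trans ?_ hε)
    refine (hdens t ht _).trans ?_
    rw [Measure.smul_apply, smul_eq_mul]
    gcongr
    exact volume_small_field_le hK (hdens t ht) hm' R ε
  have hgood : 1 / 2 ≤ μ.real {q | ε ≤ min 1 ‖alignField K μ q.1 q.2‖} := by
    have hcover : (univ : Set (E × E)) ⊆ ({q | ¬ ‖q.1‖ ≤ R} ∪
        {q | ‖q.1‖ ≤ R ∧ ‖alignField K μ q.1 q.2‖ < ε}) ∪
        {q | ε ≤ min 1 ‖alignField K μ q.1 q.2‖} := by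
      intro q _
      by_cases hq : ‖q.1‖ ≤ R
      · by_cases hq' : ‖alignField K μ q.1 q.2‖ < ε
        · exact Or.inl (Or.inr ⟨hq, hq'⟩)
        · exact Or.inr (le_min hε1 (not_lt.1 hq'))
      · exact Or.inl (Or.inl hq)
    have h2 := (measureReal_mono (μ := μ) hcover).trans ((measureReal_union_le _ _).trans
      (add_le_add_left (measureReal_union_le _ _) _))
    rw [probReal_univ] at h2
    linarith [hR t ht]
  refine le_trans ?_ (mul_meas_ge_le_integral_of_nonneg (ae_of_all _ fun q => by positivity)
    (Integrable.of_bound h0.aestronglyMeasurable 1 (ae_of_all _ fun q => ?_)) ε)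
  · gcongr
  · rw [Real.norm_of_nonneg (by positivity)]
    exact min_le_left _ _

theorem exists_closed_cover (hK : IsWeight K LK) (hZ : IsFlow K T μ₀ Z) (hT : 0 < T) :
    ∃ G : ℕ → Set ℝ, (∀ n, IsClosed (G n)) ∧
      (⋃ n, G n) = {t ∈ Icc 0 T | moment μ₀ Z t = ⊤} := by
  obtain ⟨c, hc, hlow⟩ := hZ.exists_field_lower_bound hK
  set g : ℝ → ℝ → E × E → ℝ := fun s t p => min 1 (‖(Z s p).2 - (Z t p).2‖ / |s - t|) with hg
  have hgm : ∀ s ∈ Icc 0 T, ∀ t ∈ Icc 0 T, AEStronglyMeasurable (g s t) μ₀ := fun s hs t ht =>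
    (aemeasurable_const.min ((((hZ.aemeas s hs).snd.sub (hZ.aemeas t ht).snd).norm).div_const
      _)).aestronglyMeasurable
  have hgb : ∀ s t p, ‖g s t p‖ ≤ 1 := fun s t p => by
    rw [Real.norm_of_nonneg (by positivity)]
    exact min_le_left _ _
  have hlim : ∀ t ∈ Icc 0 T, Tendsto (fun s => ∫ p, g s t p ∂μ₀) (𝓝[Icc 0 T \ {t}] t)
      (𝓝 (∫ p, min 1 ‖alignField K (μ₀.map (Z t)) (Z t p).1 (Z t p).2‖ ∂μ₀)) := by
    intro t ht
    refine tendsto_integral_filter_of_dominated_convergence (fun _ => 1)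
      (eventually_nhdsWithin_of_forall fun s hs => hgm s hs.1 t ht)
      (Eventually.of_forall fun s => ae_of_all _ (hgb s t)) (integrable_const _)
      (ae_of_all _ fun p => ?_)
    have h1 := (hasDerivWithinAt_iff_tendsto_slope.1 (hZ.snd p t ht)).norm
    refine tendsto_const_nhds.min (h1.congr fun s => ?_)
    rw [slope_def_module, norm_smul, norm_inv, Real.norm_eq_abs, inv_mul_eq_div]
  have hne : ∀ t ∈ Icc 0 T, (𝓝[Icc 0 T \ {t}] t).NeBot := fun t ht =>
    accPt_principal_iff_nhdsWithin.1 (uniqueDiffWithinAt_iff_accPt.1 (uniqueDiffOn_Icc hT t ht))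
  refine ⟨fun n => {t ∈ Icc 0 T | ∀ s ∈ Icc 0 T, s ≠ t → |s - t| < 1 / ((n : ℝ) + 1) →
    ∫ p, g s t p ∂μ₀ ≤ c / 2}, fun n => IsSeqClosed.isClosed fun u t hu hut => ?_, ?_⟩
  · have ht : t ∈ Icc 0 T :=
      isClosed_Icc.mem_of_tendsto hut (Eventually.of_forall fun n => (hu n).1)
    refine ⟨ht, fun s hs hst hlt => ?_⟩
    have h1 : Tendsto (fun k => ∫ p, g s (u k) p ∂μ₀) atTop (𝓝 (∫ p, g s t p ∂μ₀)) := by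
      refine tendsto_integral_of_dominated_convergence (fun _ => 1)
        (fun k => hgm s hs _ (hu k).1) (integrable_const _)
        (fun k => ae_of_all _ (hgb s (u k))) (ae_of_all _ fun p => ?_)
      have h2 := hZ.tendsto_seq (fun k => (hu k).1) hut p
      exact tendsto_const_nhds.min (((tendsto_const_nhds.sub
        ((continuous_snd.tendsto _).comp h2)).norm).div (tendsto_const_nhds.sub hut).abs
        (abs_ne_zero.2 (sub_ne_zero.2 hst)))
    refine le_of_tendsto h1 ?_
    filter_upwards [(tendsto_const_nhds (x := s)).sub hut |>.abs |>.eventually_lt_const hlt,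
      hut.eventually_ne hst.symm] with k hk1 hk2
    exact (hu k).2 s hs hk2.symm hk1
  · ext t
    simp only [mem_iUnion, mem_ofPred_eq, exists_and_left]
    refine and_congr_right fun ht => ⟨?_, fun htop => ?_⟩
    · rintro ⟨n, hn⟩
      by_contra hfin
      have := hne t ht
      have h2 : ∫ p, min 1 ‖alignField K (μ₀.map (Z t)) (Z t p).1 (Z t p).2‖ ∂μ₀ ≤ c / 2 := by
        refine le_of_tendsto (hlim t ht) ?_
        have hball : ball t (1 / ((n : ℝ) + 1)) ∈ 𝓝[Icc 0 T \ {t}] t :=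
          mem_nhdsWithin_of_mem_nhds (ball_mem_nhds t (by positivity))
        filter_upwards [hball, self_mem_nhdsWithin] with s hs hs'
        exact hn s hs'.1 hs'.2 hs
      linarith [hlow t ht hfin]
    · have := hZ.isProbabilityMeasure_map ht
      have h3 := hlim t ht
      simp only [alignField_eq_zero hK ((hZ.moment_map ht).trans htop), norm_zero] at h3
      norm_num at h3
      have h4 := h3.eventually_le_const (half_pos hc)
      rw [eventually_nhdsWithin_iff, Metric.eventually_nhds_iff] at h4
      obtain ⟨ε, hε, h5⟩ := h4
      obtain ⟨n, hn⟩ := exists_nat_one_div_lt hε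
      exact ⟨n, fun s hs hst hlt => h5 (hlt.trans hn) ⟨hs, hst⟩⟩

/-- The first velocity moment stays finite, with an explicit bound. -/
theorem moment_le (hK : IsWeight K LK) (hZ : IsFlow K T μ₀ Z) (hT : 0 < T)
    (h0 : moment μ₀ Z 0 < ⊤) :
    ∀ t ∈ Icc 0 T, moment μ₀ Z t ≤ 2 ^ ⌈T / (4 * K 0)⁻¹⌉₊ * moment μ₀ Z 0 := by
  have hh : 0 < (4 * K 0)⁻¹ := by have := hK.zero_pos; positivity
  obtain ⟨S, hS, hm⟩ := bounded_of_short_comparison hT hh hZ.isClosed_moment_le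
    (fun α β hα _ hβ hlen hS => hZ.moment_le_of_short hK hα hβ hlen hS)
    (fun α β hα hαβ hβ htop => hZ.moment_eq_top_of_Ioo hK hα hαβ hβ htop)
    (hZ.exists_closed_cover hK hT) h0
  refine le_two_pow_of_short_comparison hh fun α β hα hαβ hβ hlen => ?_
  exact hZ.moment_le_of_short hK hα hβ hlen
    ⟨S, hS, fun t ht => hm t ⟨hα.trans ht.1, ht.2.trans hβ⟩⟩ β (by simp [hαβ.le]) α
    (by simp [hαβ.le])

end IsFlow

end Nondegenerate

section Radius

open Filter Topology

variable {E : Type*} [NormedAddCommGroup E] [InnerProductSpace ℝ E] [FiniteDimensional ℝ E]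
  [MeasureSpace E] [BorelSpace E] [(volume : Measure E).IsAddHaarMeasure] [Nontrivial E]
  {K : ℝ → ℝ} {LK : NNReal} {T : ℝ}

/-- A flow whose characteristics issued from `A`, a set of full measure, stay in a ball. -/
structure IsBoundedFlow (K : ℝ → ℝ) (T : ℝ) (μ₀ : Measure (E × E)) (Z : ℝ → E × E → E × E)
    (A : Set (E × E)) (R : ℝ) : Prop extends IsFlow K T μ₀ Z where
  ae_mem : ∀ᵐ p ∂μ₀, p ∈ A
  norm_le : ∀ p ∈ A, ∀ t ∈ Icc 0 T, ‖Z t p‖ ≤ R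

theorem norm_le_exp_of_norm_deriv_le {F : Type*} [NormedAddCommGroup F] [NormedSpace ℝ F]
    {g g' : ℝ → F} {a b : ℝ} (ha : 0 < a) (hb : 0 ≤ b)
    (hg : ∀ t ∈ Icc 0 T, HasDerivWithinAt g (g' t) (Icc 0 T) t)
    (hbound : ∀ t ∈ Icc 0 T, ‖g' t‖ ≤ a * ‖g t‖ + b) :
    ∀ t ∈ Icc 0 T, ‖g t‖ ≤ (‖g 0‖ + b / a) * Real.exp (a * T) := by
  intro t ht
  have h1 := norm_le_gronwallBound_of_norm_deriv_right_le (f := g) (f' := g') (δ := ‖g 0‖) (K := a)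
    (ε := b) (a := 0) (b := T) (fun s hs => (hg s hs).continuousWithinAt)
    (fun s hs => (hg s ⟨hs.1, hs.2.le⟩).mono_of_mem_nhdsWithin
      (mem_of_superset (Icc_mem_nhdsGE hs.2) (Icc_subset_Icc hs.1 le_rfl))) le_rfl
    (fun s hs => hbound s ⟨hs.1, hs.2.le⟩) t ht
  rw [gronwallBound_of_K_ne_0 ha.ne', sub_zero] at h1
  have h2 : Real.exp (a * t) ≤ Real.exp (a * T) := Real.exp_le_exp.2 (by gcongr; exact ht.2)
  have h3 : 0 ≤ b / a := by positivity
  have h4 := mul_le_mul_of_nonneg_left h2 (norm_nonneg (g 0))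
  have h5 := mul_le_mul_of_nonneg_left h2 h3
  nlinarith

theorem exists_radius (hK : IsWeight K LK) (hT : 0 < T) (Rx Rv : ℝ) (hRx : 0 < Rx) (hRv : 0 < Rv) :
    ∃ R : ℝ, 0 < R ∧ ∀ (μ₀ : Measure (E × E)) [IsProbabilityMeasure μ₀] (Z : ℝ → E × E → E × E),
      IsFlow K T μ₀ Z → (∀ᵐ p ∂μ₀, p ∈ closedBall (0 : E) Rx ×ˢ closedBall (0 : E) Rv) →
      IsBoundedFlow K T μ₀ Z (closedBall (0 : E) Rx ×ˢ closedBall (0 : E) Rv) R := by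
  have hK0 := hK.zero_pos
  set M : ℝ := 2 ^ ⌈T / (4 * K 0)⁻¹⌉₊ * Rv with hM
  have hM0 : 0 < M := by positivity
  set V : ℝ := (Rv + K 0 * M / K 0) * Real.exp (K 0 * T) with hV
  have hV0 : 0 < V := by positivity
  refine ⟨Rx + V * T + V, by positivity, fun μ₀ _ Z hZ hsupp => ⟨hZ, hsupp, fun p hp t ht => ?_⟩⟩
  have hm0 : moment μ₀ Z 0 ≤ ENNReal.ofReal Rv := by
    calc moment μ₀ Z 0 ≤ ∫⁻ _, ENNReal.ofReal Rv ∂μ₀ := by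
          refine lintegral_mono_ae ?_
          filter_upwards [hsupp] with p hp
          rw [hZ.zero, ← ofReal_norm]
          exact ENNReal.ofReal_le_ofReal (by simpa using hp.2)
      _ = _ := by simp
  have hm : ∀ s ∈ Icc 0 T, moment μ₀ Z s ≤ ENNReal.ofReal M := by
    intro s hs
    refine (hZ.moment_le hK hT (hm0.trans_lt ENNReal.ofReal_lt_top) s hs).trans ?_
    rw [hM, ENNReal.ofReal_mul (by positivity), ENNReal.ofReal_pow (by norm_num)]
    gcongr
    simp
  have hfield : ∀ s ∈ Icc 0 T, ‖alignField K (μ₀.map (Z s)) (Z s p).1 (Z s p).2‖ ≤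
      K 0 * ‖(Z s p).2‖ + K 0 * M := by
    intro s hs
    have := hZ.norm_field_le hK hs ENNReal.ofReal_lt_top (hm s hs) (Z s p).1 (Z s p).2
    rw [ENNReal.toReal_ofReal hM0.le] at this
    linarith
  have hp1 : ‖p.1‖ ≤ Rx := by simpa using hp.1
  have hp2 : ‖p.2‖ ≤ Rv := by simpa using hp.2
  have hv : ∀ s ∈ Icc 0 T, ‖(Z s p).2‖ ≤ V := by
    intro s hs
    refine (norm_le_exp_of_norm_deriv_le hK0 (by positivity) (hZ.snd p) hfield s hs).trans ?_
    rw [hZ.zero, hV]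
    gcongr
  have hx : ‖(Z t p).1 - (Z 0 p).1‖ ≤ V * ‖t - 0‖ :=
    Convex.norm_image_sub_le_of_norm_hasDerivWithin_le (hZ.fst p) hv (convex_Icc 0 T)
      ⟨le_rfl, hT.le⟩ ht
  rw [hZ.zero, sub_zero, Real.norm_of_nonneg ht.1] at hx
  have h1 := norm_sub_norm_le (Z t p).1 p.1
  have h2 : V * t ≤ V * T := by gcongr; exact ht.2
  rw [Prod.norm_def]
  refine max_le ?_ ?_
  · linarith
  · have := hv t ht
    have : 0 ≤ V * T := by positivity
    linarith

end Radius

section Shell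

open Filter Topology

variable {E : Type*} [NormedAddCommGroup E] [InnerProductSpace ℝ E] [FiniteDimensional ℝ E]
  [MeasureSpace E] [BorelSpace E]
  {K : ℝ → ℝ} {LK : NNReal} {T : ℝ}

/-- The mass of a ball centred in the ball of radius `R` is Lipschitz in the radius. -/
def ShellBound (μ : Measure (E × E)) (R L : ℝ) : Prop :=
  ∀ x : E, ‖x‖ ≤ R → ∀ r s : ℝ, 0 ≤ s → ballMass μ x (r + s) ≤ ballMass μ x r + L * s

theorem ShellBound.abs_sub_le {μ : Measure (E × E)} [IsFiniteMeasure μ] {R L : ℝ}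
    (h : ShellBound μ R L) {x x' : E} (hx' : ‖x'‖ ≤ R) {r r' δ : ℝ}
    (hr : |r - r'| ≤ δ) :
    |ballMass μ x r - ballMass μ x' r'| ≤ L * (dist x x' + δ) := by
  have hd : 0 ≤ dist x x' := dist_nonneg
  have hδ : 0 ≤ δ := (abs_nonneg _).trans hr
  obtain ⟨h1, h2⟩ := abs_le.1 hr
  rw [abs_le]
  constructor
  · have e1 := ballMass_mono (μ := μ) x' (show r' ≤ (r - dist x x') + (dist x x' + δ) by linarith)
    have e2 := h x' hx' (r - dist x x') (dist x x' + δ) (by positivity)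
    have e3 := ballMass_le_add (μ := μ) (x := x') (y := x) (r := r - dist x x') (dist_comm x' x).le
    rw [sub_add_cancel] at e3
    linarith
  · have e1 := ballMass_le_add (μ := μ) (r := r) (le_refl (dist x x'))
    have e2 := ballMass_mono (μ := μ) x' (show r + dist x x' ≤ r' + (dist x x' + δ) by linarith)
    have e3 := h x' hx' r' (dist x x' + δ) (by positivity)
    linarith

theorem pow_sub_pow_le_of_le {n : ℕ} {a b c : ℝ} (ha : 0 ≤ a) (hab : a ≤ b) (hbc : b ≤ c) :
    b ^ n - a ^ n ≤ n * c ^ (n - 1) * (b - a) := by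
  have := Convex.norm_image_sub_le_of_norm_hasDerivWithin_le (f := fun y : ℝ => y ^ n)
    (f' := fun y => n * y ^ (n - 1)) (s := Icc a b) (C := n * c ^ (n - 1))
    (fun y _ => (hasDerivAt_pow n y).hasDerivWithinAt) (fun y hy => ?_) (convex_Icc a b)
    (left_mem_Icc.2 hab) (right_mem_Icc.2 hab)
  · rw [Real.norm_of_nonneg (sub_nonneg.2 hab)] at this
    exact (le_abs_self _).trans this
  · have hy0 : 0 ≤ y := ha.trans hy.1
    rw [Real.norm_of_nonneg (by positivity)]
    gcongr
    exact hy.2.trans hbc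

theorem shellBound_of_le [Nontrivial E] [(volume : Measure E).IsAddHaarMeasure]
    {μ : Measure (E × E)} [IsFiniteMeasure μ] {C : ℝ≥0∞}
    (hC : C ≠ ⊤) (hμ : μ ≤ C • volume) {R : ℝ} (hR : 0 < R) (hsupp : ∀ᵐ q ∂μ, ‖q‖ ≤ R) :
    ShellBound μ R (C.toReal * ((volume : Measure E).real (closedBall 0 R) *
      (volume : Measure E).real (ball 0 1) *
      (Module.finrank ℝ E * (2 * R) ^ (Module.finrank ℝ E - 1)))) := by
  intro x hx r s hs
  set a := min (max r 0) (2 * R) with ha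
  set b := min (max (r + s) 0) (2 * R) with hb
  have ha0 : 0 ≤ a := le_min (le_max_right _ _) (by positivity)
  have hab : a ≤ b := by simp only [ha, hb]; gcongr; linarith
  have hbR : b ≤ 2 * R := min_le_right _ _
  have hba : b - a ≤ s := by
    have e1 : max (r + s) 0 ≤ max r 0 + s := by
      apply max_le <;> [linarith [le_max_left r 0]; linarith [le_max_right r 0]]
    have : b ≤ a + s := by
      rcases le_total (max r 0) (2 * R) with h | h
      · rw [ha, min_eq_left h]; exact (min_le_left _ _).trans e1
      · rw [ha, min_eq_right h]; linarith
    linarith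
  set D := closedBall x b \ ball x a with hD
  have hcover : μ {q | dist q.1 x ≤ r + s} ≤
      μ ({q | dist q.1 x ≤ r} ∪ D ×ˢ closedBall (0 : E) R) := by
    refine measure_mono_ae ?_
    filter_upwards [hsupp] with q hq hqr
    have hq1 : ‖q.1‖ ≤ R := (norm_fst_le q).trans hq
    have hq2 : ‖q.2‖ ≤ R := (norm_snd_le q).trans hq
    by_cases h : dist q.1 x ≤ r
    · exact Or.inl h
    · refine Or.inr ⟨⟨?_, fun h' => ?_⟩, by simpa using hq2⟩
      · refine le_min (le_max_of_le_left hqr) ?_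
        rw [dist_eq_norm]
        linarith [norm_sub_le q.1 x]
      · have h2 : dist q.1 x < max r 0 := (mem_ball.1 h').trans_le (min_le_left _ _)
        exact h2.not_ge (max_le (not_le.1 h).le dist_nonneg)
  have hvolD : (volume : Measure E).real D ≤ (volume : Measure E).real (ball 0 1) *
      (Module.finrank ℝ E * (2 * R) ^ (Module.finrank ℝ E - 1)) * s := by
    have hball : (volume : Measure E).real (ball x a) =
        a ^ Module.finrank ℝ E * (volume : Measure E).real (ball 0 1) := by
      rw [measureReal_def, Measure.addHaar_ball _ _ ha0, ENNReal.toReal_mul,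
        ENNReal.toReal_ofReal (by positivity), measureReal_def]
    rw [hD, measureReal_sdiff (ball_subset_closedBall.trans (closedBall_subset_closedBall hab))
      measurableSet_ball measure_closedBall_lt_top.ne,
      Measure.addHaar_real_closedBall _ _ (ha0.trans hab), hball, ← sub_mul, mul_comm, mul_assoc]
    refine mul_le_mul_of_nonneg_left ?_ measureReal_nonneg
    refine (pow_sub_pow_le_of_le ha0 hab hbR).trans ?_
    gcongr
  have hμD : μ.real (D ×ˢ closedBall (0 : E) R) ≤
      C.toReal * ((volume : Measure E).real D * (volume : Measure E).real (closedBall 0 R)) := by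
    have hfin : volume D ≠ ⊤ := ((measure_mono sdiff_subset).trans_lt measure_closedBall_lt_top).ne
    have h1 := ENNReal.toReal_mono (ENNReal.mul_ne_top hC (ENNReal.mul_ne_top hfin
      (measure_closedBall_lt_top (μ := (volume : Measure E)) (x := 0) (r := R)).ne)) <|
      (hμ (D ×ˢ closedBall (0 : E) R)).trans_eq (by
        rw [Measure.smul_apply, Measure.volume_eq_prod, Measure.prod_prod, smul_eq_mul])
    rwa [ENNReal.toReal_mul, ENNReal.toReal_mul] at h1
  have h1 : ballMass μ x (r + s) ≤ ballMass μ x r + μ.real (D ×ˢ closedBall (0 : E) R) :=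
    (ENNReal.toReal_mono (by finiteness) hcover).trans (measureReal_union_le _ _)
  refine h1.trans (add_le_add_right (hμD.trans ?_) _)
  rw [mul_assoc C.toReal]
  refine mul_le_mul_of_nonneg_left ?_ ENNReal.toReal_nonneg
  calc _ ≤ ((volume : Measure E).real (ball 0 1) *
      (Module.finrank ℝ E * (2 * R) ^ (Module.finrank ℝ E - 1)) * s) *
        (volume : Measure E).real (closedBall 0 R) := by gcongr
    _ = _ := by ring

end Shell

section Perturbation

open Filter Topology

variable {E : Type*} [NormedAddCommGroup E] [InnerProductSpace ℝ E] [FiniteDimensional ℝ E]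
  [MeasureSpace E] [BorelSpace E]
  {K : ℝ → ℝ} {LK : NNReal} {T : ℝ} {μ₀ : Measure (E × E)} [IsProbabilityMeasure μ₀]

theorem ballMass_map_le {Y Y' : E × E → E × E} (hY : AEMeasurable Y μ₀)
    (hY' : AEMeasurable Y' μ₀) {ρ : ℝ} (hρ : ∀ᵐ p ∂μ₀, ‖Y p - Y' p‖ ≤ ρ) (x : E) (r : ℝ) :
    ballMass (μ₀.map Y) x r ≤ ballMass (μ₀.map Y') x (r + ρ) := by
  have hm : ∀ r, MeasurableSet {q : E × E | dist q.1 x ≤ r} := fun r =>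
    measurableSet_le (f := fun q : E × E => dist q.1 x) (by fun_prop) measurable_const
  rw [ballMass, ballMass, measureReal_def, measureReal_def,
    Measure.map_apply_of_aemeasurable hY (hm _), Measure.map_apply_of_aemeasurable hY' (hm _)]
  refine ENNReal.toReal_mono (by finiteness) (measure_mono_ae ?_)
  filter_upwards [hρ] with p hp (hpr : dist (Y p).1 x ≤ r)
  have h1 : dist (Y' p).1 (Y p).1 ≤ ρ := by
    rw [dist_comm, dist_eq_norm, ← Prod.fst_sub]
    exact (norm_fst_le _).trans hp
  change dist (Y' p).1 x ≤ r + ρ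
  linarith [dist_triangle (Y' p).1 (Y p).1 x]

theorem moment_map_lt_top {Y : E × E → E × E} (hY : AEMeasurable Y μ₀) {R : ℝ}
    (hYR : ∀ᵐ p ∂μ₀, ‖Y p‖ ≤ R) : ∫⁻ q, ‖q.2‖ₑ ∂(μ₀.map Y) < ⊤ := by
  rw [lintegral_map' (by fun_prop) hY]
  refine lt_of_le_of_lt (b := ∫⁻ _, ENNReal.ofReal R ∂μ₀) (lintegral_mono_ae ?_) (by simp)
  filter_upwards [hYR] with p hp
  rw [← ofReal_norm]
  exact ENNReal.ofReal_le_ofReal ((norm_snd_le _).trans hp)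

theorem norm_alignField_map_sub_le (hK : IsWeight K LK) {Y Y' : E × E → E × E}
    (hY : AEMeasurable Y μ₀) (hY' : AEMeasurable Y' μ₀) {ρ R L : ℝ} (hL : 0 ≤ L)
    (hρ : ∀ᵐ p ∂μ₀, ‖Y p - Y' p‖ ≤ ρ) (hYR : ∀ᵐ p ∂μ₀, ‖Y p‖ ≤ R)
    (hYR' : ∀ᵐ p ∂μ₀, ‖Y' p‖ ≤ R) (hshell : ShellBound (μ₀.map Y') R L) {x x' v v' : E}
    (hx' : ‖x'‖ ≤ R) (hv' : ‖v'‖ ≤ R) :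
    ‖alignField K (μ₀.map Y) x v - alignField K (μ₀.map Y') x' v'‖ ≤
      K 0 * (ρ + ‖v - v'‖) + LK * (L * (2 * ‖x - x'‖ + 2 * ρ)) * (2 * R) := by
  have hp1 := Measure.isProbabilityMeasure_map hY
  have hp2 := Measure.isProbabilityMeasure_map hY'
  have hK0 := hK.zero_pos
  have hi1 : Integrable (fun p => K (ballMass (μ₀.map Y) x (dist x (Y p).1)) • ((Y p).2 - v)) μ₀ :=
    ((integrable_map_measure (by
      exact (integrable_weight_smul hK (moment_map_lt_top hY hYR) x v).1) hY).1
      (integrable_weight_smul hK (moment_map_lt_top hY hYR) x v))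
  have hi2 : Integrable
      (fun p => K (ballMass (μ₀.map Y') x' (dist x' (Y' p).1)) • ((Y' p).2 - v')) μ₀ :=
    ((integrable_map_measure (by
      exact (integrable_weight_smul hK (moment_map_lt_top hY' hYR') x' v').1) hY').1
      (integrable_weight_smul hK (moment_map_lt_top hY' hYR') x' v'))
  rw [alignField_map hK hY, alignField_map hK hY', ← integral_sub hi1 hi2]
  refine (norm_integral_le_of_norm_le_const (C := K 0 * (ρ + ‖v - v'‖) +
    LK * (L * (2 * ‖x - x'‖ + 2 * ρ)) * (2 * R)) ?_).trans (by simp)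
  have hρ' : ∀ᵐ p ∂μ₀, ‖Y' p - Y p‖ ≤ ρ := by
    filter_upwards [hρ] with p hp
    rwa [norm_sub_rev]
  filter_upwards [hρ, hYR'] with p hp hpR
  have hρ0 : 0 ≤ ρ := (norm_nonneg _).trans hp
  have hfst : ‖(Y p).1 - (Y' p).1‖ ≤ ρ := (norm_fst_le (Y p - Y' p)).trans hp
  have hsnd : ‖(Y p).2 - (Y' p).2‖ ≤ ρ := (norm_snd_le (Y p - Y' p)).trans hp
  set r := dist x (Y p).1 with hr
  set r' := dist x' (Y' p).1 with hr'
  have hd : |r - r'| ≤ ‖x - x'‖ + ρ := by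
    rw [hr, hr', ← dist_eq_norm]
    have := dist_dist_dist_le x (Y p).1 x' (Y' p).1
    rw [Real.dist_eq, dist_eq_norm (Y p).1] at this
    linarith
  obtain ⟨hd1, hd2⟩ := abs_le.1 hd
  have hmass : |ballMass (μ₀.map Y) x r - ballMass (μ₀.map Y') x' r'| ≤
      L * (2 * ‖x - x'‖ + 2 * ρ) := by
    have e1 := ballMass_map_le hY hY' hρ x r
    have e2 := ballMass_map_le hY' hY hρ' x (r - ρ)
    rw [sub_add_cancel] at e2
    have e3 := hshell.abs_sub_le (x := x) hx' (r := r + ρ) (r' := r') (δ := ‖x - x'‖ + 2 * ρ)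
      (abs_le.2 ⟨by linarith, by linarith⟩)
    have e4 := hshell.abs_sub_le (x := x) hx' (r := r - ρ) (r' := r') (δ := ‖x - x'‖ + 2 * ρ)
      (abs_le.2 ⟨by linarith, by linarith⟩)
    rw [dist_eq_norm] at e3 e4
    have e5 : ‖x - x'‖ + (‖x - x'‖ + 2 * ρ) = 2 * ‖x - x'‖ + 2 * ρ := by ring
    rw [e5] at e3 e4
    rw [abs_le] at *
    constructor <;> linarith [e3.1, e3.2, e4.1, e4.2]
  have hKd := (hK.abs_sub_le (ballMass_mem (μ := μ₀.map Y) x r)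
    (ballMass_mem (μ := μ₀.map Y') x' r')).trans
    (mul_le_mul_of_nonneg_left hmass LK.coe_nonneg)
  have hdecomp : K (ballMass (μ₀.map Y) x r) • ((Y p).2 - v) -
      K (ballMass (μ₀.map Y') x' r') • ((Y' p).2 - v') =
      K (ballMass (μ₀.map Y) x r) • (((Y p).2 - (Y' p).2) - (v - v')) +
      (K (ballMass (μ₀.map Y) x r) - K (ballMass (μ₀.map Y') x' r')) • ((Y' p).2 - v') := by
    module
  rw [hdecomp]
  refine (norm_add_le _ _).trans ?_
  rw [norm_smul, norm_smul]
  refine add_le_add (mul_le_mul (abs_weight_le hK x r) ((norm_sub_le _ _).trans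
    (add_le_add_left hsnd _)) (norm_nonneg _) hK0.le) (mul_le_mul hKd ?_ (norm_nonneg _)
    (by positivity))
  have := norm_snd_le (Y' p)
  linarith [norm_sub_le (Y' p).2 v']

end Perturbation

section Splitting

open Filter Topology

variable {E : Type*} [NormedAddCommGroup E] [InnerProductSpace ℝ E] [FiniteDimensional ℝ E]
  [MeasureSpace E] [BorelSpace E] [(volume : Measure E).IsAddHaarMeasure] [Nontrivial E]
  {K : ℝ → ℝ} {LK : NNReal}

/-- One step of the splitting scheme: update the velocity, then transport. -/
def splitStep (K : ℝ → ℝ) (μ : Measure (E × E)) (h : ℝ) (z : E × E) : E × E :=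
  (z.1 + h • (z.2 + h • alignField K μ z.1 z.2), z.2 + h • alignField K μ z.1 z.2)

theorem volume_preimage_shear (h : ℝ) {U : Set (E × E)} (hU : MeasurableSet U) :
    volume ((fun z : E × E => (z.1 + h • z.2, z.2)) ⁻¹' U) = volume U := by
  have hm : Measurable fun z : E × E => (z.1 + h • z.2, z.2) := by fun_prop
  rw [Measure.volume_eq_prod, Measure.prod_apply_symm (hm hU), Measure.prod_apply_symm hU]
  refine lintegral_congr fun v => ?_
  exact measure_preimage_add_right (volume : Measure E) (h • v) ((fun x => (x, v)) ⁻¹' U)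

theorem one_le_exp_two_mul {u : ℝ} (h0 : 0 ≤ u) (h1 : u ≤ 1 / 2) :
    1 ≤ Real.exp (2 * u) * (1 - u) := by
  have := Real.add_one_le_exp (2 * u)
  nlinarith

theorem map_splitStep_le (hK : IsWeight K LK) {μ : Measure (E × E)} [IsProbabilityMeasure μ]
    {C : ℝ≥0∞} (hμ : μ ≤ C • volume) (hm : ∫⁻ q, ‖q.2‖ₑ ∂μ < ⊤) {h : ℝ} (h0 : 0 ≤ h)
    (h1 : h * K 0 ≤ 1 / 2) :
    Measurable (splitStep K μ h) ∧ (volume : Measure (E × E)).map (splitStep K μ h) ≤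
      ENNReal.ofReal (Real.exp (2 * (h * K 0)) ^ Module.finrank ℝ E) • volume := by
  have hcont := continuous_alignField hK hμ hm
  have hG : Measurable fun z : E × E => (z.1, z.2 + h • alignField K μ z.1 z.2) := by
    have := hcont.measurable
    fun_prop
  have hSm : Measurable (splitStep K μ h) := by
    have := hcont.measurable
    unfold splitStep
    fun_prop
  refine ⟨hSm, Measure.le_iff.2 fun U hU => ?_⟩
  rw [Measure.map_apply hSm hU]
  have hsh : Measurable fun z : E × E => (z.1 + h • z.2, z.2) := by fun_prop
  set U' := (fun z : E × E => (z.1 + h • z.2, z.2)) ⁻¹' U with hU'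
  have hU'm : MeasurableSet U' := hsh hU
  have e1 : splitStep K μ h ⁻¹' U =
      (fun z : E × E => (z.1, z.2 + h • alignField K μ z.1 z.2)) ⁻¹' U' := rfl
  rw [Measure.smul_apply, ← volume_preimage_shear h hU, e1, Measure.volume_eq_prod,
    Measure.prod_apply (hG hU'm), Measure.prod_apply hU'm, smul_eq_mul,
    ← lintegral_const_mul' _ _ ENNReal.ofReal_ne_top]
  refine lintegral_mono fun x => ?_
  set a := ∫ q, K (ballMass μ x (dist x q.1)) ∂μ with ha
  have haI : a ∈ Icc (K 1) (K 0) := integral_weight_mem hK x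
  have hb : 1 - h * K 0 ≤ 1 - h * a := by
    have := mul_le_mul_of_nonneg_left haI.2 h0
    linarith
  have hb0 : 0 < 1 - h * a := by linarith
  have e2 : Prod.mk x ⁻¹' ((fun z : E × E => (z.1, z.2 + h • alignField K μ z.1 z.2)) ⁻¹' U') =
      ((1 - h * a) • ·) ⁻¹' ((· + h • alignField K μ x 0) ⁻¹' (Prod.mk x ⁻¹' U')) := by
    ext v
    simp only [mem_preimage]
    have : v + h • alignField K μ x v = (1 - h * a) • v + h • alignField K μ x 0 := by
      rw [alignField_eq_sub hK hm x v, ← ha]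
      module
    rw [this]
  rw [e2, Measure.addHaar_preimage_smul _ hb0.ne', measure_preimage_add_right]
  gcongr
  have hexp := one_le_exp_two_mul (mul_nonneg h0 hK.zero_pos.le) h1
  rw [abs_of_pos (by positivity), ← inv_pow]
  gcongr
  rw [inv_le_iff_one_le_mul₀ hb0]
  exact hexp.trans (by gcongr)

/-- Iterates of the splitting scheme along a sequence of measures. -/
def splitIter (K : ℝ → ℝ) (μ : ℕ → Measure (E × E)) (h : ℝ) : ℕ → E × E → E × E
  | 0 => id
  | k + 1 => splitStep K (μ k) h ∘ splitIter K μ h k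

theorem map_splitIter_le (hK : IsWeight K LK) {μ : ℕ → Measure (E × E)} {n : ℕ}
    (hprob : ∀ k < n, IsProbabilityMeasure (μ k))
    {C : ℝ≥0∞} (hμ : ∀ k < n, μ k ≤ C • volume) (hm : ∀ k < n, ∫⁻ q, ‖q.2‖ₑ ∂(μ k) < ⊤) {h : ℝ}
    (h0 : 0 ≤ h) (h1 : h * K 0 ≤ 1 / 2) :
    Measurable (splitIter K μ h n) ∧ (volume : Measure (E × E)).map (splitIter K μ h n) ≤
      ENNReal.ofReal (Real.exp (2 * (h * K 0)) ^ Module.finrank ℝ E) ^ n • volume := by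
  induction n with
  | zero => exact ⟨measurable_id, by simp [splitIter, Measure.map_id]⟩
  | succ n ih =>
    obtain ⟨i1, i2⟩ := ih (fun k hk => hprob k (by omega)) (fun k hk => hμ k (by omega))
      (fun k hk => hm k (by omega))
    have := hprob n (by omega)
    obtain ⟨s1, s2⟩ := map_splitStep_le hK (hμ n (by omega)) (hm n (by omega)) h0 h1
    refine ⟨s1.comp i1, ?_⟩
    rw [splitIter, ← Measure.map_map s1 i1]
    refine (Measure.map_mono i2 s1).trans ?_
    rw [Measure.map_smul, pow_succ, mul_smul]
    refine Measure.le_iff.2 fun U _ => ?_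
    rw [Measure.smul_apply, Measure.smul_apply, smul_eq_mul, smul_eq_mul]
    gcongr

end Splitting

section BoundedFlow

open Filter Topology

variable {E : Type*} [NormedAddCommGroup E] [InnerProductSpace ℝ E] [FiniteDimensional ℝ E]
  [MeasureSpace E] [BorelSpace E] [(volume : Measure E).IsAddHaarMeasure] [Nontrivial E]
  {K : ℝ → ℝ} {LK : NNReal} {T : ℝ} {μ₀ : Measure (E × E)} [IsProbabilityMeasure μ₀]
  {Z : ℝ → E × E → E × E} {A : Set (E × E)} {R L : ℝ}

theorem exists_shellBound_of_le {C : ℝ≥0∞} (hC : C ≠ ⊤) (hR : 0 < R) :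
    ∃ L : ℝ, 0 ≤ L ∧ ∀ (μ : Measure (E × E)) [IsFiniteMeasure μ], μ ≤ C • volume →
      (∀ᵐ q ∂μ, ‖q‖ ≤ R) → ShellBound μ R L :=
  ⟨_, by positivity, fun μ _ hμ hsupp => shellBound_of_le hC hμ hR hsupp⟩

namespace IsBoundedFlow

theorem ae_norm_le (hZ : IsBoundedFlow K T μ₀ Z A R) {t : ℝ} (ht : t ∈ Icc 0 T) :
    ∀ᵐ p ∂μ₀, ‖Z t p‖ ≤ R := by
  filter_upwards [hZ.ae_mem] with p hp using hZ.norm_le p hp t ht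

theorem norm_alignField_le (hK : IsWeight K LK) (hZ : IsBoundedFlow K T μ₀ Z A R) {t : ℝ}
    (ht : t ∈ Icc 0 T) {x v : E} (hv : ‖v‖ ≤ R) :
    ‖alignField K (μ₀.map (Z t)) x v‖ ≤ K 0 * (2 * R) := by
  have := hZ.isProbabilityMeasure_map ht
  rw [alignField_map hK (hZ.aemeas t ht)]
  refine (norm_integral_le_of_norm_le_const (C := K 0 * (2 * R)) ?_).trans (by simp)
  filter_upwards [hZ.ae_norm_le ht] with p hp
  rw [norm_smul]
  refine mul_le_mul (abs_weight_le hK _ _) ?_ (norm_nonneg _) hK.zero_pos.le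
  linarith [norm_sub_le (Z t p).2 v, norm_snd_le (Z t p)]

/-- The Lipschitz constant of the alignment field generated by a bounded flow. -/
def fieldLip (K : ℝ → ℝ) (LK : NNReal) (R L : ℝ) : ℝ := 2 * K 0 + 8 * LK * L * R

theorem fieldLip_pos (hK : IsWeight K LK) (hR : 0 < R) (hL : 0 ≤ L) : 0 < fieldLip K LK R L := by
  have := hK.zero_pos
  unfold fieldLip
  positivity

theorem norm_field_sub_le (hK : IsWeight K LK) (hZ : IsBoundedFlow K T μ₀ Z A R) (hR : 0 < R)
    (hL : 0 ≤ L) (hsh : ∀ t ∈ Icc 0 T, ShellBound (μ₀.map (Z t)) R L) {s t : ℝ}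
    (hs : s ∈ Icc 0 T) (ht : t ∈ Icc 0 T) {ρ : ℝ} (hρ : ∀ᵐ p ∂μ₀, ‖Z s p - Z t p‖ ≤ ρ)
    {z z' : E × E} (hz' : ‖z'‖ ≤ R) (hzρ : ‖z - z'‖ ≤ ρ) :
    ‖alignField K (μ₀.map (Z s)) z.1 z.2 - alignField K (μ₀.map (Z t)) z'.1 z'.2‖ ≤
      fieldLip K LK R L * ρ := by
  have hK0 := hK.zero_pos
  refine (norm_alignField_map_sub_le hK (hZ.aemeas s hs) (hZ.aemeas t ht) hL hρ
    (hZ.ae_norm_le hs) (hZ.ae_norm_le ht) (hsh t ht) ((norm_fst_le z').trans hz')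
    ((norm_snd_le z').trans hz')).trans ?_
  have h1 : ‖z.1 - z'.1‖ ≤ ρ := (norm_fst_le (z - z')).trans hzρ
  have h2 : ‖z.2 - z'.2‖ ≤ ρ := (norm_snd_le (z - z')).trans hzρ
  calc _ ≤ K 0 * (ρ + ρ) + LK * (L * (2 * ρ + 2 * ρ)) * (2 * R) := by gcongr
    _ = _ := by rw [fieldLip]; ring

theorem norm_sub_le (hK : IsWeight K LK) (hZ : IsBoundedFlow K T μ₀ Z A R) (hR : 0 < R)
    {p : E × E} (hp : p ∈ A) {s t : ℝ} (hs : s ∈ Icc 0 T) (ht : t ∈ Icc 0 T) :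
    ‖Z s p - Z t p‖ ≤ (R + K 0 * (2 * R)) * |s - t| := by
  have hK0 := hK.zero_pos
  have h1 := Convex.norm_image_sub_le_of_norm_hasDerivWithin_le (hZ.fst p)
    (fun u hu => (norm_snd_le _).trans (hZ.norm_le p hp u hu)) (convex_Icc 0 T) ht hs
  have h2 := Convex.norm_image_sub_le_of_norm_hasDerivWithin_le (hZ.snd p)
    (fun u hu => hZ.norm_alignField_le hK hu ((norm_snd_le _).trans (hZ.norm_le p hp u hu)))
    (convex_Icc 0 T) ht hs
  rw [Real.norm_eq_abs] at h1 h2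
  rw [Prod.norm_def]
  refine max_le (h1.trans ?_) (h2.trans ?_) <;>
  · gcongr
    nlinarith

theorem norm_splitStep_sub_le (hK : IsWeight K LK) (hZ : IsBoundedFlow K T μ₀ Z A R) (hR : 0 < R)
    (hL : 0 ≤ L) (hsh : ∀ t ∈ Icc 0 T, ShellBound (μ₀.map (Z t)) R L) {p : E × E} (hp : p ∈ A)
    {t h : ℝ} (ht : t ∈ Icc 0 T) (hth : t + h ∈ Icc 0 T) (h0 : 0 ≤ h) :
    ‖Z (t + h) p - splitStep K (μ₀.map (Z t)) h (Z t p)‖ ≤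
      (fieldLip K LK R L + 2) * (R + K 0 * (2 * R)) * h ^ 2 := by
  have hK0 := hK.zero_pos
  have hΛ := fieldLip_pos hK hR hL
  set Λ := fieldLip K LK R L
  set V := R + K 0 * (2 * R) with hV
  have hV0 : 0 < V := by positivity
  set F := alignField K (μ₀.map (Z t)) (Z t p).1 (Z t p).2 with hF
  have hFn : ‖F‖ ≤ V := (hZ.norm_alignField_le hK ht
    ((norm_snd_le _).trans (hZ.norm_le p hp t ht))).trans (by linarith)
  have hsub : Icc t (t + h) ⊆ Icc 0 T := Icc_subset_Icc ht.1 hth.2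
  have hlip : ∀ u ∈ Icc t (t + h), ‖Z u p - Z t p‖ ≤ V * h := fun u hu => by
    refine (hZ.norm_sub_le hK hR hp (hsub hu) ht).trans ?_
    rw [abs_of_nonneg (by linarith [hu.1])]
    gcongr
    linarith [hu.2]
  have hv := Convex.norm_image_sub_le_of_norm_hasDerivWithin_le (C := Λ * (V * h))
    (f := fun u => (Z u p).2 - (u - t) • F)
    (fun u hu => ((hZ.snd p u (hsub hu)).mono hsub).sub
      ((((hasDerivAt_id u).sub_const t).smul_const F).hasDerivWithinAt))
    (fun u hu => by
      rw [one_smul]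
      refine hZ.norm_field_sub_le hK hR hL hsh (hsub hu) ht ?_ (hZ.norm_le p hp t ht) (hlip u hu)
      filter_upwards [hZ.ae_mem] with q hq
      refine (hZ.norm_sub_le hK hR hq (hsub hu) ht).trans ?_
      rw [abs_of_nonneg (by linarith [hu.1])]
      gcongr
      linarith [hu.2])
    (convex_Icc t (t + h)) (left_mem_Icc.2 (by linarith)) (right_mem_Icc.2 (by linarith))
  have hx := Convex.norm_image_sub_le_of_norm_hasDerivWithin_le (C := 2 * V * h)
    (f := fun u => (Z u p).1 - (u - t) • ((Z t p).2 + h • F))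
    (fun u hu => ((hZ.fst p u (hsub hu)).mono hsub).sub
      ((((hasDerivAt_id u).sub_const t).smul_const ((Z t p).2 + h • F)).hasDerivWithinAt))
    (fun u hu => by
      rw [one_smul, ← sub_sub]
      refine (_root_.norm_sub_le _ _).trans ?_
      have e1 := (norm_snd_le (Z u p - Z t p)).trans (hlip u hu)
      rw [Prod.snd_sub] at e1
      have e2 : ‖h • F‖ ≤ h * V := by
        rw [norm_smul, Real.norm_of_nonneg h0]
        gcongr
      linarith)
    (convex_Icc t (t + h)) (left_mem_Icc.2 (by linarith)) (right_mem_Icc.2 (by linarith))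
  simp only [add_sub_cancel_left, sub_self, zero_smul, sub_zero, Real.norm_of_nonneg h0] at hv hx
  rw [Prod.norm_def]
  refine max_le ?_ ?_
  · have e : (Z (t + h) p - splitStep K (μ₀.map (Z t)) h (Z t p)).1 =
        (Z (t + h) p).1 - h • ((Z t p).2 + h • F) - (Z t p).1 := by
      simp only [splitStep, Prod.fst_sub, hF]
      abel
    rw [e]
    refine hx.trans ?_
    have : 0 ≤ Λ * V * h ^ 2 := by positivity
    nlinarith
  · have e : (Z (t + h) p - splitStep K (μ₀.map (Z t)) h (Z t p)).2 =
        (Z (t + h) p).2 - h • F - (Z t p).2 := by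
      simp only [splitStep, Prod.snd_sub, hF]
      abel
    rw [e]
    refine hv.trans ?_
    have : 0 ≤ V * h ^ 2 := by positivity
    nlinarith

theorem norm_splitStep_sub_splitStep_le (hK : IsWeight K LK) (hZ : IsBoundedFlow K T μ₀ Z A R)
    (hR : 0 < R) (hL : 0 ≤ L) (hsh : ∀ t ∈ Icc 0 T, ShellBound (μ₀.map (Z t)) R L)
    {t h : ℝ} (ht : t ∈ Icc 0 T) (h0 : 0 ≤ h) (hT : h ≤ T) {z z' : E × E} (hz' : ‖z'‖ ≤ R) :
    ‖splitStep K (μ₀.map (Z t)) h z' - splitStep K (μ₀.map (Z t)) h z‖ ≤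
      (1 + (1 + fieldLip K LK R L + T * fieldLip K LK R L) * h) * ‖z' - z‖ := by
  have hΛ := fieldLip_pos hK hR hL
  have hF := hZ.norm_field_sub_le hK hR hL hsh ht ht (ρ := ‖z - z'‖) (by simp) hz' le_rfl
  rw [norm_sub_rev, norm_sub_rev z] at hF
  set Λ := fieldLip K LK R L
  set e := ‖z' - z‖ with he
  have he0 : 0 ≤ e := norm_nonneg _
  set D := alignField K (μ₀.map (Z t)) z'.1 z'.2 - alignField K (μ₀.map (Z t)) z.1 z.2 with hD
  have h1 : ‖z'.1 - z.1‖ ≤ e := norm_fst_le (z' - z)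
  have h2 : ‖z'.2 - z.2‖ ≤ e := norm_snd_le (z' - z)
  have h3 : ‖(z'.2 - z.2) + h • D‖ ≤ e + h * (Λ * e) := by
    refine (norm_add_le _ _).trans ?_
    rw [norm_smul, Real.norm_of_nonneg h0]
    gcongr
  have hTh : h * h ≤ T * h := by gcongr
  have hTh' := mul_le_mul_of_nonneg_right hTh (mul_nonneg hΛ.le he0)
  rw [Prod.norm_def]
  refine max_le ?_ ?_
  · have e1 : (splitStep K (μ₀.map (Z t)) h z' - splitStep K (μ₀.map (Z t)) h z).1 =
        (z'.1 - z.1) + h • ((z'.2 - z.2) + h • D) := by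
      simp only [splitStep, Prod.fst_sub, hD]
      module
    rw [e1]
    refine (norm_add_le _ _).trans ?_
    rw [norm_smul, Real.norm_of_nonneg h0]
    have := mul_le_mul_of_nonneg_left h3 h0
    have : 0 ≤ h * (Λ * e) := by positivity
    nlinarith
  · have e1 : (splitStep K (μ₀.map (Z t)) h z' - splitStep K (μ₀.map (Z t)) h z).2 =
        (z'.2 - z.2) + h • D := by
      simp only [splitStep, Prod.snd_sub, hD]
      module
    rw [e1]
    refine h3.trans ?_
    have e2 : 0 ≤ h * e := by positivity
    have e3 : 0 ≤ T * (Λ * (h * e)) := mul_nonneg (h0.trans hT) (by positivity)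
    nlinarith

theorem norm_splitIter_sub_le (hK : IsWeight K LK) (hZ : IsBoundedFlow K T μ₀ Z A R) (hR : 0 < R)
    (hL : 0 ≤ L) (hsh : ∀ t ∈ Icc 0 T, ShellBound (μ₀.map (Z t)) R L) {p : E × E} (hp : p ∈ A)
    {h : ℝ} (h0 : 0 ≤ h) (n : ℕ) (hn : n * h ≤ T) :
    ‖Z (n * h) p - splitIter K (fun k => μ₀.map (Z (k * h))) h n p‖ ≤
      n * ((fieldLip K LK R L + 2) * (R + K 0 * (2 * R)) * h ^ 2) *
        Real.exp ((1 + fieldLip K LK R L + T * fieldLip K LK R L) * h * n) := by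
  have hK0 := hK.zero_pos
  have hΛ := fieldLip_pos hK hR hL
  induction n with
  | zero => simp [splitIter, hZ.zero]
  | succ n ih =>
    have hcast : ((n + 1 : ℕ) : ℝ) * h = n * h + h := by push_cast; ring
    rw [hcast] at hn
    have hnh : 0 ≤ n * h := by positivity
    have hT : 0 ≤ T := by linarith
    specialize ih (by linarith)
    have s1 := hZ.norm_splitStep_sub_le hK hR hL hsh hp (t := n * h) (h := h) ⟨hnh, by linarith⟩
      ⟨by linarith, hn⟩ h0
    have s2 := hZ.norm_splitStep_sub_splitStep_le hK hR hL hsh (t := n * h) (h := h)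
      (z := splitIter K (fun k => μ₀.map (Z (k * h))) h n p) ⟨hnh, by linarith⟩ h0 (by linarith)
      (hZ.norm_le p hp (n * h) ⟨hnh, by linarith⟩)
    rw [hcast]
    set c := (fieldLip K LK R L + 2) * (R + K 0 * (2 * R)) * h ^ 2 with hc
    have hc0 : 0 ≤ c := by positivity
    set Λ' := 1 + fieldLip K LK R L + T * fieldLip K LK R L with hΛ'
    have hΛ'0 : 0 ≤ Λ' := by positivity
    have e1 : 1 + Λ' * h ≤ Real.exp (Λ' * h) := by linarith [Real.add_one_le_exp (Λ' * h)]
    have e2 : (1 : ℝ) ≤ Real.exp (Λ' * h * (n + 1 : ℕ)) := Real.one_le_exp (by positivity)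
    have e3 : Real.exp (Λ' * h) * Real.exp (Λ' * h * n) = Real.exp (Λ' * h * (n + 1 : ℕ)) := by
      rw [← Real.exp_add]; congr 1; push_cast; ring
    calc _ ≤ c + (1 + Λ' * h) *
          ‖Z (n * h) p - splitIter K (fun k => μ₀.map (Z (k * h))) h n p‖ := by
          rw [splitIter, Function.comp_apply]
          exact (norm_sub_le_norm_sub_add_norm_sub _ _ _).trans (add_le_add s1 s2)
      _ ≤ c * Real.exp (Λ' * h * (n + 1 : ℕ)) +
          Real.exp (Λ' * h) * (n * c * Real.exp (Λ' * h * n)) := by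
          gcongr
          exact le_mul_of_one_le_right hc0 e2
      _ = _ := by
          rw [mul_left_comm (Real.exp (Λ' * h)), e3]; push_cast; ring

theorem tendsto_splitIter (hK : IsWeight K LK) (hZ : IsBoundedFlow K T μ₀ Z A R) (hR : 0 < R)
    (hL : 0 ≤ L) (hsh : ∀ t ∈ Icc 0 T, ShellBound (μ₀.map (Z t)) R L) {p : E × E} (hp : p ∈ A)
    {t : ℝ} (ht : t ∈ Icc 0 T) :
    Tendsto (fun n : ℕ => splitIter K (fun k => μ₀.map (Z (k * (t / n)))) (t / n) n p) atTop
      (𝓝 (Z t p)) := by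
  set c := (fieldLip K LK R L + 2) * (R + K 0 * (2 * R)) with hc
  set Λ' := 1 + fieldLip K LK R L + T * fieldLip K LK R L with hΛ'
  have hlim : Tendsto (fun n : ℕ => c * t ^ 2 * Real.exp (Λ' * t) * (1 / (n : ℝ))) atTop (𝓝 0) := by
    simpa using tendsto_one_div_atTop_nhds_zero_nat.const_mul (c * t ^ 2 * Real.exp (Λ' * t))
  rw [tendsto_iff_norm_sub_tendsto_zero]
  refine squeeze_zero' (Eventually.of_forall fun n => norm_nonneg _) ?_ hlim
  filter_upwards [eventually_ge_atTop 1] with n hn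
  have hn0 : (0 : ℝ) < n := by exact_mod_cast hn
  have e1 : n * (t / n) = t := by field_simp
  have := hZ.norm_splitIter_sub_le hK hR hL hsh hp (h := t / n) (div_nonneg ht.1 hn0.le) n
    (by rw [e1]; exact ht.2)
  rw [e1, norm_sub_rev] at this
  refine this.trans (le_of_eq ?_)
  rw [← hc, ← hΛ', mul_assoc Λ', div_mul_cancel₀ _ hn0.ne']
  field_simp

/-- Along the flow the density grows at most exponentially. -/
theorem map_le (hK : IsWeight K LK) (hZ : IsBoundedFlow K T μ₀ Z A R) (hR : 0 < R)
    {B : ℝ≥0∞} (hB : B ≠ ⊤) (hμ₀ : μ₀ ≤ B • volume) {t : ℝ} (ht : t ∈ Icc 0 T) :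
    μ₀.map (Z t) ≤
      (B * ENNReal.ofReal (Real.exp (2 * (T * K 0)) ^ Module.finrank ℝ E)) • volume := by
  have hK0 := hK.zero_pos
  obtain ⟨C, hC, hdens⟩ := hZ.dens
  obtain ⟨L, hL, hsh⟩ : ∃ L : ℝ, 0 ≤ L ∧ ∀ t ∈ Icc 0 T, ShellBound (μ₀.map (Z t)) R L := by
    obtain ⟨L, hL, h⟩ := exists_shellBound_of_le (E := E) hC hR
    refine ⟨L, hL, fun s hs => ?_⟩
    have := hZ.isProbabilityMeasure_map hs
    refine h _ (hdens s hs) ?_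
    rw [ae_map_iff (hZ.aemeas s hs) (measurableSet_le measurable_norm measurable_const)]
    exact hZ.ae_norm_le hs
  set D := B * ENNReal.ofReal (Real.exp (2 * (T * K 0)) ^ Module.finrank ℝ E) with hD
  have hDtop : D ≠ ⊤ := ENNReal.mul_ne_top hB ENNReal.ofReal_ne_top
  have hopen : ∀ U : Set (E × E), IsOpen U → μ₀.map (Z t) U ≤ D * volume U := by
    intro U hU
    set S : ℕ → E × E → E × E :=
      fun n => splitIter K (fun k => μ₀.map (Z (k * (t / n)))) (t / n) n with hS
    have hiter : ∀ᶠ n : ℕ in atTop, Measurable (S n) ∧ μ₀ (S n ⁻¹' U) ≤ D * volume U := by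
      have hlarge : ∀ᶠ n : ℕ in atTop, 2 * (t * K 0) ≤ n :=
        tendsto_natCast_atTop_atTop.eventually_ge_atTop _
      filter_upwards [eventually_ge_atTop 1, hlarge] with n hn hnl
      have hn0 : (0 : ℝ) < n := by exact_mod_cast hn
      have hmem : ∀ k < n, (k : ℝ) * (t / n) ∈ Icc 0 T := fun k hk => by
        have hk' : (k : ℝ) ≤ n := by exact_mod_cast hk.le
        refine ⟨mul_nonneg k.cast_nonneg (div_nonneg ht.1 hn0.le), ?_⟩
        calc (k : ℝ) * (t / n) ≤ n * (t / n) := by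
              gcongr
              exact div_nonneg ht.1 hn0.le
          _ = t := by field_simp
          _ ≤ T := ht.2
      obtain ⟨m1, m2⟩ := map_splitIter_le hK (μ := fun k => μ₀.map (Z (k * (t / n)))) (n := n)
        (fun k hk => hZ.isProbabilityMeasure_map (hmem k hk)) (fun k hk => hdens _ (hmem k hk))
        (fun k hk => moment_map_lt_top (hZ.aemeas _ (hmem k hk)) (hZ.ae_norm_le (hmem k hk)))
        (h := t / n) (div_nonneg ht.1 hn0.le)
        (by rw [div_mul_eq_mul_div, div_le_iff₀ hn0]; linarith)
      refine ⟨m1, ?_⟩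
      have e2 := m2 U
      rw [Measure.map_apply m1 hU.measurableSet, Measure.smul_apply, smul_eq_mul] at e2
      have e3 : ENNReal.ofReal (Real.exp (2 * (t / n * K 0)) ^ Module.finrank ℝ E) ^ n ≤
          ENNReal.ofReal (Real.exp (2 * (T * K 0)) ^ Module.finrank ℝ E) := by
        rw [← ENNReal.ofReal_pow (by positivity), ← pow_mul, mul_comm (Module.finrank ℝ E),
          pow_mul, ← Real.exp_nat_mul]
        have e4 : (n : ℝ) * (2 * (t / n * K 0)) = 2 * (t * K 0) := by field_simp
        rw [e4]
        gcongr
        exact ht.2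
      calc μ₀ (S n ⁻¹' U) ≤ B * volume (S n ⁻¹' U) := hμ₀ _
        _ ≤ B * (ENNReal.ofReal (Real.exp (2 * (T * K 0)) ^ Module.finrank ℝ E) * volume U) := by
            gcongr
            exact e2.trans (by gcongr)
        _ = D * volume U := by rw [hD, mul_assoc]
    obtain ⟨n₀, hn₀⟩ := eventually_atTop.1 hiter
    calc μ₀.map (Z t) U = ∫⁻ p, U.indicator 1 (Z t p) ∂μ₀ := by
          rw [← lintegral_indicator_one hU.measurableSet, lintegral_map'
            (measurable_one.indicator hU.measurableSet).aemeasurable (hZ.aemeas t ht)]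
      _ ≤ ∫⁻ p, liminf (fun n => U.indicator (1 : E × E → ℝ≥0∞) (S (n + n₀) p)) atTop ∂μ₀ := by
          refine lintegral_mono_ae ?_
          filter_upwards [hZ.ae_mem] with p hp
          by_cases hU' : Z t p ∈ U
          · rw [indicator_of_mem hU', Pi.one_apply]
            refine le_liminf_of_le (by isBoundedDefault) ?_
            have := (tendsto_add_atTop_iff_nat n₀).2 (hZ.tendsto_splitIter hK hR hL hsh hp ht)
            filter_upwards [this (hU.mem_nhds hU')] with n hn
            rw [indicator_of_mem (by exact hn), Pi.one_apply]
          · simp [hU']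
      _ ≤ liminf (fun n => ∫⁻ p, U.indicator (1 : E × E → ℝ≥0∞) (S (n + n₀) p) ∂μ₀) atTop :=
          lintegral_liminf_le fun n =>
            (measurable_one.indicator hU.measurableSet).comp (hn₀ (n + n₀) (by omega)).1
      _ ≤ D * volume U := by
          refine liminf_le_of_le (by isBoundedDefault) fun b hb => ?_
          obtain ⟨n, hn⟩ := hb.exists
          refine hn.trans ((le_of_eq ?_).trans (hn₀ (n + n₀) (by omega)).2)
          rw [← lintegral_indicator_one ((hn₀ (n + n₀) (by omega)).1 hU.measurableSet)]
          rfl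
  refine Measure.le_iff.2 fun s _ => ?_
  have := Measure.OuterRegular.smul (volume : Measure (E × E)) hDtop
  rw [s.measure_eq_iInf_isOpen (D • volume)]
  refine le_iInf₂ fun U hsU => le_iInf fun hU => ?_
  exact (measure_mono hsU).trans (hopen U hU)

end IsBoundedFlow

end BoundedFlow

section UniformShell

variable {E : Type*} [NormedAddCommGroup E] [InnerProductSpace ℝ E] [FiniteDimensional ℝ E]
  [MeasureSpace E] [BorelSpace E] [(volume : Measure E).IsAddHaarMeasure] [Nontrivial E]
  {K : ℝ → ℝ} {LK : NNReal} {T : ℝ}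

theorem exists_shellBound (hK : IsWeight K LK) (T : ℝ) {R : ℝ} (hR : 0 < R) {B : ℝ≥0∞}
    (hB : B ≠ ⊤) : ∃ L : ℝ, 0 ≤ L ∧ ∀ (μ₀ : Measure (E × E)) [IsProbabilityMeasure μ₀]
      (Z : ℝ → E × E → E × E) (A : Set (E × E)), IsBoundedFlow K T μ₀ Z A R → μ₀ ≤ B • volume →
      ∀ t ∈ Icc 0 T, ShellBound (μ₀.map (Z t)) R L := by
  obtain ⟨L, hL, h⟩ := exists_shellBound_of_le (E := E)
    (ENNReal.mul_ne_top hB (ENNReal.ofReal_ne_top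
      (r := Real.exp (2 * (T * K 0)) ^ Module.finrank ℝ E))) hR
  refine ⟨L, hL, fun μ₀ _ Z A hZ hμ₀ t ht => ?_⟩
  have := hZ.isProbabilityMeasure_map ht
  refine h _ (hZ.map_le hK hR hB hμ₀ ht) ?_
  rw [ae_map_iff (hZ.aemeas t ht) (measurableSet_le measurable_norm measurable_const)]
  exact hZ.ae_norm_le ht

end UniformShell

section GronwallAE

open Filter Topology

variable {F : Type*} [NormedAddCommGroup F] [NormedSpace ℝ F]

theorem deriv_norm_le_of_hasDerivAt {g : ℝ → F} {g' : F} {t : ℝ} (hg : HasDerivAt g g' t)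
    (hn : DifferentiableAt ℝ (fun s => ‖g s‖) t) : deriv (fun s => ‖g s‖) t ≤ ‖g'‖ := by
  have h1 := hasDerivAt_iff_tendsto_slope.1 hn.hasDerivAt
  have h2 := (hasDerivAt_iff_tendsto_slope.1 hg).norm
  refine le_of_tendsto_of_tendsto h1 h2 (Eventually.of_forall fun s => ?_)
  change slope (fun s => ‖g s‖) t s ≤ ‖slope g t s‖
  rw [slope_def_field, slope_def_module, norm_smul, norm_inv, Real.norm_eq_abs, div_eq_inv_mul]
  refine (le_abs_self _).trans ?_
  rw [abs_mul, abs_inv]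
  gcongr
  exact abs_norm_sub_norm_le _ _

/-- Grönwall's inequality for Lipschitz curves whose derivative is controlled almost everywhere. -/
theorem norm_le_exp_of_ae_norm_deriv_le {T : ℝ} {g g' : ℝ → F} {C : NNReal}
    (hlip : LipschitzOnWith C g (Icc 0 T)) {a b : ℝ} (ha : 0 < a) (hb : 0 ≤ b)
    (hg : ∀ᵐ t ∂(volume.restrict (Icc (0 : ℝ) T)), HasDerivAt g (g' t) t ∧ ‖g' t‖ ≤ a * ‖g t‖ + b) :
    ∀ t ∈ Icc 0 T, ‖g t‖ ≤ (‖g 0‖ + b / a) * Real.exp (a * T) := by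
  intro t ht
  set u : ℝ → ℝ := fun s => ‖g s‖ with hu
  have hsub : uIcc 0 t ⊆ Icc 0 T := by
    rw [uIcc_of_le ht.1]
    exact Icc_subset_Icc le_rfl ht.2
  have hulip : LipschitzOnWith C u (uIcc 0 t) :=
    LipschitzOnWith.of_dist_le_mul fun x hx y hy => by
      refine (dist_norm_norm_le _ _).trans ?_
      rw [← dist_eq_norm]
      exact hlip.dist_le_mul x (hsub hx) y (hsub hy)
  have huac := hulip.absolutelyContinuousOnInterval
  have heac : AbsolutelyContinuousOnInterval (fun s => Real.exp (-(a * s))) 0 t := by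
    refine ContDiffOn.absolutelyContinuousOnInterval (ContDiff.contDiffOn ?_)
    fun_prop
  have hwac : AbsolutelyContinuousOnInterval (fun s => Real.exp (-(a * s)) * (u s + b / a)) 0 t := by
    refine heac.mul (huac.add ?_)
    exact (LipschitzWith.const (b / a)).lipschitzOnWith.absolutelyContinuousOnInterval
  have hint := hwac.integral_deriv_eq_sub
  have hle : ∫ s in (0 : ℝ)..t, deriv (fun s => Real.exp (-(a * s)) * (u s + b / a)) s ≤ 0 := by
    rw [intervalIntegral.integral_of_le ht.1]
    refine integral_nonpos_of_ae ?_
    have hgt := ae_restrict_of_ae_restrict_of_subset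
      (s := Ioc 0 t) (t := Icc 0 T) (fun s hs => ⟨hs.1.le, hs.2.trans ht.2⟩) hg
    filter_upwards [hgt, ae_restrict_of_ae huac.ae_differentiableAt,
      ae_restrict_mem measurableSet_Ioc] with s ⟨hs1, hs2⟩ hs3 hs4
    have hud : DifferentiableAt ℝ u s := hs3 (by rw [uIcc_of_le ht.1]; exact ⟨hs4.1.le, hs4.2⟩)
    have hu' := (deriv_norm_le_of_hasDerivAt hs1 hud).trans hs2
    have hexp : HasDerivAt (fun s => Real.exp (-(a * s))) (Real.exp (-(a * s)) * -(a * 1)) s :=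
      (((hasDerivAt_id s).const_mul a).neg).exp
    have hw := hexp.mul (hud.hasDerivAt.add_const (b / a))
    have hw' : deriv (fun s => Real.exp (-(a * s)) * (u s + b / a)) s = _ := hw.deriv
    rw [hw', Pi.zero_apply]
    have e1 : Real.exp (-(a * s)) * -(a * 1) * (u s + b / a) + Real.exp (-(a * s)) * deriv u s =
        Real.exp (-(a * s)) * (deriv u s - (a * u s + b)) := by
      field_simp
      ring
    rw [e1]
    exact mul_nonpos_of_nonneg_of_nonpos (Real.exp_pos _).le (by linarith)
  rw [hint] at hle
  simp only [mul_zero, neg_zero, Real.exp_zero, one_mul, sub_nonpos] at hle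
  have e2 : u t + b / a ≤ (u 0 + b / a) * Real.exp (a * t) := by
    have := mul_le_mul_of_nonneg_right hle (Real.exp_pos (a * t)).le
    rwa [mul_right_comm, ← Real.exp_add, neg_add_cancel, Real.exp_zero, one_mul] at this
  have e3 : Real.exp (a * t) ≤ Real.exp (a * T) := Real.exp_le_exp.2 (by gcongr; exact ht.2)
  have e4 : 0 ≤ b / a := by positivity
  have e5 : (u 0 + b / a) * Real.exp (a * t) ≤ (u 0 + b / a) * Real.exp (a * T) :=
    mul_le_mul_of_nonneg_left e3 (add_nonneg (norm_nonneg _) e4)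
  change u t ≤ (u 0 + b / a) * Real.exp (a * T)
  linarith

end GronwallAE

section Wasserstein

variable {X : Type*} [NormedAddCommGroup X] [MeasurableSpace X] [BorelSpace X]
  {μ ν : Measure X} [IsProbabilityMeasure μ] [IsProbabilityMeasure ν] {A : Set X} {r : ℝ}

theorem integral_sub_le_of_lipschitzWith (hA : ∀ p ∈ A, ‖p‖ ≤ r) (hμ : ∀ᵐ p ∂μ, p ∈ A)
    (hν : ∀ᵐ p ∂ν, p ∈ A) {φ : X → ℝ} (hφ : LipschitzWith 1 φ) :
    (∫ p, φ p ∂μ) - ∫ p, φ p ∂ν ≤ 2 * r := by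
  have key : ∀ (η : Measure X) [IsProbabilityMeasure η], (∀ᵐ p ∂η, p ∈ A) →
      |(∫ p, φ p ∂η) - φ 0| ≤ r := by
    intro η _ hη
    have hdiff : ∀ᵐ p ∂η, ‖φ p - φ 0‖ ≤ r := by
      filter_upwards [hη] with p hp
      refine (le_trans ?_ (hA p hp))
      simpa [dist_eq_norm] using hφ.dist_le_mul p 0
    have hint : Integrable (fun p => φ p - φ 0) η :=
      Integrable.of_bound (hφ.continuous.measurable.sub_const _).stronglyMeasurable.aestronglyMeasurable
        r hdiff
    have hint' : Integrable φ η :=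
      (hint.add (integrable_const (φ 0))).congr (ae_of_all _ fun p => by simp)
    have e : (∫ p, φ p ∂η) - φ 0 = ∫ p, (φ p - φ 0) ∂η := by
      rw [integral_sub hint' (integrable_const _)]
      simp
    rw [e, ← Real.norm_eq_abs]
    exact (norm_integral_le_of_norm_le_const hdiff).trans (by simp)
  have h1 := abs_le.1 (key μ hμ)
  have h2 := abs_le.1 (key ν hν)
  linarith [h1.2, h2.1]

theorem W1_nonneg_and_le (hA : ∀ p ∈ A, ‖p‖ ≤ r) (hμ : ∀ᵐ p ∂μ, p ∈ A)
    (hν : ∀ᵐ p ∂ν, p ∈ A) : 0 ≤ W1 μ ν ∧ W1 μ ν ≤ 2 * r := by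
  have hub : ∀ a ∈ {a : ℝ | ∃ φ : X → ℝ, LipschitzWith 1 φ ∧ (∃ C : ℝ, ∀ x, |φ x| ≤ C) ∧
      a = (∫ x, φ x ∂μ) - ∫ x, φ x ∂ν}, a ≤ 2 * r := by
    rintro a ⟨φ, hφ, -, rfl⟩
    exact integral_sub_le_of_lipschitzWith hA hμ hν hφ
  have h0 : (0 : ℝ) ∈ {a : ℝ | ∃ φ : X → ℝ, LipschitzWith 1 φ ∧ (∃ C : ℝ, ∀ x, |φ x| ≤ C) ∧
      a = (∫ x, φ x ∂μ) - ∫ x, φ x ∂ν} :=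
    ⟨fun _ => 0, LipschitzWith.const' 0, ⟨0, by simp⟩, by simp⟩
  exact ⟨le_csSup ⟨_, hub⟩ h0, csSup_le ⟨0, h0⟩ hub⟩

theorem integral_sub_le_mul_W1 (hA : ∀ p ∈ A, ‖p‖ ≤ r) (hμ : ∀ᵐ p ∂μ, p ∈ A)
    (hν : ∀ᵐ p ∂ν, p ∈ A) {φ : X → ℝ} {l : NNReal} (hl : 0 < l) (hφ : LipschitzOnWith l φ A) :
    (∫ p, φ p ∂μ) - ∫ p, φ p ∂ν ≤ l * W1 μ ν := by
  obtain ⟨g, hg, hgA⟩ := hφ.extend_real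
  set M : ℝ := |g 0| + l * r with hM
  have hgM : ∀ p ∈ A, |g p| ≤ M := fun p hp => by
    have h1 := hg.dist_le_mul p 0
    rw [Real.dist_eq, dist_zero_right] at h1
    have h2 : (l : ℝ) * ‖p‖ ≤ l * r := by gcongr; exact hA p hp
    have h3 := abs_sub_abs_le_abs_sub (g p) (g 0)
    linarith
  set G : X → ℝ := fun p => max (-M) (min (g p) M) with hG
  have hGlip : LipschitzWith l G := (hg.min_const M).const_max (-M)
  have hGA : ∀ p ∈ A, G p = φ p := fun p hp => by
    obtain ⟨h1, h2⟩ := abs_le.1 (hgM p hp)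
    rw [hgA hp, hG]
    simp only [min_eq_left h2, max_eq_right h1]
  have e1 : ∫ p, φ p ∂μ = ∫ p, G p ∂μ :=
    integral_congr_ae (by filter_upwards [hμ] with p hp using (hGA p hp).symm)
  have e2 : ∫ p, φ p ∂ν = ∫ p, G p ∂ν :=
    integral_congr_ae (by filter_upwards [hν] with p hp using (hGA p hp).symm)
  have hl' : (0 : ℝ) < l := hl
  have hmem : (∫ p, (l : ℝ)⁻¹ * G p ∂μ) - ∫ p, (l : ℝ)⁻¹ * G p ∂ν ≤ W1 μ ν := by
    refine le_csSup ⟨2 * r, ?_⟩ ⟨fun p => (l : ℝ)⁻¹ * G p, ?_, ⟨(l : ℝ)⁻¹ * |M|, fun p => ?_⟩, rfl⟩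
    · rintro a ⟨φ, hφ, -, rfl⟩
      exact integral_sub_le_of_lipschitzWith hA hμ hν hφ
    · refine LipschitzWith.of_dist_le_mul fun p q => ?_
      have := hGlip.dist_le_mul p q
      rw [Real.dist_eq] at this ⊢
      rw [← mul_sub, abs_mul, abs_of_pos (inv_pos.2 hl'), NNReal.coe_one, one_mul,
        inv_mul_le_iff₀ hl']
      exact this
    · rw [abs_mul, abs_of_pos (inv_pos.2 hl')]
      refine mul_le_mul_of_nonneg_left (abs_le.2 ⟨?_, ?_⟩) (inv_pos.2 hl').le
      · exact (neg_le_neg (le_abs_self M)).trans (le_max_left _ _)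
      · exact max_le (neg_le_abs M) ((min_le_right _ _).trans (le_abs_self M))
  rw [integral_const_mul, integral_const_mul, ← mul_sub, inv_mul_le_iff₀ hl'] at hmem
  rwa [e1, e2]

theorem norm_integral_sub_le_mul_W1 [SecondCountableTopology X] {E : Type*} [NormedAddCommGroup E]
    [InnerProductSpace ℝ E] [FiniteDimensional ℝ E] (hAm : MeasurableSet A)
    (hA : ∀ p ∈ A, ‖p‖ ≤ r) (hμ : ∀ᵐ p ∂μ, p ∈ A)
    (hν : ∀ᵐ p ∂ν, p ∈ A) {φ : X → E} {l : NNReal} (hl : 0 < l) (hφ : LipschitzOnWith l φ A)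
    {M : ℝ} (hφM : ∀ p ∈ A, ‖φ p‖ ≤ M) :
    ‖(∫ p, φ p ∂μ) - ∫ p, φ p ∂ν‖ ≤ l * W1 μ ν := by
  have hint : ∀ (η : Measure X) [IsProbabilityMeasure η], (∀ᵐ p ∂η, p ∈ A) → Integrable φ η := by
    intro η _ hη
    refine Integrable.of_bound ?_ M (by filter_upwards [hη] with p hp using hφM p hp)
    rw [← Measure.restrict_eq_self_of_ae_mem hη]
    exact hφ.continuousOn.aestronglyMeasurable hAm
  set D := (∫ p, φ p ∂μ) - ∫ p, φ p ∂ν with hD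
  have hl' : (0 : ℝ) < l := hl
  rcases eq_or_ne D 0 with h0 | h0
  · rw [h0, norm_zero]
    exact mul_nonneg hl'.le (W1_nonneg_and_le hA hμ hν).1
  · have hDpos : 0 < ‖D‖ := norm_pos_iff.2 h0
    have hlip : LipschitzOnWith (‖D‖₊ * l) (fun p => inner ℝ D (φ p)) A :=
      LipschitzOnWith.of_dist_le_mul fun p hp q hq => by
        rw [Real.dist_eq, ← inner_sub_right, NNReal.coe_mul, coe_nnnorm, mul_assoc]
        refine (abs_real_inner_le_norm _ _).trans ?_
        gcongr
        rw [← dist_eq_norm]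
        exact hφ.dist_le_mul p hp q hq
    have h1 := integral_sub_le_mul_W1 hA hμ hν (mul_pos (nnnorm_pos.2 h0) hl) hlip
    rw [integral_inner (hint μ hμ), integral_inner (hint ν hν), ← inner_sub_right, ← hD,
      real_inner_self_eq_norm_sq, NNReal.coe_mul, coe_nnnorm, mul_assoc, sq] at h1
    exact le_of_mul_le_mul_left h1 hDpos

end Wasserstein

section FlowLip

variable {E : Type*} [NormedAddCommGroup E] [InnerProductSpace ℝ E] [FiniteDimensional ℝ E]
  [MeasureSpace E] [BorelSpace E] [(volume : Measure E).IsAddHaarMeasure] [Nontrivial E]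
  {K : ℝ → ℝ} {LK : NNReal} {T : ℝ} {μ₀ : Measure (E × E)} [IsProbabilityMeasure μ₀]
  {Z : ℝ → E × E → E × E} {A : Set (E × E)} {R L : ℝ}

/-- The Lipschitz constant of the characteristics of a bounded flow. -/
def flowLip (K : ℝ → ℝ) (LK : NNReal) (R L T : ℝ) : NNReal :=
  (Real.exp ((1 + IsBoundedFlow.fieldLip K LK R L) * T)).toNNReal

theorem coe_flowLip : (flowLip K LK R L T : ℝ) =
    Real.exp ((1 + IsBoundedFlow.fieldLip K LK R L) * T) :=
  Real.coe_toNNReal _ (Real.exp_pos _).le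

theorem flowLip_pos : 0 < flowLip K LK R L T := Real.toNNReal_pos.2 (Real.exp_pos _)

theorem IsBoundedFlow.lipschitzOnWith (hK : IsWeight K LK) (hZ : IsBoundedFlow K T μ₀ Z A R)
    (hR : 0 < R) (hL : 0 ≤ L) (hsh : ∀ t ∈ Icc 0 T, ShellBound (μ₀.map (Z t)) R L) {t : ℝ}
    (ht : t ∈ Icc 0 T) : LipschitzOnWith (flowLip K LK R L T) (Z t) A := by
  refine LipschitzOnWith.of_dist_le_mul fun p hp q hq => ?_
  have hΛ := fieldLip_pos hK hR hL
  have := norm_le_exp_of_norm_deriv_le (T := T) (g := fun s => Z s p - Z s q)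
    (g' := fun s => ((Z s p).2, alignField K (μ₀.map (Z s)) (Z s p).1 (Z s p).2) -
      ((Z s q).2, alignField K (μ₀.map (Z s)) (Z s q).1 (Z s q).2))
    (a := 1 + fieldLip K LK R L) (b := 0) (by positivity) le_rfl
    (fun s hs => ((hZ.fst p s hs).prodMk (hZ.snd p s hs)).sub
      ((hZ.fst q s hs).prodMk (hZ.snd q s hs)))
    (fun s hs => by
      have h1 := hZ.norm_field_sub_le hK hR hL hsh hs hs (ρ := ‖Z s p - Z s q‖) (by simp)
        (z := Z s p) (hZ.norm_le q hq s hs) le_rfl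
      have h2 := norm_snd_le (Z s p - Z s q)
      have h3 := norm_nonneg (Z s p - Z s q)
      rw [add_zero, Prod.mk_sub_mk, Prod.norm_def]
      refine max_le (h2.trans ?_) (h1.trans ?_) <;> nlinarith) t ht
  rw [zero_div, add_zero, hZ.zero, hZ.zero] at this
  rw [coe_flowLip, dist_eq_norm, dist_eq_norm, mul_comm]
  exact this

/-- A Lipschitz cutoff equal to one on the cylinder of radius `s` and supported in that of radius
`s + η`. -/
def radialCutoff (c : E) (s η : ℝ) (q : E × E) : ℝ := max 0 (min ((s + η - dist q.1 c) / η) 1)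

theorem radialCutoff_mem (c : E) (s η : ℝ) (q : E × E) : radialCutoff c s η q ∈ Icc (0 : ℝ) 1 :=
  ⟨le_max_left _ _, max_le zero_le_one (min_le_right _ _)⟩

theorem lipschitzWith_radialCutoff (c : E) (s : ℝ) {η : ℝ} (hη : 0 < η) :
    LipschitzWith (η⁻¹).toNNReal (radialCutoff c s η) := by
  refine LipschitzWith.const_max (LipschitzWith.min_const ?_ 1) 0
  refine LipschitzWith.of_dist_le_mul fun p q => ?_
  rw [Real.coe_toNNReal _ (inv_pos.2 hη).le, Real.dist_eq, ← sub_div, abs_div, abs_of_pos hη,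
    inv_mul_eq_div]
  gcongr
  have := dist_dist_dist_le q.1 c p.1 c
  rw [dist_self, add_zero, Real.dist_eq] at this
  calc |s + η - dist p.1 c - (s + η - dist q.1 c)| = |dist q.1 c - dist p.1 c| := by
        congr 1; ring
    _ ≤ dist q.1 p.1 := this
    _ ≤ dist p q := by rw [dist_comm q.1]; exact le_max_left _ _

theorem indicator_le_radialCutoff (c : E) (s : ℝ) {η : ℝ} (hη : 0 < η) (q : E × E) :
    ({q | dist q.1 c ≤ s} : Set (E × E)).indicator 1 q ≤ radialCutoff c s η q := by
  by_cases h : dist q.1 c ≤ s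
  · rw [indicator_of_mem (by exact h)]
    refine le_max_of_le_right (le_min ?_ le_rfl)
    rw [Pi.one_apply, le_div_iff₀ hη]
    linarith
  · rw [indicator_of_notMem (by exact h)]
    exact (radialCutoff_mem c s η q).1

theorem radialCutoff_le_indicator (c : E) (s : ℝ) {η : ℝ} (hη : 0 < η) (q : E × E) :
    radialCutoff c s η q ≤ ({q | dist q.1 c ≤ s + η} : Set (E × E)).indicator 1 q := by
  by_cases h : dist q.1 c ≤ s + η
  · rw [indicator_of_mem (by exact h)]
    exact (radialCutoff_mem c s η q).2
  · rw [indicator_of_notMem (by exact h)]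
    refine max_le le_rfl (min_le_of_left_le ?_)
    exact div_nonpos_of_nonpos_of_nonneg (by linarith) hη.le

theorem ballMass_map_le_add {μ ν : Measure (E × E)} [IsProbabilityMeasure μ]
    [IsProbabilityMeasure ν] {Y : E × E → E × E} (hYμ : AEMeasurable Y μ) (hYν : AEMeasurable Y ν)
    (c : E) (s : ℝ) {η w : ℝ} (hη : 0 < η)
    (hw : |(∫ p, radialCutoff c s η (Y p) ∂μ) - ∫ p, radialCutoff c s η (Y p) ∂ν| ≤ w) :
    ballMass (μ.map Y) c s ≤ ballMass (ν.map Y) c (s + η) + w := by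
  have hcm : Measurable (radialCutoff c s η) := (lipschitzWith_radialCutoff c s hη).continuous.measurable
  have hci : ∀ (ρ : Measure (E × E)) [IsProbabilityMeasure ρ], AEMeasurable Y ρ →
      Integrable (fun p => radialCutoff c s η (Y p)) ρ := fun ρ _ h =>
    Integrable.of_bound (hcm.comp_aemeasurable h).aestronglyMeasurable 1 (ae_of_all _ fun p => by
      rw [Real.norm_of_nonneg (radialCutoff_mem c s η _).1]
      exact (radialCutoff_mem c s η _).2)
  have hii : ∀ (ρ : Measure (E × E)) [IsProbabilityMeasure ρ], AEMeasurable Y ρ → ∀ u : ℝ,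
      Integrable (fun p => ({q | dist q.1 c ≤ u} : Set (E × E)).indicator (1 : E × E → ℝ) (Y p)) ρ :=
    fun ρ _ h u => by
      have hm : MeasurableSet {q : E × E | dist q.1 c ≤ u} :=
        measurableSet_le (f := fun q : E × E => dist q.1 c) (by fun_prop) measurable_const
      refine Integrable.of_bound
        ((measurable_one.indicator hm).comp_aemeasurable h).aestronglyMeasurable 1
        (ae_of_all _ fun p => ?_)
      refine (norm_indicator_le_norm_self _ _).trans (by simp)
  have h1 : ballMass (μ.map Y) c s ≤ ∫ p, radialCutoff c s η (Y p) ∂μ := by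
    rw [ballMass_map hYμ]
    exact integral_mono (hii μ hYμ s) (hci μ hYμ) fun p => indicator_le_radialCutoff c s hη (Y p)
  have h2 : ∫ p, radialCutoff c s η (Y p) ∂ν ≤ ballMass (ν.map Y) c (s + η) := by
    rw [ballMass_map hYν]
    exact integral_mono (hci ν hYν) (hii ν hYν _) fun p => radialCutoff_le_indicator c s hη (Y p)
  linarith [(abs_le.1 hw).2]

end FlowLip

section Empirical

variable {d N : ℕ}

theorem isProbabilityMeasure_empPair (hN : 0 < N) (x v : Fin N → EuclideanSpace ℝ (Fin d)) :
    IsProbabilityMeasure (empPair x v) := by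
  refine ⟨?_⟩
  rw [empPair, Measure.smul_apply, Measure.finsetSum_apply]
  simp only [measure_univ, Finset.sum_const, Finset.card_univ, Fintype.card_fin, nsmul_eq_mul,
    mul_one, smul_eq_mul]
  exact ENNReal.inv_mul_cancel (by exact_mod_cast hN.ne') (ENNReal.natCast_ne_top N)

theorem integral_empPair {F : Type*} [NormedAddCommGroup F] [NormedSpace ℝ F] [CompleteSpace F]
    (x v : Fin N → EuclideanSpace ℝ (Fin d))
    (φ : EuclideanSpace ℝ (Fin d) × EuclideanSpace ℝ (Fin d) → F) :
    ∫ p, φ p ∂(empPair x v) = (N : ℝ)⁻¹ • ∑ i, φ (x i, v i) := by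
  rw [empPair, integral_smul_measure, integral_finsetSum_measure
    (fun i _ => integrable_dirac (by finiteness))]
  simp

theorem ae_empPair_mem {A : Set (EuclideanSpace ℝ (Fin d) × EuclideanSpace ℝ (Fin d))}
    (hA : MeasurableSet A) {x v : Fin N → EuclideanSpace ℝ (Fin d)} (h : ∀ i, (x i, v i) ∈ A) :
    ∀ᵐ p ∂(empPair x v), p ∈ A := by
  rw [ae_iff, empPair, Measure.smul_apply, Measure.finsetSum_apply]
  simp only [smul_eq_mul, mul_eq_zero]
  right
  refine Finset.sum_eq_zero fun i _ => ?_
  have : {a | a ∉ A} = Aᶜ := rfl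
  rw [this, Measure.dirac_apply' _ hA.compl]
  simp [h i]

theorem Mpart_eq_ballMass {x v : Fin N → EuclideanSpace ℝ (Fin d)} (hN : 0 < N)
    {Y : EuclideanSpace ℝ (Fin d) × EuclideanSpace ℝ (Fin d) →
      EuclideanSpace ℝ (Fin d) × EuclideanSpace ℝ (Fin d)} (hY : AEMeasurable Y (empPair x v))
    (c : EuclideanSpace ℝ (Fin d)) (s : ℝ) :
    Mpart (fun k => (Y (x k, v k)).1) c s = ballMass ((empPair x v).map Y) c s := by
  have := isProbabilityMeasure_empPair hN x v
  rw [ballMass_map hY, integral_empPair, Mpart, Finset.card_filter, smul_eq_mul, inv_mul_eq_div]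
  congr 1
  push_cast
  refine Finset.sum_congr rfl fun k _ => ?_
  by_cases h : dist (Y (x k, v k)).1 c ≤ s
  · rw [if_pos h, indicator_of_mem (by exact h), Pi.one_apply]
  · rw [if_neg h, indicator_of_notMem (by exact h)]

theorem Mpart_mem (Y : Fin N → EuclideanSpace ℝ (Fin d)) (c : EuclideanSpace ℝ (Fin d)) (s : ℝ) :
    Mpart Y c s ∈ Icc (0 : ℝ) 1 := by
  refine ⟨by unfold Mpart; positivity, div_le_one_of_le₀ ?_ N.cast_nonneg⟩
  exact_mod_cast (Finset.card_filter_le _ _).trans (by simp)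

theorem Mpart_le_of_imp {Y Y' : Fin N → EuclideanSpace ℝ (Fin d)} {c c' : EuclideanSpace ℝ (Fin d)}
    {s s' : ℝ} (h : ∀ k, dist (Y k) c ≤ s → dist (Y' k) c' ≤ s') : Mpart Y c s ≤ Mpart Y' c' s' := by
  refine div_le_div_of_nonneg_right ?_ N.cast_nonneg
  exact_mod_cast Finset.card_le_card fun k hk => by
    simp only [Finset.mem_filter, Finset.mem_univ, true_and] at hk ⊢
    exact h k hk

end Empirical

section Consistency

variable {d N : ℕ} [Nontrivial (EuclideanSpace ℝ (Fin d))]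
  {K : ℝ → ℝ} {LK : NNReal} {T : ℝ}
  {μ₀ : Measure (EuclideanSpace ℝ (Fin d) × EuclideanSpace ℝ (Fin d))} [IsProbabilityMeasure μ₀]
  {Z : ℝ → EuclideanSpace ℝ (Fin d) × EuclideanSpace ℝ (Fin d) →
    EuclideanSpace ℝ (Fin d) × EuclideanSpace ℝ (Fin d)}
  {A : Set (EuclideanSpace ℝ (Fin d) × EuclideanSpace ℝ (Fin d))} {R L r : ℝ}
  {x v : Fin N → EuclideanSpace ℝ (Fin d)}

theorem LipschitzOnWith.aemeasurable_of_ae_mem {X Y : Type*} [MetricSpace X] [MeasurableSpace X]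
    [BorelSpace X] [MetricSpace Y] [MeasurableSpace Y] [BorelSpace Y] {μ : Measure X} {A : Set X}
    {f : X → Y} {l : NNReal} (hf : LipschitzOnWith l f A) (hA : MeasurableSet A)
    (hμ : ∀ᵐ p ∂μ, p ∈ A) : AEMeasurable f μ := by
  rw [← Measure.restrict_eq_self_of_ae_mem hμ]
  exact hf.continuousOn.aemeasurable hA

theorem abs_Mpart_sub_ballMass_le (hK : IsWeight K LK) (hZ : IsBoundedFlow K T μ₀ Z A R)
    (hR : 0 < R) (hL : 0 ≤ L) (hsh : ∀ t ∈ Icc 0 T, ShellBound (μ₀.map (Z t)) R L)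
    (hAm : MeasurableSet A) (hA : ∀ p ∈ A, ‖p‖ ≤ r) (hN : 0 < N) (hxv : ∀ i, (x i, v i) ∈ A)
    {t : ℝ} (ht : t ∈ Icc 0 T) {Y : Fin N → EuclideanSpace ℝ (Fin d)} {ε η : ℝ} (hη : 0 < η)
    (hY : ∀ k, ‖Y k - (Z t (x k, v k)).1‖ ≤ ε) (i j : Fin N) :
    |Mpart Y (Y i) (dist (Y i) (Y j)) - ballMass (μ₀.map (Z t)) (Z t (x i, v i)).1
      (dist (Z t (x i, v i)).1 (Z t (x j, v j)).1)| ≤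
      L * (4 * ε + η) + η⁻¹ * flowLip K LK R L T * W1 μ₀ (empPair x v) := by
  have hlip := hZ.lipschitzOnWith hK hR hL hsh ht
  have hν := isProbabilityMeasure_empPair hN x v
  have hνA := ae_empPair_mem hAm hxv
  have hZν := hlip.aemeasurable_of_ae_mem hAm hνA
  set w := W1 μ₀ (empPair x v) with hw
  set c := (Z t (x i, v i)).1 with hc
  have hcR : ‖c‖ ≤ R := (norm_fst_le _).trans (hZ.norm_le _ (hxv i) t ht)
  have hcut : ∀ s, |(∫ p, radialCutoff c s η (Z t p) ∂μ₀) -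
      ∫ p, radialCutoff c s η (Z t p) ∂(empPair x v)| ≤ η⁻¹ * flowLip K LK R L T * w := by
    intro s
    have h := norm_integral_sub_le_mul_W1 (E := ℝ) hAm hA hZ.ae_mem hνA
      (mul_pos (Real.toNNReal_pos.2 (inv_pos.2 hη)) flowLip_pos)
      ((lipschitzWith_radialCutoff c s hη).comp_lipschitzOnWith hlip) (M := 1) fun p _ => by
        rw [Function.comp_apply, Real.norm_of_nonneg (radialCutoff_mem c s η _).1]
        exact (radialCutoff_mem c s η _).2
    rw [NNReal.coe_mul, Real.coe_toNNReal _ (inv_pos.2 hη).le] at h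
    exact h
  have hε : 0 ≤ ε := (norm_nonneg _).trans (hY i)
  have hd : ∀ k, dist (Y k) (Z t (x k, v k)).1 ≤ ε := fun k => by rw [dist_eq_norm]; exact hY k
  set ρ := dist (Y i) (Y j) with hρ
  set ρ' := dist c (Z t (x j, v j)).1 with hρ'
  have hρρ : |ρ - ρ'| ≤ 2 * ε := by
    have := dist_dist_dist_le (Y i) (Y j) c (Z t (x j, v j)).1
    rw [Real.dist_eq] at this
    linarith [hd i, hd j]
  obtain ⟨h1, h2⟩ := abs_le.1 hρρ
  have hup : Mpart Y (Y i) ρ ≤ Mpart (fun k => (Z t (x k, v k)).1) c (ρ + 2 * ε) :=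
    Mpart_le_of_imp fun k hk => by
      have := dist_triangle4 (Z t (x k, v k)).1 (Y k) (Y i) c
      rw [dist_comm _ (Y k)] at this
      linarith [hd k, hd i]
  have hlow : Mpart (fun k => (Z t (x k, v k)).1) c (ρ - 2 * ε) ≤ Mpart Y (Y i) ρ :=
    Mpart_le_of_imp fun k hk => by
      have := dist_triangle4 (Y k) (Z t (x k, v k)).1 c (Y i)
      rw [dist_comm c (Y i)] at this
      linarith [hd k, hd i]
  rw [Mpart_eq_ballMass hN hZν] at hup hlow
  have hup' := ballMass_map_le_add hZν (hZ.aemeas t ht) c (ρ + 2 * ε) hη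
    (w := η⁻¹ * flowLip K LK R L T * w) (by rw [abs_sub_comm]; exact hcut _)
  have hlow' := ballMass_map_le_add (hZ.aemeas t ht) hZν c (ρ - 2 * ε - η) hη (hcut _)
  rw [sub_add_cancel] at hlow'
  have hp := hZ.isProbabilityMeasure_map ht
  have e1 := (hsh t ht).abs_sub_le (x := c) hcR (r := ρ + 2 * ε + η) (r' := ρ')
    (δ := 4 * ε + η) (abs_le.2 ⟨by linarith, by linarith⟩)
  have e2 := (hsh t ht).abs_sub_le (x := c) hcR (r := ρ - 2 * ε - η) (r' := ρ')
    (δ := 4 * ε + η) (abs_le.2 ⟨by linarith, by linarith⟩)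
  rw [dist_self, zero_add] at e1 e2
  rw [abs_le] at e1 e2 ⊢
  constructor <;> linarith [e1.1, e1.2, e2.1, e2.2]

theorem norm_sum_sub_alignField_le (hK : IsWeight K LK) (hZ : IsBoundedFlow K T μ₀ Z A R)
    (hR : 0 < R) (hL : 0 ≤ L) (hsh : ∀ t ∈ Icc 0 T, ShellBound (μ₀.map (Z t)) R L)
    (hAm : MeasurableSet A) (hA : ∀ p ∈ A, ‖p‖ ≤ r) (hN : 0 < N) (hxv : ∀ i, (x i, v i) ∈ A)
    {t : ℝ} (ht : t ∈ Icc 0 T) {U : Fin N → EuclideanSpace ℝ (Fin d)} {ε θ : ℝ}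
    (hU : ∀ k, ‖U k - (Z t (x k, v k)).2‖ ≤ ε) (i : Fin N) {κ : Fin N → ℝ}
    (hκ : ∀ j, |κ j| ≤ K 0) (hκθ : ∀ j, |κ j - K (ballMass (μ₀.map (Z t)) (Z t (x i, v i)).1
      (dist (Z t (x i, v i)).1 (Z t (x j, v j)).1))| ≤ LK * θ) :
    ‖(N : ℝ)⁻¹ • ∑ j, κ j • (U j - U i) -
      alignField K (μ₀.map (Z t)) (Z t (x i, v i)).1 (Z t (x i, v i)).2‖ ≤
      2 * K 0 * ε + LK * θ * (2 * R) +
        (LK * L * (2 * R) + K 0) * flowLip K LK R L T * W1 μ₀ (empPair x v) := by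
  have hK0 := hK.zero_pos
  have hlip := hZ.lipschitzOnWith hK hR hL hsh ht
  have hν := isProbabilityMeasure_empPair hN x v
  have hνA := ae_empPair_mem hAm hxv
  have hp := hZ.isProbabilityMeasure_map ht
  set zi := Z t (x i, v i) with hzi
  have hziR : ‖zi‖ ≤ R := hZ.norm_le _ (hxv i) t ht
  set ψ : EuclideanSpace ℝ (Fin d) × EuclideanSpace ℝ (Fin d) → EuclideanSpace ℝ (Fin d) :=
    fun q => K (ballMass (μ₀.map (Z t)) zi.1 (dist zi.1 q.1)) • (q.2 - zi.2) with hψ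
  have hψb : ∀ q : EuclideanSpace ℝ (Fin d) × EuclideanSpace ℝ (Fin d), ‖q‖ ≤ R → ‖q.2 - zi.2‖ ≤ 2 * R := fun q hq => by
    linarith [norm_sub_le q.2 zi.2, norm_snd_le q, norm_snd_le zi]
  have hl0 : 0 < LK * L * (2 * R) + K 0 := by positivity
  have hψlip : LipschitzOnWith (LK * L * (2 * R) + K 0).toNNReal ψ {q | ‖q‖ ≤ R} := by
    refine LipschitzOnWith.of_dist_le_mul fun q hq q' hq' => ?_
    rw [Real.coe_toNNReal _ hl0.le, dist_eq_norm, dist_eq_norm]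
    have hdd : |dist zi.1 q.1 - dist zi.1 q'.1| ≤ ‖q - q'‖ := by
      have := dist_dist_dist_le zi.1 q.1 zi.1 q'.1
      rw [dist_self, zero_add, Real.dist_eq, dist_eq_norm q.1] at this
      exact this.trans (norm_fst_le (q - q'))
    have hm := (hsh t ht).abs_sub_le (x := zi.1) ((norm_fst_le _).trans hziR) hdd
    rw [dist_self, zero_add] at hm
    have hKd := (hK.abs_sub_le (ballMass_mem (μ := μ₀.map (Z t)) zi.1 (dist zi.1 q.1))
      (ballMass_mem (μ := μ₀.map (Z t)) zi.1 (dist zi.1 q'.1))).trans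
      (mul_le_mul_of_nonneg_left hm LK.coe_nonneg)
    have e : ψ q - ψ q' = (K (ballMass (μ₀.map (Z t)) zi.1 (dist zi.1 q.1)) -
        K (ballMass (μ₀.map (Z t)) zi.1 (dist zi.1 q'.1))) • (q.2 - zi.2) +
        K (ballMass (μ₀.map (Z t)) zi.1 (dist zi.1 q'.1)) • (q.2 - q'.2) := by
      simp only [hψ]
      module
    rw [e]
    refine (norm_add_le _ _).trans ?_
    rw [norm_smul, norm_smul, Real.norm_eq_abs, Real.norm_eq_abs]
    calc _ ≤ LK * (L * ‖q - q'‖) * (2 * R) + K 0 * ‖q - q'‖ := by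
          gcongr
          · exact hψb q hq
          · exact abs_weight_le hK _ _
          · exact norm_snd_le (q - q')
      _ = _ := by ring
  have hquad := norm_integral_sub_le_mul_W1 hAm hA hZ.ae_mem hνA
    (mul_pos (Real.toNNReal_pos.2 hl0) flowLip_pos)
    (hψlip.comp hlip fun p hp => hZ.norm_le p hp t ht) (M := K 0 * (2 * R)) fun p hp => by
      rw [Function.comp_apply, norm_smul]
      exact mul_le_mul (abs_weight_le hK _ _) (hψb _ (hZ.norm_le p hp t ht)) (norm_nonneg _) hK0.le
  rw [NNReal.coe_mul, Real.coe_toNNReal _ hl0.le, integral_empPair, norm_sub_rev] at hquad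
  have hfield : ∫ p, (ψ ∘ Z t) p ∂μ₀ = alignField K (μ₀.map (Z t)) zi.1 zi.2 :=
    (alignField_map hK (hZ.aemeas t ht) zi.1 zi.2).symm
  rw [hfield] at hquad
  have hN' : (0 : ℝ) < N := by exact_mod_cast hN
  have hsum : ‖(N : ℝ)⁻¹ • ∑ j, κ j • (U j - U i) - (N : ℝ)⁻¹ • ∑ j, (ψ ∘ Z t) (x j, v j)‖ ≤
      2 * K 0 * ε + LK * θ * (2 * R) := by
    rw [← smul_sub, ← Finset.sum_sub_distrib, norm_smul, norm_inv, Real.norm_of_nonneg hN'.le,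
      inv_mul_le_iff₀ hN']
    calc _ ≤ ∑ j : Fin N, (2 * K 0 * ε + LK * θ * (2 * R)) := by
          refine (norm_sum_le _ _).trans (Finset.sum_le_sum fun j _ => ?_)
          have e : κ j • (U j - U i) - (ψ ∘ Z t) (x j, v j) =
              κ j • ((U j - (Z t (x j, v j)).2) - (U i - zi.2)) +
              (κ j - K (ballMass (μ₀.map (Z t)) zi.1 (dist zi.1 (Z t (x j, v j)).1))) •
                ((Z t (x j, v j)).2 - zi.2) := by
            simp only [hψ, Function.comp_apply]
            module
          rw [e]
          refine (norm_add_le _ _).trans ?_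
          rw [norm_smul, norm_smul, Real.norm_eq_abs, Real.norm_eq_abs]
          have h1 : ‖(U j - (Z t (x j, v j)).2) - (U i - zi.2)‖ ≤ 2 * ε := by
            linarith [norm_sub_le (U j - (Z t (x j, v j)).2) (U i - zi.2), hU i, hU j]
          have h2 := mul_le_mul (hκ j) h1 (norm_nonneg _) hK0.le
          have h3 := mul_le_mul (hκθ j) (hψb _ (hZ.norm_le _ (hxv j) t ht)) (norm_nonneg _)
            ((abs_nonneg _).trans (hκθ j))
          linarith
      _ = _ := by simp [mul_add]
  calc _ ≤ _ := norm_sub_le_norm_sub_add_norm_sub _ ((N : ℝ)⁻¹ • ∑ j, (ψ ∘ Z t) (x j, v j)) _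
    _ ≤ _ := add_le_add hsum hquad

end Consistency

/-- The Grönwall rate for the deviation of a particle system from the mean-field flow. -/
def particleRate (K : ℝ → ℝ) (LK : NNReal) (R L : ℝ) : ℝ := 1 + 2 * K 0 + 8 * LK * L * R

/-- The consistency error of a particle system at Wasserstein distance `w` from the mean-field
datum, the ball masses being smoothed at scale `η`. -/
def particleError (K : ℝ → ℝ) (LK : NNReal) (R L T η w : ℝ) : ℝ :=
  2 * R * LK * (L * η + η⁻¹ * flowLip K LK R L T * w) +
    (LK * L * (2 * R) + K 0) * flowLip K LK R L T * w

theorem le_mul_sqrt_of_forall_le {y c w D : ℝ} (hc : 0 ≤ c) (hw : 0 ≤ w) (hwD : w ≤ D)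
    (h : ∀ η, 0 < η → y ≤ c * (η + η⁻¹ * w + w)) : y ≤ c * (2 + √D) * √w := by
  rcases hw.eq_or_lt with rfl | hw'
  · simp only [mul_zero, add_zero, Real.sqrt_zero] at h ⊢
    refine le_of_forall_pos_le_add fun ε hε => ?_
    refine (h (ε / (c + 1)) (by positivity)).trans ?_
    rw [zero_add, mul_div_assoc', div_le_iff₀ (by positivity)]
    nlinarith
  · have h0 := Real.sqrt_pos.2 hw'
    have h1 := h √w h0
    have h2 : (√w)⁻¹ * w = √w := by
      rw [inv_mul_eq_iff_eq_mul₀ h0.ne', Real.mul_self_sqrt hw]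
    have h3 : w ≤ √D * √w := by
      calc w = √w * √w := (Real.mul_self_sqrt hw).symm
        _ ≤ _ := by gcongr
    rw [h2] at h1
    refine h1.trans ?_
    rw [mul_assoc]
    gcongr
    linarith

section Stability

variable {d N : ℕ} [Nontrivial (EuclideanSpace ℝ (Fin d))]
  {K : ℝ → ℝ} {LK : NNReal} {T : ℝ}
  {μ₀ : Measure (EuclideanSpace ℝ (Fin d) × EuclideanSpace ℝ (Fin d))} [IsProbabilityMeasure μ₀]
  {Z : ℝ → EuclideanSpace ℝ (Fin d) × EuclideanSpace ℝ (Fin d) →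
    EuclideanSpace ℝ (Fin d) × EuclideanSpace ℝ (Fin d)}
  {A : Set (EuclideanSpace ℝ (Fin d) × EuclideanSpace ℝ (Fin d))} {R L r : ℝ}
  {x v : Fin N → EuclideanSpace ℝ (Fin d)}

theorem particleRate_pos (hK : IsWeight K LK) (hR : 0 < R) (hL : 0 ≤ L) :
    0 < particleRate K LK R L := by
  have := hK.zero_pos
  unfold particleRate
  positivity

theorem particleError_nonneg (hK : IsWeight K LK) (hR : 0 < R) (hL : 0 ≤ L) {η w : ℝ}
    (hη : 0 < η) (hw : 0 ≤ w) : 0 ≤ particleError K LK R L T η w := by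
  have := hK.zero_pos
  unfold particleError
  positivity

theorem exists_particleError_le (hK : IsWeight K LK) (hR : 0 < R) (hL : 0 ≤ L) (T : ℝ) :
    ∃ c, 0 < c ∧ ∀ η w, 0 < η → 0 ≤ w →
      particleError K LK R L T η w ≤ c * (η + η⁻¹ * w + w) := by
  have hK0 := hK.zero_pos
  refine ⟨1 + 2 * R * LK * (L + flowLip K LK R L T) +
    (LK * L * (2 * R) + K 0) * flowLip K LK R L T, by positivity, fun η w hη hw => ?_⟩
  have hF := (flowLip K LK R L T).coe_nonneg
  set F := (flowLip K LK R L T).toReal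
  have hu : 0 ≤ η⁻¹ * w := by positivity
  have h1 : 0 ≤ 2 * R * LK * L * (η⁻¹ * w + w) := by positivity
  have h2 : 0 ≤ 2 * R * LK * F * (η + w) := by positivity
  have h3 : 0 ≤ (LK * L * (2 * R) + K 0) * F * (η + η⁻¹ * w) := by positivity
  unfold particleError
  nlinarith

theorem norm_velocity_sub_le (hK : IsWeight K LK) (hZ : IsBoundedFlow K T μ₀ Z A R)
    (hR : 0 < R) (hL : 0 ≤ L) (hsh : ∀ t ∈ Icc 0 T, ShellBound (μ₀.map (Z t)) R L)
    (hAm : MeasurableSet A) (hA : ∀ p ∈ A, ‖p‖ ≤ r) (hN : 0 < N) (hxv : ∀ i, (x i, v i) ∈ A)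
    {t : ℝ} (ht : t ∈ Icc 0 T) {Y U : Fin N → EuclideanSpace ℝ (Fin d)} {η : ℝ} (hη : 0 < η)
    {m : Fin N → Fin N → ℝ} (hm : ∀ i j, m i j ∈ Icc (0 : ℝ) 1)
    (hmθ : ∀ i j, |m i j - ballMass (μ₀.map (Z t)) (Z t (x i, v i)).1
      (dist (Z t (x i, v i)).1 (Z t (x j, v j)).1)| ≤
        L * (4 * ‖fun i => (Y i, U i) - Z t (x i, v i)‖ + η) +
          η⁻¹ * flowLip K LK R L T * W1 μ₀ (empPair x v)) :
    ‖fun i => ((U i, (N : ℝ)⁻¹ • ∑ j, K (m i j) • (U j - U i)) :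
        EuclideanSpace ℝ (Fin d) × EuclideanSpace ℝ (Fin d)) -
      ((Z t (x i, v i)).2, alignField K (μ₀.map (Z t)) (Z t (x i, v i)).1 (Z t (x i, v i)).2)‖ ≤
      particleRate K LK R L * ‖fun i => (Y i, U i) - Z t (x i, v i)‖ +
        particleError K LK R L T η (W1 μ₀ (empPair x v)) := by
  have hK0 := hK.zero_pos
  have hp := hZ.isProbabilityMeasure_map ht
  have hν := isProbabilityMeasure_empPair hN x v
  have hw := (W1_nonneg_and_le hA hZ.ae_mem (ae_empPair_mem hAm hxv)).1
  have herr := particleError_nonneg (T := T) hK hR hL hη hw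
  set w := W1 μ₀ (empPair x v)
  set ε := ‖fun i => (Y i, U i) - Z t (x i, v i)‖ with hε
  have hε0 : 0 ≤ ε := norm_nonneg _
  have hg : ∀ k, ‖(Y k, U k) - Z t (x k, v k)‖ ≤ ε := fun k =>
    norm_le_pi_norm (fun i => (Y i, U i) - Z t (x i, v i)) k
  have hrate : ε ≤ particleRate K LK R L * ε := by
    have : 0 ≤ (2 * K 0 + 8 * LK * L * R) * ε := by positivity
    unfold particleRate
    linarith
  refine (pi_norm_le_iff_of_nonneg (by linarith)).2 fun i => norm_prod_le_iff.2 ⟨?_, ?_⟩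
  · exact ((norm_snd_le _).trans (hg i)).trans (by linarith)
  · refine (norm_sum_sub_alignField_le hK hZ hR hL hsh hAm hA hN hxv ht (U := U) (ε := ε)
      (θ := L * (4 * ε + η) + η⁻¹ * flowLip K LK R L T * w)
      (fun k => (norm_snd_le _).trans (hg k)) i (κ := fun j => K (m i j)) (fun j => ?_)
      fun j => ?_).trans ?_
    · rw [abs_of_pos (hK.pos _ (hm i j))]
      exact hK.le_zero (hm i j)
    · exact (hK.abs_sub_le (hm i j) (ballMass_mem _ _)).trans
        (mul_le_mul_of_nonneg_left (hmθ i j) LK.coe_nonneg)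
    · unfold particleRate particleError
      linarith

theorem norm_intermediate_sub_flow_le (hK : IsWeight K LK) (hZ : IsBoundedFlow K T μ₀ Z A R)
    (hR : 0 < R) (hL : 0 ≤ L) (hsh : ∀ t ∈ Icc 0 T, ShellBound (μ₀.map (Z t)) R L)
    (hAm : MeasurableSet A) (hA : ∀ p ∈ A, ‖p‖ ≤ r) (hN : 0 < N) (hxv : ∀ i, (x i, v i) ∈ A)
    {X V : Fin N → ℝ → EuclideanSpace ℝ (Fin d)} (h0 : ∀ i, X i 0 = x i ∧ V i 0 = v i)
    (hX : ∀ t ∈ Icc 0 T, ∀ i, HasDerivWithinAt (X i) (V i t) (Icc 0 T) t ∧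
      HasDerivWithinAt (V i) ((N : ℝ)⁻¹ • ∑ j, K (ballMass (μ₀.map (Z t)) (X i t)
        (dist (X i t) (X j t))) • (V j t - V i t)) (Icc 0 T) t) {η : ℝ} (hη : 0 < η) :
    ∀ t ∈ Icc 0 T, ‖fun i => (X i t, V i t) - Z t (x i, v i)‖ ≤
      particleError K LK R L T η (W1 μ₀ (empPair x v)) / particleRate K LK R L *
        Real.exp (particleRate K LK R L * T) := by
  have hν := isProbabilityMeasure_empPair hN x v
  have hw := (W1_nonneg_and_le hA hZ.ae_mem (ae_empPair_mem hAm hxv)).1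
  intro t ht
  refine (norm_le_exp_of_norm_deriv_le
    (g := fun τ i => (X i τ, V i τ) - Z τ (x i, v i))
    (particleRate_pos hK hR hL) (particleError_nonneg (T := T) hK hR hL hη hw)
    (fun s hs => hasDerivWithinAt_pi.2 fun i => ((hX s hs i).1.prodMk (hX s hs i).2).sub
      ((hZ.fst (x i, v i) s hs).prodMk (hZ.snd (x i, v i) s hs)))
    (fun s hs => ?_) t ht).trans_eq ?_
  · have hp := hZ.isProbabilityMeasure_map hs
    refine norm_velocity_sub_le hK hZ hR hL hsh hAm hA hN hxv hs
      (Y := fun i => X i s) (U := fun i => V i s) hη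
      (m := fun i j => ballMass (μ₀.map (Z s)) (X i s) (dist (X i s) (X j s)))
      (fun i j => ballMass_mem _ _) fun i j => ?_
    set ε := ‖fun i => (X i s, V i s) - Z s (x i, v i)‖ with hε
    have hε0 : 0 ≤ ε := norm_nonneg _
    have hg : ∀ k, dist (X k s) (Z s (x k, v k)).1 ≤ ε := fun k => by
      rw [dist_eq_norm]
      exact (norm_fst_le ((X k s, V k s) - Z s (x k, v k))).trans
        (norm_le_pi_norm (fun i => (X i s, V i s) - Z s (x i, v i)) k)
    have hdd := dist_dist_dist_le (X i s) (X j s) (Z s (x i, v i)).1 (Z s (x j, v j)).1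
    rw [Real.dist_eq] at hdd
    refine ((hsh s hs).abs_sub_le ((norm_fst_le _).trans (hZ.norm_le _ (hxv i) s hs))
      hdd).trans ?_
    have e1 : 0 ≤ η⁻¹ * flowLip K LK R L T * W1 μ₀ (empPair x v) := by positivity
    have e2 : dist (X i s) (Z s (x i, v i)).1 + (dist (X i s) (Z s (x i, v i)).1 +
        dist (X j s) (Z s (x j, v j)).1) ≤ 4 * ε + η := by
      linarith [hg i, hg j]
    linarith [mul_le_mul_of_nonneg_left e2 hL]
  · have : (fun i => (X i 0, V i 0) - Z 0 (x i, v i)) =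
        (0 : Fin N → EuclideanSpace ℝ (Fin d) × EuclideanSpace ℝ (Fin d)) := by
      ext1 i
      rw [hZ.zero, (h0 i).1, (h0 i).2, sub_self, Pi.zero_apply]
    simp only [this, norm_zero, zero_add]

theorem norm_particle_sub_flow_le (hK : IsWeight K LK) (hZ : IsBoundedFlow K T μ₀ Z A R)
    (hR : 0 < R) (hL : 0 ≤ L) (hsh : ∀ t ∈ Icc 0 T, ShellBound (μ₀.map (Z t)) R L)
    (hAm : MeasurableSet A) (hA : ∀ p ∈ A, ‖p‖ ≤ r) (hN : 0 < N) (hxv : ∀ i, (x i, v i) ∈ A)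
    {X V : Fin N → ℝ → EuclideanSpace ℝ (Fin d)} (h0 : ∀ i, X i 0 = x i ∧ V i 0 = v i)
    (hXlip : ∀ i, ∃ l : NNReal, LipschitzOnWith l (X i) (Icc 0 T))
    (hVlip : ∀ i, ∃ l : NNReal, LipschitzOnWith l (V i) (Icc 0 T))
    (hX : ∀ᵐ t ∂(volume.restrict (Icc (0 : ℝ) T)), ∀ i, HasDerivAt (X i) (V i t) t ∧
      HasDerivAt (V i) (CSforce K (fun k => X k t) (fun k => V k t) i) t)
    {η : ℝ} (hη : 0 < η) :
    ∀ t ∈ Icc 0 T, ‖fun i => (X i t, V i t) - Z t (x i, v i)‖ ≤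
      particleError K LK R L T η (W1 μ₀ (empPair x v)) / particleRate K LK R L *
        Real.exp (particleRate K LK R L * T) := by
  have hK0 := hK.zero_pos
  have hν := isProbabilityMeasure_empPair hN x v
  have hw := (W1_nonneg_and_le hA hZ.ae_mem (ae_empPair_mem hAm hxv)).1
  choose lX hlX using hXlip
  choose lV hlV using hVlip
  have hZlip : ∀ i, LipschitzOnWith (R + K 0 * (2 * R)).toNNReal (fun τ => Z τ (x i, v i))
      (Icc 0 T) := fun i => LipschitzOnWith.of_dist_le_mul fun s hs t ht => by
    rw [Real.coe_toNNReal _ (by positivity), dist_eq_norm, Real.dist_eq]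
    exact hZ.norm_sub_le hK hR (hxv i) hs ht
  have hglip : ∃ l, LipschitzOnWith l (fun τ i => (X i τ, V i τ) - Z τ (x i, v i)) (Icc 0 T) := by
    refine ⟨∑ i, (max (lX i) (lV i) + (R + K 0 * (2 * R)).toNNReal),
      LipschitzOnWith.of_dist_le_mul fun s hs t ht => ?_⟩
    refine (dist_pi_le_iff (by positivity)).2 fun i => ?_
    have h1 := (((hlX i).prodMk (hlV i)).sub (hZlip i)).dist_le_mul s hs t ht
    refine h1.trans (mul_le_mul_of_nonneg_right (NNReal.coe_le_coe.2 ?_) dist_nonneg)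
    exact Finset.single_le_sum
      (f := fun i => max (lX i) (lV i) + (R + K 0 * (2 * R)).toNNReal)
      (fun _ _ => zero_le) (Finset.mem_univ i)
  obtain ⟨l, hl⟩ := hglip
  intro t ht
  refine (norm_le_exp_of_ae_norm_deriv_le hl (particleRate_pos hK hR hL)
    (particleError_nonneg (T := T) hK hR hL hη hw)
    (g' := fun s i => (V i s, CSforce K (fun k => X k s) (fun k => V k s) i) -
      ((Z s (x i, v i)).2, alignField K (μ₀.map (Z s)) (Z s (x i, v i)).1 (Z s (x i, v i)).2))
    ?_ t ht).trans_eq ?_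
  · rw [← restrict_Ioo_eq_restrict_Icc] at hX ⊢
    filter_upwards [hX, ae_restrict_mem measurableSet_Ioo] with s hXs hs
    have hs' := Ioo_subset_Icc_self hs
    have hnhds := Icc_mem_nhds hs.1 hs.2
    refine ⟨hasDerivAt_pi.2 fun i => ((hXs i).1.prodMk (hXs i).2).sub
      (((hZ.fst (x i, v i) s hs').hasDerivAt hnhds).prodMk
        ((hZ.snd (x i, v i) s hs').hasDerivAt hnhds)), ?_⟩
    refine norm_velocity_sub_le hK hZ hR hL hsh hAm hA hN hxv hs'
      (Y := fun i => X i s) (U := fun i => V i s) hη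
      (m := fun i j => Mpart (fun k => X k s) (X i s) (dist (X i s) (X j s)))
      (fun i j => Mpart_mem _ _ _) fun i j => ?_
    exact abs_Mpart_sub_ballMass_le hK hZ hR hL hsh hAm hA hN hxv hs' (Y := fun k => X k s) hη
      (fun k => (norm_fst_le ((X k s, V k s) - Z s (x k, v k))).trans
        (norm_le_pi_norm (fun i => (X i s, V i s) - Z s (x i, v i)) k)) i j
  · have : (fun i => (X i 0, V i 0) - Z 0 (x i, v i)) =
        (0 : Fin N → EuclideanSpace ℝ (Fin d) × EuclideanSpace ℝ (Fin d)) := by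
      ext1 i
      rw [hZ.zero, (h0 i).1, (h0 i).2, sub_self, Pi.zero_apply]
    simp only [this, norm_zero, zero_add]

/-- Both particle systems stay at distance of order `√W₁` from the mean-field flow. -/
theorem exists_dist_le_mul_sqrt_W1 (hK : IsWeight K LK) (T : ℝ) (hR : 0 < R) (hL : 0 ≤ L)
    (hAm : MeasurableSet A) (hA : ∀ p ∈ A, ‖p‖ ≤ r) :
    ∃ C : ℝ, 0 < C ∧
      ∀ (μ₀ : Measure (EuclideanSpace ℝ (Fin d) × EuclideanSpace ℝ (Fin d)))
        [IsProbabilityMeasure μ₀] (Z : ℝ → EuclideanSpace ℝ (Fin d) × EuclideanSpace ℝ (Fin d) →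
          EuclideanSpace ℝ (Fin d) × EuclideanSpace ℝ (Fin d)),
        IsBoundedFlow K T μ₀ Z A R → (∀ t ∈ Icc 0 T, ShellBound (μ₀.map (Z t)) R L) →
      ∀ (N : ℕ), 0 < N → ∀ (x v : Fin N → EuclideanSpace ℝ (Fin d)), (∀ i, (x i, v i) ∈ A) →
      ∀ (Xf Vf : Fin N → ℝ → EuclideanSpace ℝ (Fin d)), (∀ i, Xf i 0 = x i ∧ Vf i 0 = v i) →
        (∀ t ∈ Icc 0 T, ∀ i, HasDerivWithinAt (Xf i) (Vf i t) (Icc 0 T) t ∧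
          HasDerivWithinAt (Vf i) ((N : ℝ)⁻¹ • ∑ j, K (ballMass (μ₀.map (Z t)) (Xf i t)
            (dist (Xf i t) (Xf j t))) • (Vf j t - Vf i t)) (Icc 0 T) t) →
      ∀ (XN VN : Fin N → ℝ → EuclideanSpace ℝ (Fin d)), (∀ i, XN i 0 = x i ∧ VN i 0 = v i) →
        (∀ i, ∃ l : NNReal, LipschitzOnWith l (XN i) (Icc 0 T)) →
        (∀ i, ∃ l : NNReal, LipschitzOnWith l (VN i) (Icc 0 T)) →
        (∀ᵐ t ∂(volume.restrict (Icc (0 : ℝ) T)), ∀ i, HasDerivAt (XN i) (VN i t) t ∧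
          HasDerivAt (VN i) (CSforce K (fun k => XN k t) (fun k => VN k t) i) t) →
      ∀ t ∈ Icc 0 T, ∀ i, dist (Xf i t) (XN i t) + dist (Vf i t) (VN i t) ≤
        C * √(W1 μ₀ (empPair x v)) := by
  have ha := particleRate_pos hK hR hL
  obtain ⟨c, hc, hcb⟩ := exists_particleError_le hK hR hL T
  set e := c / particleRate K LK R L * Real.exp (particleRate K LK R L * T) with he
  have he0 : 0 < e := by positivity
  refine ⟨4 * e * (2 + √(2 * r)), by positivity, fun μ₀ _ Z hZ hsh N hN x v hxv Xf Vf hf0 hf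
    XN VN hN0 hXN hVN hpart t ht i => ?_⟩
  have hν := isProbabilityMeasure_empPair hN x v
  obtain ⟨hw, hwr⟩ := W1_nonneg_and_le hA hZ.ae_mem (ae_empPair_mem hAm hxv)
  refine le_mul_sqrt_of_forall_le (by positivity) hw hwr fun η hη => ?_
  have herr : particleError K LK R L T η (W1 μ₀ (empPair x v)) / particleRate K LK R L *
      Real.exp (particleRate K LK R L * T) ≤ e * (η + η⁻¹ * W1 μ₀ (empPair x v) +
        W1 μ₀ (empPair x v)) := by
    calc _ ≤ c * (η + η⁻¹ * W1 μ₀ (empPair x v) + W1 μ₀ (empPair x v)) / particleRate K LK R L *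
          Real.exp (particleRate K LK R L * T) := by
          gcongr
          exact hcb η _ hη hw
      _ = _ := by rw [he]; ring
  have h1 := ((norm_le_pi_norm _ i).trans (norm_intermediate_sub_flow_le hK hZ hR hL hsh hAm hA hN
    hxv hf0 hf hη t ht)).trans herr
  have h2 := ((norm_le_pi_norm _ i).trans (norm_particle_sub_flow_le hK hZ hR hL hsh hAm hA hN
    hxv hN0 hXN hVN hpart hη t ht)).trans herr
  have h3 : ‖((Xf i t, Vf i t) : EuclideanSpace ℝ (Fin d) × EuclideanSpace ℝ (Fin d)) -
      (XN i t, VN i t)‖ ≤ _ := (norm_sub_le_norm_sub_add_norm_sub _ (Z t (x i, v i)) _).trans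
    (add_le_add h1 ((norm_sub_rev _ _).trans_le h2))
  have h4 := (norm_fst_le _).trans h3
  have h5 := (norm_snd_le _).trans h3
  rw [dist_eq_norm, dist_eq_norm]
  simp only [Prod.fst_sub, Prod.snd_sub] at h4 h5
  linarith

end Stability

section Density

variable {X : Type*} [MeasurableSpace X] {ν : Measure X} {g : X → ℝ}

theorem isProbabilityMeasure_withDensity_ofReal (hg : Integrable g ν) (h0 : ∀ p, 0 ≤ g p)
    (h1 : ∫ p, g p ∂ν = 1) :
    IsProbabilityMeasure (ν.withDensity fun p => ENNReal.ofReal (g p)) :=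
  ⟨by rw [withDensity_apply _ MeasurableSet.univ, Measure.restrict_univ,
    ← ofReal_integral_eq_lintegral_ofReal hg (ae_of_all _ h0), h1, ENNReal.ofReal_one]⟩

theorem integral_withDensity_ofReal {F : Type*} [NormedAddCommGroup F] [NormedSpace ℝ F]
    (hg : Measurable g) (h0 : ∀ p, 0 ≤ g p) (φ : X → F) :
    ∫ p, φ p ∂(ν.withDensity fun p => ENNReal.ofReal (g p)) = ∫ p, g p • φ p ∂ν := by
  rw [integral_withDensity_eq_integral_toReal_smul hg.ennreal_ofReal (by simp)]
  simp only [ENNReal.toReal_ofReal (h0 _)]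

theorem withDensity_ofReal_le_smul {B : ℝ} (hB : ∀ᵐ p ∂ν, g p ≤ B) :
    ν.withDensity (fun p => ENNReal.ofReal (g p)) ≤ ENNReal.ofReal B • ν := by
  rw [← withDensity_const]
  exact withDensity_mono (hB.mono fun p hp => ENNReal.ofReal_le_ofReal hp)

theorem aemeasurable_of_forall_integral_eq {Y : Type*} [TopologicalSpace Y] {g₁ : Y → ℝ}
    [MeasurableSpace Y] {ν₁ : Measure Y} (hg : Measurable g) (h0 : ∀ p, 0 ≤ g p)
    (h0' : ∀ p, 0 ≤ g₁ p) (h1 : ∫ p, g₁ p ∂ν₁ = 1) {z : X → Y} [OpensMeasurableSpace Y]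
    (hz : ∀ α : Y → ℝ, Continuous α → (∃ C : ℝ, ∀ p, |α p| ≤ C) →
      ∫ p, α p * g₁ p ∂ν₁ = ∫ p, α (z p) * g p ∂ν)
    {α : Y → ℝ} (hα : Continuous α) {C : ℝ} (hC : ∀ p, |α p| ≤ C) :
    AEMeasurable (fun p => α (z p)) (ν.withDensity fun p => ENNReal.ofReal (g p)) := by
  have hg₁ : Integrable g₁ ν₁ := Integrable.of_integral_ne_zero (by rw [h1]; exact one_ne_zero)
  have hβ : ∀ p, 1 ≤ α p + (C + 1) ∧ |α p + (C + 1)| ≤ 2 * C + 1 := fun p => by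
    obtain ⟨h, h'⟩ := abs_le.1 (hC p)
    exact ⟨by linarith, abs_le.2 ⟨by linarith, by linarith⟩⟩
  have hβc : Continuous fun p => α p + (C + 1) := by fun_prop
  have hint : Integrable (fun p => (α p + (C + 1)) * g₁ p) ν₁ :=
    hg₁.bdd_mul hβc.measurable.aestronglyMeasurable (ae_of_all _ fun p => (hβ p).2)
  have hge : 1 ≤ ∫ p, (α p + (C + 1)) * g₁ p ∂ν₁ := by
    refine h1.ge.trans ?_
    exact integral_mono hg₁ hint fun p => le_mul_of_one_le_left (h0' p) (hβ p).1
  rw [hz _ hβc ⟨_, fun p => (hβ p).2⟩] at hge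
  have hintz : Integrable (fun p => (α (z p) + (C + 1)) * g p) ν :=
    Integrable.of_integral_ne_zero (by linarith)
  have := (integrable_withDensity_iff_integrable_smul' (μ := ν)
    (f := fun p => ENNReal.ofReal (g p)) hg.ennreal_ofReal (by simp)
    (g := fun p => α (z p) + (C + 1))).2 (by
      simpa only [ENNReal.toReal_ofReal (h0 _), smul_eq_mul, mul_comm] using hintz)
  simpa using this.aemeasurable.sub_const (C + 1)

end Density

section WeakSolution

variable {d : ℕ} {K : ℝ → ℝ} {LK : NNReal} {T : ℝ}
  {f₀ g : EuclideanSpace ℝ (Fin d) × EuclideanSpace ℝ (Fin d) → ℝ}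

/-- The measure on phase space with density `g`. -/
def phaseMeasure (g : EuclideanSpace ℝ (Fin d) × EuclideanSpace ℝ (Fin d) → ℝ) :
    Measure (EuclideanSpace ℝ (Fin d) × EuclideanSpace ℝ (Fin d)) :=
  volume.withDensity fun p => ENNReal.ofReal (g p)

theorem Mdens_Smarg (hg : Integrable g) (h0 : ∀ p, 0 ≤ g p) (x : EuclideanSpace ℝ (Fin d))
    (s : ℝ) : Mdens (Smarg g) x s = ballMass (phaseMeasure g) x s := by
  have hset : {q : EuclideanSpace ℝ (Fin d) × EuclideanSpace ℝ (Fin d) | dist q.1 x ≤ s} =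
      closedBall x s ×ˢ univ := by
    ext q
    simp
  have hm : MeasurableSet (closedBall x s ×ˢ (univ : Set (EuclideanSpace ℝ (Fin d)))) :=
    measurableSet_closedBall.prod MeasurableSet.univ
  have hprod := setIntegral_prod (μ := volume) (ν := volume) g (s := closedBall x s) (t := univ)
    hg.integrableOn
  simp only [Measure.restrict_univ] at hprod
  rw [ballMass, hset, phaseMeasure, measureReal_def, withDensity_apply _ hm,
    ← ofReal_integral_eq_lintegral_ofReal hg.integrableOn (ae_of_all _ h0),
    ENNReal.toReal_ofReal (integral_nonneg h0), Measure.volume_eq_prod, hprod]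
  rfl

theorem Wfield_eq_alignField (hgm : Measurable g) (hg : Integrable g) (h0 : ∀ p, 0 ≤ g p)
    (x v : EuclideanSpace ℝ (Fin d)) :
    Wfield K (Smarg g) g x v = alignField K (phaseMeasure g) x v := by
  unfold Wfield alignField
  conv_rhs => rw [phaseMeasure, integral_withDensity_ofReal hgm h0]
  simp only [Mdens_Smarg hg h0, smul_smul, mul_comm, phaseMeasure]

theorem WfieldMeas_empPair {N : ℕ} (hg : Integrable g) (h0 : ∀ p, 0 ≤ g p)
    (y u : Fin N → EuclideanSpace ℝ (Fin d)) (x v : EuclideanSpace ℝ (Fin d)) :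
    WfieldMeas K (Smarg g) (empPair y u) x v =
      (N : ℝ)⁻¹ • ∑ j, K (ballMass (phaseMeasure g) x (dist x (y j))) • (u j - v) := by
  rw [WfieldMeas, integral_empPair]
  simp only [Mdens_Smarg hg h0]

theorem aemeasurable_of_forall_coord {X : Type*} [MeasurableSpace X] {μ : Measure X}
    {z : X → EuclideanSpace ℝ (Fin d)} (hz : ∀ j, AEMeasurable (fun p => Real.arctan (z p j)) μ) :
    AEMeasurable z μ := by
  have h : AEMeasurable (fun p j => z p j) μ := aemeasurable_pi_iff.2 fun j => by
    have hm : Measurable Real.tan := by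
      rw [funext Real.tan_eq_sin_div_cos]
      fun_prop
    have := hm.comp_aemeasurable (hz j)
    simpa only [Function.comp_def, Real.tan_arctan] using this
  exact (MeasurableEquiv.toLp 2 (Fin d → ℝ)).measurable.comp_aemeasurable h

theorem aemeasurable_flow {z : EuclideanSpace ℝ (Fin d) × EuclideanSpace ℝ (Fin d) →
      EuclideanSpace ℝ (Fin d) × EuclideanSpace ℝ (Fin d)}
    (hf₀ : Measurable f₀) (h0 : ∀ p, 0 ≤ f₀ p) (h0' : ∀ p, 0 ≤ g p) (h1 : ∫ p, g p = 1)
    (hz : ∀ α : EuclideanSpace ℝ (Fin d) × EuclideanSpace ℝ (Fin d) → ℝ, Continuous α →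
      (∃ C : ℝ, ∀ p, |α p| ≤ C) → ∫ p, α p * g p = ∫ p, α (z p) * f₀ p) :
    AEMeasurable z (phaseMeasure f₀) := by
  have hC : ∀ y : ℝ, |Real.arctan y| ≤ Real.pi / 2 := fun y =>
    abs_le.2 ⟨(Real.neg_pi_div_two_lt_arctan y).le, (Real.arctan_lt_pi_div_two y).le⟩
  refine AEMeasurable.prodMk (f := fun p => (z p).1) (g := fun p => (z p).2)
    (aemeasurable_of_forall_coord fun j => ?_) (aemeasurable_of_forall_coord fun j => ?_)
  · exact aemeasurable_of_forall_integral_eq hf₀ h0 h0' h1 hz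
      (α := fun q => Real.arctan (q.1 j)) (by fun_prop) fun q => hC _
  · exact aemeasurable_of_forall_integral_eq hf₀ h0 h0' h1 hz
      (α := fun q => Real.arctan (q.2 j)) (by fun_prop) fun q => hC _

theorem map_phaseMeasure {z : EuclideanSpace ℝ (Fin d) × EuclideanSpace ℝ (Fin d) →
      EuclideanSpace ℝ (Fin d) × EuclideanSpace ℝ (Fin d)}
    (hf₀ : Measurable f₀) (h0 : ∀ p, 0 ≤ f₀ p) (hf₀1 : ∫ p, f₀ p = 1) (hg : Measurable g)
    (h0' : ∀ p, 0 ≤ g p) (h1 : ∫ p, g p = 1)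
    (hz : ∀ α : EuclideanSpace ℝ (Fin d) × EuclideanSpace ℝ (Fin d) → ℝ, Continuous α →
      (∃ C : ℝ, ∀ p, |α p| ≤ C) → ∫ p, α p * g p = ∫ p, α (z p) * f₀ p) :
    (phaseMeasure f₀).map z = phaseMeasure g := by
  have hzm := aemeasurable_flow hf₀ h0 h0' h1 hz
  have hp : IsProbabilityMeasure (phaseMeasure f₀) := isProbabilityMeasure_withDensity_ofReal
    (Integrable.of_integral_ne_zero (by rw [hf₀1]; exact one_ne_zero)) h0 hf₀1
  have hp' : IsProbabilityMeasure (phaseMeasure g) := isProbabilityMeasure_withDensity_ofReal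
    (Integrable.of_integral_ne_zero (by rw [h1]; exact one_ne_zero)) h0' h1
  have := Measure.isProbabilityMeasure_map hzm
  refine ext_of_forall_integral_eq_of_IsFiniteMeasure fun φ => ?_
  rw [integral_map hzm φ.continuous.measurable.aestronglyMeasurable, phaseMeasure, phaseMeasure,
    integral_withDensity_ofReal hf₀ h0, integral_withDensity_ofReal hg h0']
  simp only [smul_eq_mul, mul_comm (f₀ _), mul_comm (g _)]
  exact (hz φ φ.continuous ⟨‖φ‖, φ.norm_coe_le_norm⟩).symm

/-- The characteristics of a weak solution form a flow whose laws are the phase measures of the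
solution. -/
theorem IsWeakSolCS.exists_isFlow {f : ℝ → EuclideanSpace ℝ (Fin d) × EuclideanSpace ℝ (Fin d) → ℝ}
    (hf₀ : Measurable f₀) (h0 : ∀ p, 0 ≤ f₀ p) (hf₀1 : ∫ p, f₀ p = 1)
    (hf : IsWeakSolCS K T f₀ f) :
    ∃ Z, IsFlow K T (phaseMeasure f₀) Z ∧
      ∀ t ∈ Icc 0 T, (phaseMeasure f₀).map (Z t) = phaseMeasure (f t) := by
  obtain ⟨hdens, ⟨C, hC⟩, -, Z, hZ0, hZ, hpush⟩ := hf
  have hmap : ∀ t ∈ Icc 0 T, (phaseMeasure f₀).map (Z t) = phaseMeasure (f t) := fun t ht =>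
    map_phaseMeasure hf₀ h0 hf₀1 (hdens t ht).1 (hdens t ht).2.1 (hdens t ht).2.2 (hpush t ht)
  refine ⟨Z, ⟨hZ0, fun t ht => aemeasurable_flow hf₀ h0 (hdens t ht).2.1 (hdens t ht).2.2
    (hpush t ht), fun p t ht => (hZ p t ht).1, fun p t ht => ?_, ENNReal.ofReal C,
    ENNReal.ofReal_ne_top, fun t ht => ?_⟩, hmap⟩
  · obtain ⟨hm, h0', h1⟩ := hdens t ht
    rw [hmap t ht, ← Wfield_eq_alignField hm
      (Integrable.of_integral_ne_zero (by rw [h1]; exact one_ne_zero)) h0']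
    exact (hZ p t ht).2
  · rw [hmap t ht]
    exact withDensity_ofReal_le_smul (hC t ht)

end WeakSolution

/-- Under the setup of Statement 17, if moreover `(X^N_i,V^N_i)`
solve the topological Cucker–Smale `N`-agent system (for a.e. `t`) with the same
initial data, then
`δ(t) = max_i (|X^f_i−X^N_i| + |V^f_i−V^N_i|) ≤ C(T) √(W₁(f₀,μ^N₀))` on `[0,T]`,
with `C(T)` depending only on `T`, `R_x`, `R_v` and `‖f₀‖_∞`. -/
theorem particle_intermediate_distance_estimate {d : ℕ} (K : ℝ → ℝ)
    (hKpos : ∀ z ∈ Set.Icc (0:ℝ) 1, 0 < K z)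
    (hKanti : AntitoneOn K (Set.Icc (0:ℝ) 1))
    (LK : NNReal) (hKlip : LipschitzOnWith LK K (Set.Icc (0:ℝ) 1))
    (T Rx Rv B : ℝ) (hT : 0 < T) (hRx : 0 < Rx) (hRv : 0 < Rv) (hB : 0 < B) :
    ∃ C : ℝ, 0 < C ∧
      ∀ (f₀ : EuclideanSpace ℝ (Fin d) × EuclideanSpace ℝ (Fin d) → ℝ),
        Measurable f₀ → (∀ p, 0 ≤ f₀ p) → (∫ p, f₀ p) = 1 →
        (∀ᵐ p ∂volume, f₀ p ≤ B) →
        (∀ p, f₀ p ≠ 0 → p ∈ closedBall (0 : EuclideanSpace ℝ (Fin d)) Rx ×ˢ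
          closedBall (0 : EuclideanSpace ℝ (Fin d)) Rv) →
      ∀ (f : ℝ → EuclideanSpace ℝ (Fin d) × EuclideanSpace ℝ (Fin d) → ℝ),
        IsWeakSolCS K T f₀ f →
      ∀ (N : ℕ), 0 < N →
      ∀ (x v : Fin N → EuclideanSpace ℝ (Fin d)),
        (∀ i, x i ∈ closedBall (0 : EuclideanSpace ℝ (Fin d)) Rx) →
        (∀ i, v i ∈ closedBall (0 : EuclideanSpace ℝ (Fin d)) Rv) →
      ∀ (Xf Vf : Fin N → ℝ → EuclideanSpace ℝ (Fin d)),
        (∀ i, Xf i 0 = x i ∧ Vf i 0 = v i) →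
        (∀ t ∈ Set.Icc 0 T, ∀ i,
          HasDerivWithinAt (Xf i) (Vf i t) (Set.Icc 0 T) t ∧
          HasDerivWithinAt (Vf i)
            (WfieldMeas K (Smarg (f t))
              (empPair (fun k => Xf k t) (fun k => Vf k t)) (Xf i t) (Vf i t))
            (Set.Icc 0 T) t) →
      ∀ (XN VN : Fin N → ℝ → EuclideanSpace ℝ (Fin d)),
        (∀ i, XN i 0 = x i ∧ VN i 0 = v i) →
        (∀ i, ∃ L : NNReal, LipschitzOnWith L (XN i) (Set.Icc 0 T)) →
        (∀ i, ∃ L : NNReal, LipschitzOnWith L (VN i) (Set.Icc 0 T)) →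
        (∀ᵐ t ∂(volume.restrict (Set.Icc (0:ℝ) T)), ∀ i,
          HasDerivAt (XN i) (VN i t) t ∧
          HasDerivAt (VN i)
            (CSforce K (fun k => XN k t) (fun k => VN k t) i) t) →
      ∀ t ∈ Set.Icc 0 T, ∀ i,
        dist (Xf i t) (XN i t) + dist (Vf i t) (VN i t) ≤
          C * Real.sqrt
            (W1 (volume.withDensity fun p => ENNReal.ofReal (f₀ p)) (empPair x v)) := by
  have hK : IsWeight K LK := ⟨hKpos, hKanti, hKlip⟩
  rcases subsingleton_or_nontrivial (EuclideanSpace ℝ (Fin d)) with _ | _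
  · refine ⟨1, one_pos, fun f₀ _ _ _ _ _ f _ N _ x v _ _ Xf Vf _ _ XN VN _ _ _ _ t _ i => ?_⟩
    rw [Subsingleton.elim (Xf i t) (XN i t), Subsingleton.elim (Vf i t) (VN i t), dist_self,
      dist_self, add_zero, one_mul]
    exact Real.sqrt_nonneg _
  obtain ⟨R, hR, hflow⟩ :=
    exists_radius (E := EuclideanSpace ℝ (Fin d)) hK hT Rx Rv hRx hRv
  obtain ⟨L, hL, hshell⟩ := exists_shellBound (E := EuclideanSpace ℝ (Fin d)) hK T hR
    (ENNReal.ofReal_ne_top (r := B))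
  obtain ⟨C, hC, hdist⟩ := exists_dist_le_mul_sqrt_W1 (L := L) hK T hR hL
    (A := closedBall (0 : EuclideanSpace ℝ (Fin d)) Rx ×ˢ
      closedBall (0 : EuclideanSpace ℝ (Fin d)) Rv) (r := max Rx Rv)
    (measurableSet_closedBall.prod measurableSet_closedBall) fun p hp =>
      max_le_max (mem_closedBall_zero_iff.1 hp.1) (mem_closedBall_zero_iff.1 hp.2)
  refine ⟨C, hC, fun f₀ hf₀ h0 hf₀1 hf₀B hsupp f hf N hN x v hx hv Xf Vf hf0 hfd XN VN hN0 hXN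
    hVN hpart => ?_⟩
  have hprob : IsProbabilityMeasure (phaseMeasure f₀) := isProbabilityMeasure_withDensity_ofReal
    (Integrable.of_integral_ne_zero (by rw [hf₀1]; exact one_ne_zero)) h0 hf₀1
  obtain ⟨Z, hZ, hmap⟩ := hf.exists_isFlow hf₀ h0 hf₀1
  have hae : ∀ᵐ p ∂(phaseMeasure f₀), p ∈ closedBall (0 : EuclideanSpace ℝ (Fin d)) Rx ×ˢ
      closedBall (0 : EuclideanSpace ℝ (Fin d)) Rv :=
    (ae_withDensity_iff hf₀.ennreal_ofReal).2 (ae_of_all _ fun p hp =>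
      hsupp p fun h => hp (by rw [h, ENNReal.ofReal_zero]))
  have hZb := hflow _ Z hZ hae
  refine hdist _ Z hZb (hshell _ Z _ hZb (withDensity_ofReal_le_smul hf₀B)) N hN x v
    (fun i => ⟨hx i, hv i⟩) Xf Vf hf0 (fun t ht i => ⟨(hfd t ht i).1, ?_⟩) XN VN hN0 hXN hVN hpart
  obtain ⟨-, h0', h1⟩ := hf.1 t ht
  rw [hmap t ht, ← WfieldMeas_empPair
    (Integrable.of_integral_ne_zero (by rw [h1]; exact one_ne_zero)) h0'
    (fun k => Xf k t) (fun k => Vf k t)]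
  exact (hfd t ht i).2
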